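/- arXiv:1803.06264 — 2 statements merged into one kernel-verified Lean document; each statement's English description precedes it below -/
import Mathlib

section
/- Let q, p ∈ ℕ ∪ {∞}. A continuous function f : 𝔻̃ × 𝔻̃ → ℂ is positive definite on Ω_{2q} × Ω_{2p} if, and only if, it admits an expansion f(ξ,η) = Σ_{m,n,k,l∈ℤ₊} a_{m,n,k,l} R_{m,n}^{q−2}(ξ) R_{k,l}^{p−2}(η) with all a_{m,n,k,l} ≥ 0 and Σ a_{m,n,k,l} < ∞, with the additional requirement that a_{m,n,k,l} = 0 whenever q = 1 and mn > 0, and whenever p = 1 and kl > 0. Here 𝔻̃ denotes ∂𝔻 in a slot where the corresponding sphere is Ω₂ (q = 1 or p = 1) and 𝔻 otherwise. -/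
open scoped ComplexOrder

noncomputable section

/-- The Hilbert space ℓ²(ℂ) of square–summable complex sequences. -/
abbrev Ell2 : Type := lp (fun _ : ℕ => ℂ) 2

/-- The Hermitian inner product of the paper: `hdot z w = z·w = Σ_j z_j conj(w_j)`. -/
def hdot (z w : Ell2) : ℂ := @inner ℂ _ _ w z

/-- The sphere `Ω_{2q}` (for `q : ℕ∞`), viewed inside ℓ²(ℂ): the unit vectors supported
on the first `q` coordinates; for `q = ⊤` this is the unit sphere `Ω_∞` of ℓ²(ℂ). -/
def Omega (q : ℕ∞) : Set Ell2 :=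
  {z | ‖z‖ = 1 ∧ ∀ j : ℕ, q ≤ (j : ℕ∞) → z j = 0}

/-- A kernel `K` is positive definite on a set `S`. -/
def IsPDKernel {α : Type*} (S : Set α) (K : α → α → ℂ) : Prop :=
  ∀ (L : ℕ) (x : Fin L → α), (∀ i, x i ∈ S) → Function.Injective x →
    ∀ c : Fin L → ℂ, 0 ≤ ∑ μ, ∑ ν, c μ * (starRingEnd ℂ) (c ν) * K (x μ) (x ν)

/-- A kernel `K` is strictly positive definite on a set `S`. -/
def IsSPDKernel {α : Type*} (S : Set α) (K : α → α → ℂ) : Prop :=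
  IsPDKernel S K ∧
    ∀ (L : ℕ) (x : Fin L → α), (∀ i, x i ∈ S) → Function.Injective x →
      ∀ c : Fin L → ℂ,
        ∑ μ, ∑ ν, c μ * (starRingEnd ℂ) (c ν) * K (x μ) (x ν) = 0 → c = 0

/-- `f` is positive definite on `Ω_{2q} × Ω_{2p}`. -/
def PDonProd (q p : ℕ∞) (f : ℂ → ℂ → ℂ) : Prop :=
  IsPDKernel ((Omega q) ×ˢ (Omega p))
    (fun x y => f (hdot x.1 y.1) (hdot x.2 y.2))

/-- `f` is strictly positive definite on `Ω_{2q} × Ω_{2p}`. -/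
def SPDonProd (q p : ℕ∞) (f : ℂ → ℂ → ℂ) : Prop :=
  IsSPDKernel ((Omega q) ×ˢ (Omega p))
    (fun x y => f (hdot x.1 y.1) (hdot x.2 y.2))

/-- `g` is positive definite on `Ω_{2q}`. -/
def PDonSphere (q : ℕ∞) (g : ℂ → ℂ) : Prop :=
  IsPDKernel (Omega q) (fun z z' => g (hdot z z'))

/-- The Jacobi polynomial of degree `k` with (integer) parameters `α, β`, normalized
so that its value at `1` is `1`. -/
def jacobiR (α β k : ℕ) (x : ℝ) : ℝ :=
  (∑ s ∈ Finset.range (k + 1),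
      ((k + α).choose (k - s) : ℝ) * ((k + β).choose s : ℝ) *
        ((x - 1) / 2) ^ s * ((x + 1) / 2) ^ (k - s)) /
    ((k + α).choose k : ℝ)

/-- The disc polynomial `R_{m,n}^{q-2}`; for `q = ⊤` (and also `q = 1`) it is
`ξ^m conj(ξ)^n`.  For `2 ≤ q < ⊤` it equals
`r^{|m-n|} e^{i(m-n)φ} R_{min(m,n)}^{(q-2,|m-n|)}(2r²-1)` for `ξ = r e^{iφ}`. -/
def discR (q : ℕ∞) (m n : ℕ) (ξ : ℂ) : ℂ :=
  if q = ⊤ ∨ q ≤ 1 then ξ ^ m * (starRingEnd ℂ ξ) ^ n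
  else (if n ≤ m then ξ ^ (m - n) else (starRingEnd ℂ ξ) ^ (n - m)) *
    ((jacobiR (q.toNat - 2) (max m n - min m n) (min m n)
        (2 * ‖ξ‖ ^ 2 - 1) : ℝ) : ℂ)

/-- The natural domain `𝔻̃`: the unit circle `∂𝔻` when `q = 1` (the sphere `Ω₂`),
the closed unit disc `𝔻` otherwise. -/
def domD (q : ℕ∞) : Set ℂ :=
  if q = 1 then Metric.sphere (0 : ℂ) 1 else Metric.closedBall (0 : ℂ) 1

/-- `A ⊆ ℤ²` intersects every product of full arithmetic progressions in ℤ. -/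
def MeetsAllProgressions (A : Set (ℤ × ℤ)) : Prop :=
  ∀ N M x y : ℤ, 0 < N → 0 < M → 0 < x → 0 < y →
    ∃ v ∈ A, (∃ j : ℤ, v.1 = N * j + x) ∧ (∃ j : ℤ, v.2 = M * j + y)

namespace DiscPD

open Finset ComplexConjugate

/-- Positive semidefiniteness of `K` along all finite families of points of `S`, repetitions
allowed. -/
def PDK {α : Type*} (S : Set α) (K : α → α → ℂ) : Prop :=
  ∀ (ι : Type) [Fintype ι] (x : ι → α), (∀ i, x i ∈ S) → ∀ c : ι → ℂ,
    0 ≤ ∑ μ, ∑ ν, c μ * conj (c ν) * K (x μ) (x ν)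

lemma isPDKernel_iff {α : Type*} {S : Set α} {K : α → α → ℂ} :
    IsPDKernel S K ↔ PDK S K := by
  classical
  refine ⟨fun h ι _ x hx c => ?_, fun h L x hx _ c => h (Fin L) x hx c⟩
  let s : Finset α := univ.image x
  let e := s.equivFin
  let y : Fin s.card → α := fun j => (e.symm j : α)
  have hy : Function.Injective y := Subtype.val_injective.comp e.symm.injective
  have hyS : ∀ j, y j ∈ S := fun j => by
    obtain ⟨i, -, hi⟩ := mem_image.1 (e.symm j).2
    simpa only [y, ← hi] using hx i
  let π : ι → Fin s.card := fun i => e ⟨x i, mem_image_of_mem _ (mem_univ i)⟩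
  have hπ : ∀ i, y (π i) = x i := fun i => by simp [y, π]
  have key := h s.card y hyS hy (fun j => ∑ i with π i = j, c i)
  have h1 : ∀ F : ι → ℂ, ∀ G : Fin s.card → ℂ,
      ∑ j, (∑ i with π i = j, F i) * G j = ∑ i, F i * G (π i) := fun F G => by
    rw [← sum_fiberwise univ π (fun i => F i * G (π i))]
    refine sum_congr rfl fun j _ => ?_
    rw [sum_mul]
    exact sum_congr rfl fun i hi => by rw [(mem_filter.1 hi).2]
  convert key using 1
  simp only [map_sum, mul_assoc, ← mul_sum]
  rw [h1 c (fun j => ∑ ν, (∑ i with π i = ν, conj (c i)) * K (y j) (y ν))]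
  refine sum_congr rfl fun i _ => ?_
  rw [h1 (fun i => conj (c i)) (fun ν => K (y (π i)) (y ν))]
  simp only [hπ]

namespace PDK

variable {α β : Type*} {S : Set α} {K K' : α → α → ℂ}

lemma two (h : PDK S K) {x y : α} (hx : x ∈ S) (hy : y ∈ S) (s t : ℂ) :
    0 ≤ s * conj s * K x x + s * conj t * K x y + (t * conj s * K y x + t * conj t * K y y) := by
  have := h (Fin 2) ![x, y] (by intro i; fin_cases i <;> simpa) ![s, t]
  simpa [Fin.sum_univ_two] using this

lemma diag_nonneg (h : PDK S K) {x : α} (hx : x ∈ S) : 0 ≤ K x x := by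
  simpa using h.two hx hx 1 0

lemma symm (h : PDK S K) {x y : α} (hx : x ∈ S) (hy : y ∈ S) : K y x = conj (K x y) := by
  have h1 := (Complex.nonneg_iff.1 (h.two hx hy 1 1)).2
  have h2 := (Complex.nonneg_iff.1 (h.two hx hy 1 Complex.I)).2
  have h3 := (Complex.nonneg_iff.1 (h.diag_nonneg hx)).2
  have h4 := (Complex.nonneg_iff.1 (h.diag_nonneg hy)).2
  simp at h1 h2
  apply Complex.ext <;> simp <;> linarith

lemma posSemidef (h : PDK S K) {ι : Type} [Fintype ι] (x : ι → α) (hx : ∀ i, x i ∈ S) :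
    (Matrix.of fun i j => K (x i) (x j)).PosSemidef := by
  refine Matrix.PosSemidef.of_dotProduct_mulVec_nonneg ?_ fun c => ?_
  · ext i j
    simp [Matrix.conjTranspose_apply, h.symm (hx i) (hx j)]
  · have := h ι x hx (Star.star c)
    simpa [dotProduct, Matrix.mulVec, mul_sum, sum_mul, mul_comm, mul_left_comm, mul_assoc] using this

lemma of_posSemidef (h : ∀ (ι : Type) [Fintype ι] (x : ι → α), (∀ i, x i ∈ S) →
    (Matrix.of fun i j => K (x i) (x j)).PosSemidef) : PDK S K := fun ι _ x hx c => by
  have := (h ι x hx).dotProduct_mulVec_nonneg (Star.star c)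
  simpa [dotProduct, Matrix.mulVec, mul_sum, sum_mul, mul_comm, mul_left_comm, mul_assoc] using this

lemma mul (h : PDK S K) (h' : PDK S K') : PDK S fun x y => K x y * K' x y :=
  of_posSemidef fun _ _ x hx => (h.posSemidef x hx).hadamard (h'.posSemidef x hx)

lemma star (h : PDK S K) : PDK S fun x y => (starRingEnd ℂ) (K x y) := fun ι _ x hx c => by
  have := h ι x hx (Star.star c)
  rw [← star_nonneg_iff] at this
  simpa using this

lemma const {a : ℂ} (ha : 0 ≤ a) : PDK S fun _ _ => a := fun ι _ x hx c => by
  have : ∑ μ, ∑ ν, c μ * (starRingEnd ℂ) (c ν) * a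
      = (∑ μ, c μ) * (starRingEnd ℂ) (∑ μ, c μ) * a := by
    simp only [map_sum, sum_mul, mul_sum]
    rw [sum_comm]
  rw [this, Complex.mul_conj]
  exact mul_nonneg (by exact_mod_cast Complex.normSq_nonneg _) ha

lemma pow (h : PDK S K) (n : ℕ) : PDK S fun x y => K x y ^ n := by
  induction n with
  | zero => simpa using const (S := S) zero_le_one
  | succ n ih => simpa only [pow_succ] using ih.mul h

lemma sum {ι : Type*} {K : ι → α → α → ℂ} (s : Finset ι) (h : ∀ i ∈ s, PDK S (K i)) :
    PDK S fun x y => ∑ i ∈ s, K i x y := fun κ _ x hx c => by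
  have : ∑ μ, ∑ ν, c μ * (starRingEnd ℂ) (c ν) * ∑ i ∈ s, K i (x μ) (x ν)
      = ∑ i ∈ s, ∑ μ, ∑ ν, c μ * (starRingEnd ℂ) (c ν) * K i (x μ) (x ν) := by
    simp only [mul_sum]
    rw [sum_comm]
    simp only [sum_comm (s := s)]
    rw [sum_comm]
  rw [this]
  exact sum_nonneg fun i hi => h i hi κ x hx c

lemma add (h : PDK S K) (h' : PDK S K') : PDK S fun x y => K x y + K' x y := fun κ _ x hx c => by
  simpa [mul_add, sum_add_distrib] using add_nonneg (h κ x hx c) (h' κ x hx c)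

lemma of_tendsto {ι : Type*} {l : Filter ι} [l.NeBot] {F : ι → α → α → ℂ}
    (h : ∀ i, PDK S (F i)) (hl : ∀ x ∈ S, ∀ y ∈ S, Filter.Tendsto (F · x y) l (nhds (K x y))) :
    PDK S K := fun κ _ x hx c =>
  ge_of_tendsto' (tendsto_finsetSum _ fun μ _ => tendsto_finsetSum _ fun ν _ =>
    (hl _ (hx μ) _ (hx ν)).const_mul _) fun i => h i κ x hx c

lemma comp {T : Set β} (h : PDK S K) (φ : β → α) (hφ : ∀ y ∈ T, φ y ∈ S) :
    PDK T fun x y => K (φ x) (φ y) := fun κ _ x hx c => h κ (φ ∘ x) (fun i => hφ _ (hx i)) c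

lemma congr (h : PDK S K) (hK : ∀ x ∈ S, ∀ y ∈ S, K x y = K' x y) : PDK S K' :=
  fun κ _ x hx c => by simpa only [← hK _ (hx _) _ (hx _)] using h κ x hx c

/-- Kernels that factor through a feature map into an inner product space. -/
lemma of_inner {E : Type*} [NormedAddCommGroup E] [InnerProductSpace ℂ E] (Φ : α → E)
    (hK : ∀ x ∈ S, ∀ y ∈ S, K x y = inner ℂ (Φ y) (Φ x)) : PDK S K := fun κ _ x hx c => by
  have : ∑ μ, ∑ ν, c μ * (starRingEnd ℂ) (c ν) * K (x μ) (x ν)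
      = inner ℂ (∑ ν, c ν • Φ (x ν)) (∑ μ, c μ • Φ (x μ)) := by
    simp only [sum_inner, inner_sum, inner_smul_left, inner_smul_right, hK _ (hx _) _ (hx _)]
    simp only [mul_sum]
    exact sum_congr rfl fun i _ => sum_congr rfl fun j _ => by ring
  rw [this, inner_self_eq_norm_sq_to_K]
  exact pow_nonneg (Complex.zero_le_real.2 (norm_nonneg (∑ ν, c ν • Φ (x ν)))) 2

lemma norm_sq_le (h : PDK S K) {x y : α} (hx : x ∈ S) (hy : y ∈ S) :
    ‖K x y‖ ^ 2 ≤ (K x x).re * (K y y).re := by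
  have hp : 0 ≤ (K x x).re * (K y y).re :=
    mul_nonneg (Complex.nonneg_iff.1 (h.diag_nonneg hx)).1
      (Complex.nonneg_iff.1 (h.diag_nonneg hy)).1
  have hd := discrim_le_zero (a := (K x x).re) (b := -2 * ‖K x y‖ ^ 2)
    (c := (K y y).re * ‖K x y‖ ^ 2) fun t => by
      have := (Complex.nonneg_iff.1 (h.two hx hy t (-K x y))).1
      rw [h.symm hx hy] at this
      simp at this
      rw [Complex.sq_norm, Complex.normSq_apply]
      nlinarith
  rw [discrim] at hd
  rcases eq_or_lt_of_le (sq_nonneg ‖K x y‖) with h0 | h0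
  · rwa [← h0]
  · nlinarith

/-- The Cauchy–Schwarz inequality for `K x (δ_y - δ_z)`. -/
lemma norm_sub_sq_le (h : PDK S K) {x y z : α} (hx : x ∈ S) (hy : y ∈ S) (hz : z ∈ S) :
    ‖K x y - K x z‖ ^ 2 ≤ (K x x).re * ((K y y).re + (K z z).re - 2 * (K y z).re) := by
  have h3 : ∀ s t : ℂ, 0 ≤ s * (starRingEnd ℂ) s * K x x
      + s * (starRingEnd ℂ) t * (K x y - K x z)
      + (t * (starRingEnd ℂ) s * (K y x - K z x)
      + t * (starRingEnd ℂ) t * (K y y + K z z - K y z - K z y)) := fun s t => by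
    have := h (Fin 3) ![x, y, z] (by intro i; fin_cases i <;> simpa) ![s, t, -t]
    simp [Fin.sum_univ_three] at this
    convert this using 1
    ring
  have hyz := (Complex.nonneg_iff.1 (h3 0 1)).1
  have hxx := (Complex.nonneg_iff.1 (h.diag_nonneg hx)).1
  have hzy : (K z y).re = (K y z).re := by rw [h.symm hy hz]; simp
  have hd := discrim_le_zero (a := (K x x).re) (b := -2 * ‖K x y - K x z‖ ^ 2)
    (c := ((K y y).re + (K z z).re - 2 * (K y z).re) * ‖K x y - K x z‖ ^ 2) fun t => by
      have := (Complex.nonneg_iff.1 (h3 t (-(K x y - K x z)))).1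
      rw [h.symm hx hy, h.symm hx hz] at this
      simp at this
      rw [Complex.sq_norm, Complex.normSq_apply, Complex.sub_re, Complex.sub_im]
      rw [hzy] at this
      nlinarith
  rw [discrim] at hd
  simp [hzy] at hyz
  rcases eq_or_lt_of_le (sq_nonneg ‖K x y - K x z‖) with h0 | h0
  · rw [← h0]
    exact mul_nonneg hxx (by linarith)
  · nlinarith

end PDK

/-- `ℂ^N` with its Euclidean norm, viewed as the first `N` coordinates of `ℓ²(ℂ)`. -/
def toEll {N : ℕ} (v : EuclideanSpace ℂ (Fin N)) : Ell2 :=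
  ⟨fun j => if h : j < N then v ⟨j, h⟩ else 0, by
    refine memℓp_gen (summable_of_ne_finset_zero (s := range N) fun j hj => ?_)
    rw [mem_range] at hj
    simp [hj]⟩

lemma toEll_apply {N : ℕ} (v : EuclideanSpace ℂ (Fin N)) (j : ℕ) :
    toEll v j = if h : j < N then v ⟨j, h⟩ else 0 := rfl

lemma hdot_toEll {N : ℕ} (v w : EuclideanSpace ℂ (Fin N)) :
    hdot (toEll v) (toEll w) = inner ℂ w v := by
  rw [hdot, lp.inner_eq_tsum, tsum_eq_sum (s := range N), sum_range]
  · simp [toEll_apply, PiLp.inner_apply]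
  · intro j hj
    rw [mem_range] at hj
    simp [toEll_apply, hj]

lemma norm_toEll {N : ℕ} (v : EuclideanSpace ℂ (Fin N)) : ‖toEll v‖ = ‖v‖ := by
  have h := hdot_toEll v v
  rw [hdot, inner_self_eq_norm_sq_to_K, inner_self_eq_norm_sq_to_K] at h
  have h' : ‖toEll v‖ ^ 2 = ‖v‖ ^ 2 := by exact_mod_cast h
  exact (sq_eq_sq₀ (norm_nonneg _) (norm_nonneg _)).1 h'

lemma toEll_mem_Omega {N : ℕ} {q : ℕ∞} (hN : N ≤ q) {v : EuclideanSpace ℂ (Fin N)}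
    (hv : ‖v‖ = 1) : toEll v ∈ Omega q := by
  refine ⟨by rw [norm_toEll, hv], fun j hj => ?_⟩
  have : ¬ j < N := by
    have : (N : ℕ∞) ≤ j := hN.trans hj
    simpa using this
  simp [toEll_apply, this]

lemma exists_toEll {q : ℕ} {z : Ell2} (hz : z ∈ Omega q) :
    ∃ v : EuclideanSpace ℂ (Fin q), ‖v‖ = 1 ∧ toEll v = z := by
  have h : toEll (WithLp.toLp 2 fun i : Fin q => z i) = z := by
    ext j
    by_cases hj : j < q
    · simp [toEll_apply, hj]
    · simp [toEll_apply, hj, hz.2 j (by simpa using hj)]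
  exact ⟨_, by rw [← norm_toEll, h, hz.1], h⟩

lemma hdot_self {q : ℕ∞} {z : Ell2} (hz : z ∈ Omega q) : hdot z z = 1 := by
  rw [hdot, inner_self_eq_norm_sq_to_K, hz.1]
  simp

lemma one_mem_domD (q : ℕ∞) : (1 : ℂ) ∈ domD q := by
  unfold domD; split_ifs <;> simp

lemma norm_le_one_of_mem_domD {q : ℕ∞} {ξ : ℂ} (h : ξ ∈ domD q) : ‖ξ‖ ≤ 1 := by
  unfold domD at h; split_ifs at h <;> simp at h <;> simp [h]

lemma isCompact_domD (q : ℕ∞) : IsCompact (domD q) := by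
  unfold domD; split_ifs
  · exact isCompact_sphere _ _
  · exact isCompact_closedBall _ _

lemma hdot_mem_domD {q : ℕ∞} {z w : Ell2} (hz : z ∈ Omega q) (hw : w ∈ Omega q) :
    hdot z w ∈ domD q := by
  unfold domD; split_ifs with h
  · subst h
    obtain ⟨v, hv, rfl⟩ := exists_toEll (q := 1) (by simpa using hz)
    obtain ⟨u, hu, rfl⟩ := exists_toEll (q := 1) (by simpa using hw)
    rw [hdot_toEll]
    rw [EuclideanSpace.norm_eq] at hu hv
    simp at hu hv
    simp [PiLp.inner_apply, hu, hv]
  · have := norm_inner_le_norm (𝕜 := ℂ) w z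
    rw [hz.1, hw.1] at this
    simpa [hdot] using this

/-- A continuous choice of `y ∈ Ω_{2q}` with `e₁ · y = η`. -/
def sec (η : ℂ) : Ell2 := toEll (N := 2) !₂[conj η, ((√(1 - ‖η‖ ^ 2) : ℝ) : ℂ)]

lemma sec_mem {q : ℕ∞} (hq : 1 ≤ q) {η : ℂ} (hη : η ∈ domD q) : sec η ∈ Omega q := by
  have hn := norm_le_one_of_mem_domD hη
  have h1 : ‖(!₂[conj η, ((√(1 - ‖η‖ ^ 2) : ℝ) : ℂ)] : EuclideanSpace ℂ (Fin 2))‖ = 1 := by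
    rw [EuclideanSpace.norm_eq]
    have : 0 ≤ 1 - ‖η‖ ^ 2 := by nlinarith [norm_nonneg η]
    simp [Fin.sum_univ_two, Real.sq_sqrt this]
  by_cases h : q = 1
  · refine ⟨by rw [sec, norm_toEll, h1], fun j hj => ?_⟩
    rw [h] at hj
    have hj' : 1 ≤ j := by exact_mod_cast hj
    have hη1 : ‖η‖ = 1 := by simpa [domD, h] using hη
    rw [sec, toEll_apply]
    split_ifs with h2
    · obtain rfl : j = 1 := by omega
      simp [hη1]
    · rfl
  · refine toEll_mem_Omega ?_ h1
    have : (1 : ℕ∞) < q := lt_of_le_of_ne hq (Ne.symm h)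
    rw [Nat.cast_ofNat, ← one_add_one_eq_two]
    exact Order.add_one_le_of_lt this

lemma hdot_sec_sec (η η' : ℂ) : hdot (sec η) (sec η')
    = conj η * η' + (√(1 - ‖η‖ ^ 2) * √(1 - ‖η'‖ ^ 2) : ℝ) := by
  simp [sec, hdot_toEll, PiLp.inner_apply, Fin.sum_univ_two]

lemma hdot_sec_one (η : ℂ) : hdot (sec 1) (sec η) = η := by simp [hdot_sec_sec]

lemma pdk_hdot (S : Set Ell2) : PDK S hdot := PDK.of_inner id fun _ _ _ _ => rfl

lemma jacobiR_one (α β k : ℕ) : jacobiR α β k 1 = 1 := by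
  rw [jacobiR, sum_range_succ', sum_eq_zero]
  · have : ((k + α).choose k : ℝ) ≠ 0 := by
      exact_mod_cast (Nat.choose_pos (Nat.le_add_right _ _)).ne'
    simp [this]
  · simp

lemma discR_one (q : ℕ∞) (m n : ℕ) : discR q m n 1 = 1 := by
  unfold discR
  norm_num
  intro _ _
  norm_num [jacobiR_one]

lemma continuous_discR (q : ℕ∞) (m n : ℕ) : Continuous (discR q m n) := by
  unfold discR jacobiR
  split_ifs <;> fun_prop

/-- The coefficient indices allowed in the slot `q`. -/
def Adm (q : ℕ∞) (i : ℕ × ℕ) : Prop := q = 1 → i.1 * i.2 = 0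

lemma pdk_pow_mul_conj_pow (S : Set Ell2) (m n : ℕ) :
    PDK S fun z w => hdot z w ^ m * conj (hdot z w) ^ n :=
  ((pdk_hdot S).pow m).mul ((pdk_hdot S).star.pow n)

lemma PDK.norm_le_of_hdot {q : ℕ∞} (hq : 1 ≤ q) {g : ℂ → ℂ}
    (h : PDK (Omega q) fun z w => g (hdot z w)) {ξ : ℂ} (hξ : ξ ∈ domD q) :
    ‖g ξ‖ ≤ (g 1).re := by
  have h1 := h.norm_sq_le (sec_mem hq (one_mem_domD q)) (sec_mem hq hξ)
  have h0 := (Complex.nonneg_iff.1 (h.diag_nonneg (sec_mem hq hξ))).1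
  simp only [hdot_sec_one, hdot_self (sec_mem hq hξ)] at h1 h0
  rw [← sq] at h1
  exact le_of_sq_le_sq h1 h0

section Fischer

open MvPolynomial

variable {σ : Type*} [Fintype σ]

/-- The Fischer inner product on polynomials, for which multiplication by `X i` is adjoint to
`∂/∂X i`. It is linear in the second argument. -/
def fischer (r : MvPolynomial σ ℂ) : MvPolynomial σ ℂ →ₗ[ℂ] ℂ :=
  (basisMonomials σ ℂ).constr ℂ fun α => (∏ i, (α i).factorial : ℕ) * conj (coeff α r)

lemma fischer_monomial (r : MvPolynomial σ ℂ) (α : σ →₀ ℕ) (a : ℂ) :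
    fischer r (monomial α a) = a * ((∏ i, (α i).factorial : ℕ) * conj (coeff α r)) := by
  have h : monomial α a = a • basisMonomials σ ℂ α := by simp [smul_monomial]
  rw [h, map_smul, fischer, Module.Basis.constr_basis, smul_eq_mul]

lemma fischer_apply (r p : MvPolynomial σ ℂ) : fischer r p
    = ∑ α ∈ p.support, coeff α p * ((∏ i, (α i).factorial : ℕ) * conj (coeff α r)) := by
  conv_lhs => rw [← support_sum_monomial_coeff p]
  simp only [map_sum, fischer_monomial]

lemma fischer_add (r s p : MvPolynomial σ ℂ) : fischer (r + s) p = fischer r p + fischer s p := by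
  simp only [fischer_apply, coeff_add, map_add, mul_add, sum_add_distrib]

lemma fischer_C_mul (c : ℂ) (r p : MvPolynomial σ ℂ) :
    fischer (C c * r) p = conj c * fischer r p := by
  simp only [fischer_apply, coeff_C_mul, map_mul, mul_sum]
  exact sum_congr rfl fun _ _ => by ring

lemma fischer_apply_C_mul (c : ℂ) (r p : MvPolynomial σ ℂ) :
    fischer r (C c * p) = c * fischer r p := by
  rw [C_mul', map_smul, smul_eq_mul]

lemma fischer_sum {ι : Type*} (s : Finset ι) (r : ι → MvPolynomial σ ℂ) (p : MvPolynomial σ ℂ) :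
    fischer (∑ i ∈ s, r i) p = ∑ i ∈ s, fischer (r i) p := by
  classical
  induction s using Finset.induction_on with
  | empty => simp [fischer_apply]
  | insert a s ha ih => rw [sum_insert ha, sum_insert ha, fischer_add, ih]

lemma fischer_self_nonneg (p : MvPolynomial σ ℂ) : 0 ≤ fischer p p := by
  rw [fischer_apply]
  refine sum_nonneg fun α _ => ?_
  rw [mul_left_comm, Complex.mul_conj]
  exact mul_nonneg (Nat.cast_nonneg _) (Complex.zero_le_real.2 (Complex.normSq_nonneg _))

lemma fischer_X_mul (i : σ) (p r : MvPolynomial σ ℂ) :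
    fischer r (X i * p) = fischer (pderiv i r) p := by
  classical
  induction p using MvPolynomial.induction_on' with
  | add p q hp hq => rw [mul_add, map_add, map_add, hp, hq]
  | monomial α a =>
    rw [X, monomial_mul, one_mul, fischer_monomial, fischer_monomial, coeff_pderiv, add_comm _ α]
    have : ∏ j, ((α + Finsupp.single i 1 : σ →₀ ℕ) j).factorial
        = (α i + 1) * ∏ j, (α j).factorial := by
      rw [← mul_prod_erase univ _ (mem_univ i), ← mul_prod_erase univ _ (mem_univ i), ← mul_assoc]
      congr 1
      · simp [Nat.factorial_succ]
      · exact prod_congr rfl fun j hj => by simp [(ne_of_mem_erase hj).symm]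
    rw [this]
    simp only [Nat.cast_mul, Nat.cast_add, Nat.cast_one, map_mul, map_add, map_natCast, map_one]
    ring

variable {α : Type*} {S : Set α}

/-- A kernel that is a Fischer Gram kernel is positive definite. -/
lemma pdk_fischer (Φ : α → MvPolynomial σ ℂ) : PDK S fun x y => fischer (Φ y) (Φ x) :=
  fun κ _ x hx c => by
  have : ∑ μ, ∑ ν, c μ * conj (c ν) * fischer (Φ (x ν)) (Φ (x μ))
      = fischer (∑ ν, C (c ν) * Φ (x ν)) (∑ μ, C (c μ) * Φ (x μ)) := by
    simp only [fischer_sum, map_sum, fischer_apply_C_mul, fischer_C_mul, mul_sum]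
    exact sum_congr rfl fun i _ => sum_congr rfl fun j _ => by ring
  rw [this]
  exact fischer_self_nonneg _

end Fischer

section Zonal

open MvPolynomial

variable {q : ℕ}

/-- Polynomials in `q` holomorphic and `q` antiholomorphic variables. -/
abbrev BiPoly (q : ℕ) : Type := MvPolynomial (Fin q ⊕ Fin q) ℂ

/-- The linear form `x ↦ x · w` in the holomorphic variables. -/
def linForm (w : Fin q → ℂ) : BiPoly q :=
  ∑ i, C (conj (w i)) * X (Sum.inl i)

/-- The linear form `x ↦ w · x` in the antiholomorphic variables. -/
def conjForm (w : Fin q → ℂ) : BiPoly q := ∑ i, C (w i) * X (Sum.inr i)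

variable (q) in
/-- The polynomial `‖x‖ ^ 2`. -/
def normForm : BiPoly q := ∑ i, X (Sum.inl i) * X (Sum.inr i)

/-- The squared norm of the component of `x` orthogonal to `w`. -/
def perpForm (w : Fin q → ℂ) : BiPoly q :=
  normForm q - linForm w * conjForm w

/-- The complex Laplacian. -/
def lap (r : BiPoly q) : BiPoly q :=
  ∑ i, pderiv (Sum.inr i) (pderiv (Sum.inl i) r)

lemma lap_C_mul (c : ℂ) (r : BiPoly q) : lap (C c * r) = C c * lap r := by
  simp [lap, mul_sum]

lemma lap_sum {ι : Type*} (s : Finset ι) (r : ι → BiPoly q) :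
    lap (∑ j ∈ s, r j) = ∑ j ∈ s, lap (r j) := by
  simp only [lap, map_sum]
  exact sum_comm

lemma fischer_normForm_mul (r p : BiPoly q) :
    fischer r (normForm q * p) = fischer (lap r) p := by
  simp only [normForm, sum_mul, map_sum, mul_assoc, fischer_X_mul, lap, fischer_sum]

lemma pderiv_inl_linForm (w : Fin q → ℂ) (i : Fin q) :
    pderiv (Sum.inl i) (linForm w) = C (conj (w i)) := by
  classical
  simp [linForm, pderiv_X, Pi.single_apply]

lemma pderiv_inr_linForm (w : Fin q → ℂ) (i : Fin q) : pderiv (Sum.inr i) (linForm w) = 0 := by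
  classical
  simp [linForm, pderiv_X]

lemma pderiv_inl_conjForm (w : Fin q → ℂ) (i : Fin q) : pderiv (Sum.inl i) (conjForm w) = 0 := by
  classical
  simp [conjForm, pderiv_X]

lemma pderiv_inr_conjForm (w : Fin q → ℂ) (i : Fin q) :
    pderiv (Sum.inr i) (conjForm w) = C (w i) := by
  classical
  simp [conjForm, pderiv_X, Pi.single_apply]

lemma pderiv_inl_perpForm (w : Fin q → ℂ) (i : Fin q) :
    pderiv (Sum.inl i) (perpForm w) = X (Sum.inr i) - C (conj (w i)) * conjForm w := by
  classical
  simp [perpForm, normForm, pderiv_inl_linForm, pderiv_inl_conjForm, pderiv_X, Pi.single_apply,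
    mul_comm]

lemma pderiv_inr_perpForm (w : Fin q → ℂ) (i : Fin q) :
    pderiv (Sum.inr i) (perpForm w) = X (Sum.inl i) - C (w i) * linForm w := by
  classical
  simp [perpForm, normForm, pderiv_inr_linForm, pderiv_inr_conjForm, pderiv_X, Pi.single_apply,
    mul_comm]

lemma lap_zonal {w : Fin q → ℂ} (hw : ∑ i, conj (w i) * w i = 1) (a b s : ℕ) :
    lap (linForm w ^ a * conjForm w ^ b * perpForm w ^ s)
      = ((a * b : ℕ) : BiPoly q) * linForm w ^ (a - 1) * conjForm w ^ (b - 1) * perpForm w ^ s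
        + ((s * (s + q - 2 : ℤ) : ℤ) : BiPoly q) * linForm w ^ a * conjForm w ^ b * perpForm w ^ (s - 1) := by
  have key : ∀ i, pderiv (Sum.inr i) (pderiv (Sum.inl i)
      (linForm w ^ a * conjForm w ^ b * perpForm w ^ s))
      = ((a * b : ℕ) : BiPoly q) * linForm w ^ (a - 1) * conjForm w ^ (b - 1) * perpForm w ^ s
          * (C (conj (w i)) * C (w i))
        + (a : BiPoly q) * (s : BiPoly q) * linForm w ^ (a - 1) * conjForm w ^ b * perpForm w ^ (s - 1)
          * (C (conj (w i)) * (X (Sum.inl i) - C (w i) * linForm w))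
        + (b : BiPoly q) * (s : BiPoly q) * linForm w ^ a * conjForm w ^ (b - 1) * perpForm w ^ (s - 1)
          * (C (w i) * (X (Sum.inr i) - C (conj (w i)) * conjForm w))
        + (s : BiPoly q) * ((s - 1 : ℕ) : BiPoly q) * linForm w ^ a * conjForm w ^ b
          * perpForm w ^ (s - 1 - 1)
          * ((X (Sum.inl i) - C (w i) * linForm w) * (X (Sum.inr i) - C (conj (w i)) * conjForm w))
        + (s : BiPoly q) * linForm w ^ a * conjForm w ^ b * perpForm w ^ (s - 1)
          * (1 - C (conj (w i)) * C (w i)) := by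
    intro i
    have h1 : pderiv (Sum.inl i) (linForm w ^ a * conjForm w ^ b * perpForm w ^ s)
        = (a : BiPoly q) * C (conj (w i)) * (linForm w ^ (a - 1) * conjForm w ^ b * perpForm w ^ s)
          + (s : BiPoly q) * ((X (Sum.inr i) - C (conj (w i)) * conjForm w) *
            (linForm w ^ a * conjForm w ^ b * perpForm w ^ (s - 1))) := by
      simp only [pderiv_mul, pderiv_pow, pderiv_inl_linForm, pderiv_inl_conjForm,
        pderiv_inl_perpForm]
      ring
    rw [h1]
    simp only [pderiv_mul, pderiv_pow, pderiv_inr_linForm, pderiv_inr_conjForm, map_add, map_sub,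
      pderiv_inr_perpForm, pderiv_C, pderiv_X_self, Derivation.map_natCast]
    push_cast
    ring
  have e1 : ∑ i, C (σ := Fin q ⊕ Fin q) (conj (w i)) * C (w i) = 1 := by
    simp only [← C_mul, ← map_sum, hw, C_1]
  have e2 : ∑ i, C (conj (w i)) * (X (Sum.inl i) - C (w i) * linForm w) = 0 := by
    simp only [mul_sub, sum_sub_distrib, ← mul_assoc, ← sum_mul, e1]
    simp [linForm]
  have e3 : ∑ i, C (w i) * (X (Sum.inr i) - C (conj (w i)) * conjForm w) = 0 := by
    simp only [mul_sub, sum_sub_distrib, ← mul_assoc, ← sum_mul]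
    simp only [mul_comm (C (w _)) (C (conj (w _))), e1]
    simp [conjForm]
  have e4 : ∑ i, (X (Sum.inl i) - C (w i) * linForm w)
      * (X (Sum.inr i) - C (conj (w i)) * conjForm w) = perpForm w := by
    have : ∀ i, (X (Sum.inl i) - C (w i) * linForm w)
      * (X (Sum.inr i) - C (conj (w i)) * conjForm w)
      = X (Sum.inl i) * X (Sum.inr i) - (C (conj (w i)) * X (Sum.inl i)) * conjForm w
        - linForm w * (C (w i) * (X (Sum.inr i) - C (conj (w i)) * conjForm w)) := fun i => by ring
    simp only [this, sum_sub_distrib, ← sum_mul, ← mul_sum, e3]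
    rw [perpForm, normForm, ← linForm]
    ring
  rw [lap]
  simp only [key, sum_add_distrib, ← mul_sum, e1, e2, e3, e4, sum_sub_distrib]
  rcases s with _ | _ | s
  · simp
  · simp; ring
  · simp only [Nat.add_sub_cancel, pow_succ, sum_const, card_univ, Fintype.card_fin, nsmul_eq_mul]
    push_cast
    ring

/-- Coefficients of the zonal harmonics. -/
def zonalCoeff (α β k s : ℕ) : ℕ := (k + α).choose (k - s) * (k + β).choose s

lemma zonalCoeff_succ {α β k s : ℕ} (hs : s < k) :
    zonalCoeff α β k (s + 1) * ((s + 1) * (s + 1 + α))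
      = zonalCoeff α β k s * ((β + k - s) * (k - s)) := by
  have h1 := Nat.choose_succ_right_eq (k + β) s
  have h2 := Nat.choose_succ_right_eq (k + α) (k - (s + 1))
  rw [show k - (s + 1) + 1 = k - s by omega, show k + α - (k - (s + 1)) = s + 1 + α by omega] at h2
  rw [zonalCoeff, zonalCoeff, show β + k - s = k + β - s by omega]
  calc _ = ((k + α).choose (k - (s + 1)) * (s + 1 + α)) * ((k + β).choose (s + 1) * (s + 1)) := by
        ring
    _ = _ := by rw [← h2, h1]; ring

/-- The zonal harmonic polynomial of bidegree `(β + k, k)` with pole `w`. -/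
def zonal (β k : ℕ) (w : Fin q → ℂ) : BiPoly q :=
  ∑ s ∈ range (k + 1), C ((zonalCoeff (q - 2) β k s : ℕ) * (-1) ^ s : ℂ) *
    (linForm w ^ (β + k - s) * conjForm w ^ (k - s) * perpForm w ^ s)

lemma lap_zonal_eq_zero (hq : 2 ≤ q) {w : Fin q → ℂ} (hw : ∑ i, conj (w i) * w i = 1) (β k : ℕ) :
    lap (zonal β k w) = 0 := by
  obtain ⟨α, rfl⟩ : ∃ α, q = α + 2 := ⟨q - 2, by omega⟩
  simp only [zonal, lap_sum, lap_C_mul, lap_zonal hw, mul_add, sum_add_distrib,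
    Nat.add_sub_cancel]
  rw [sum_range_succ, sum_range_succ' (n := k)]
  simp only [Nat.sub_self, mul_zero, Nat.cast_zero, zero_mul, add_zero, Int.cast_zero]
  rw [← sum_add_distrib]
  refine sum_eq_zero fun s hs => ?_
  have hs' := mem_range.1 hs
  have h : ((zonalCoeff α β k (s + 1) * ((s + 1) * (s + 1 + α)) : ℕ)
      : BiPoly (α + 2))
      = (zonalCoeff α β k s * ((β + k - s) * (k - s)) : ℕ) := by rw [zonalCoeff_succ hs']
  have e1 : β + k - s - 1 = β + k - (s + 1) := by omega
  have e2 : k - s - 1 = k - (s + 1) := by omega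
  rw [e1, e2]
  simp only [C_mul, C_pow, C_neg, C_1, map_natCast, Nat.add_sub_cancel, pow_succ]
  have e3 : ((((s + 1 : ℕ) : ℤ) * ((s + 1 : ℕ) + (α + 2 : ℕ) - 2 : ℤ) : ℤ)
      : BiPoly (α + 2)) = ((s + 1) * (s + 1 + α) : ℕ) := by
    push_cast; ring
  rw [e3]
  rw [Nat.cast_mul, Nat.cast_mul (zonalCoeff α β k s)] at h
  linear_combination (-1) * (-1) ^ s * linForm w ^ (β + k - (s + 1)) * conjForm w ^ (k - (s + 1)) *
    perpForm w ^ s * h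

end Zonal

section Reproducing

open MvPolynomial

variable {q : ℕ}

/-- Bihomogeneous polynomials of bidegree `(m, n)`. -/
def BiHom (m n : ℕ) (r : BiPoly q) : Prop :=
  IsWeightedHomogeneous (Sum.elim (fun _ => 1) fun _ => 0 : Fin q ⊕ Fin q → ℕ) r m ∧
    IsWeightedHomogeneous (Sum.elim (fun _ => 0) fun _ => 1 : Fin q ⊕ Fin q → ℕ) r n

lemma BiHom.mul {m n m' n' : ℕ} {r s : BiPoly q} (hr : BiHom m n r) (hs : BiHom m' n' s) :
    BiHom (m + m') (n + n') (r * s) := ⟨hr.1.mul hs.1, hr.2.mul hs.2⟩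

lemma BiHom.pow {m n : ℕ} {r : BiPoly q} (hr : BiHom m n r) (a : ℕ) :
    BiHom (a * m) (a * n) (r ^ a) := ⟨hr.1.pow a, hr.2.pow a⟩

lemma BiHom.sum {m n : ℕ} {ι : Type*} {s : Finset ι} {r : ι → BiPoly q}
    (hr : ∀ i ∈ s, BiHom m n (r i)) : BiHom m n (∑ i ∈ s, r i) :=
  ⟨.sum s r m fun i hi => (hr i hi).1, .sum s r n fun i hi => (hr i hi).2⟩

lemma BiHom.C_mul {m n : ℕ} {r : BiPoly q} (hr : BiHom m n r) (c : ℂ) : BiHom m n (C c * r) :=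
  ⟨hr.1.C_mul c, hr.2.C_mul c⟩

lemma biHom_inl (i : Fin q) : BiHom 1 0 (X (Sum.inl i) : BiPoly q) :=
  ⟨isWeightedHomogeneous_X _ _ _, isWeightedHomogeneous_X _ _ _⟩

lemma biHom_inr (i : Fin q) : BiHom 0 1 (X (Sum.inr i) : BiPoly q) :=
  ⟨isWeightedHomogeneous_X _ _ _, isWeightedHomogeneous_X _ _ _⟩

lemma biHom_linForm (w : Fin q → ℂ) : BiHom 1 0 (linForm w) :=
  .sum fun i _ => (biHom_inl i).C_mul _

lemma biHom_conjForm (w : Fin q → ℂ) : BiHom 0 1 (conjForm w) :=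
  .sum fun i _ => (biHom_inr i).C_mul _

lemma biHom_perpForm (w : Fin q → ℂ) : BiHom 1 1 (perpForm w) := by
  have h1 : BiHom 1 1 (normForm q) := .sum fun i _ => (biHom_inl i).mul (biHom_inr i)
  have h2 := (biHom_linForm w).mul (biHom_conjForm w)
  exact ⟨h1.1.sub h2.1, h1.2.sub h2.2⟩

lemma biHom_zonal (β k : ℕ) (w : Fin q → ℂ) : BiHom (β + k) k (zonal β k w) := by
  refine .sum fun s hs => .C_mul ?_ _
  have hs := mem_range_succ_iff.1 hs
  have h := (((biHom_linForm w).pow (β + k - s)).mul ((biHom_conjForm w).pow (k - s))).mul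
    ((biHom_perpForm w).pow s)
  convert h using 1 <;> omega

lemma BiHom.pderiv_inl {m n : ℕ} {r : BiPoly q} (hr : BiHom (m + 1) n r) (i : Fin q) :
    BiHom m n (pderiv (Sum.inl i) r) := ⟨hr.1.pderiv rfl, hr.2.pderiv rfl⟩

lemma BiHom.pderiv_inr {m n : ℕ} {r : BiPoly q} (hr : BiHom m (n + 1) r) (i : Fin q) :
    BiHom m n (pderiv (Sum.inr i) r) := ⟨hr.1.pderiv rfl, hr.2.pderiv rfl⟩

/-- The evaluation of a polynomial at the point `z`. -/
def evalAt (z : Fin q → ℂ) : BiPoly q →+* ℂ := eval (Sum.elim z fun i => conj (z i))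

lemma fischer_linForm_mul (z : Fin q → ℂ) (r p : BiPoly q) : fischer r (linForm z * p)
    = fischer (∑ i, C (z i) * pderiv (Sum.inl i) r) p := by
  simp [linForm, sum_mul, mul_assoc, fischer_sum, fischer_C_mul, fischer_apply_C_mul,
    fischer_X_mul]

lemma fischer_conjForm_mul (z : Fin q → ℂ) (r p : BiPoly q) : fischer r (conjForm z * p)
    = fischer (∑ i, C (conj (z i)) * pderiv (Sum.inr i) r) p := by
  simp [conjForm, sum_mul, mul_assoc, fischer_sum, fischer_C_mul, fischer_apply_C_mul,
    fischer_X_mul]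

lemma BiHom.evalAt_inl {m n : ℕ} {r : BiPoly q} (hr : BiHom m n r) (z : Fin q → ℂ) :
    evalAt z (∑ i, C (z i) * pderiv (Sum.inl i) r) = m * evalAt z r := by
  have h := congr_arg (evalAt z) hr.1.sum_weight_X_mul_pderiv
  simpa [evalAt, Fintype.sum_sum_type] using h

lemma BiHom.evalAt_inr {m n : ℕ} {r : BiPoly q} (hr : BiHom m n r) (z : Fin q → ℂ) :
    evalAt z (∑ i, C (conj (z i)) * pderiv (Sum.inr i) r) = n * evalAt z r := by
  have h := congr_arg (evalAt z) hr.2.sum_weight_X_mul_pderiv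
  simpa [evalAt, Fintype.sum_sum_type] using h

lemma BiHom.eq_C {r : BiPoly q} (hr : BiHom 0 0 r) : r = C (coeff 0 r) := by
  refine eq_monomial_of_support_subset_singleton fun d hd => ?_
  have h1 := hr.1 (mem_support_iff.1 hd)
  have h2 := hr.2 (mem_support_iff.1 hd)
  rw [Finsupp.weight_apply, Finsupp.sum_fintype _ _ (by simp)] at h1 h2
  simp only [Fintype.sum_sum_type] at h1 h2
  simp at h1 h2
  show d = 0
  ext (i | i)
  · exact h1 i
  · exact h2 i

lemma BiHom.fischer_eq {m n : ℕ} {r : BiPoly q} (hr : BiHom m n r) (z : Fin q → ℂ) :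
    fischer r (linForm z ^ m * conjForm z ^ n)
      = m.factorial * n.factorial * conj (evalAt z r) := by
  induction m generalizing r with
  | succ m ih =>
    rw [pow_succ', mul_assoc, fischer_linForm_mul, ih (.sum fun i _ => (hr.pderiv_inl i).C_mul _),
      hr.evalAt_inl, Nat.factorial_succ]
    simp
    ring
  | zero =>
    induction n generalizing r with
    | succ n ih =>
      rw [pow_succ', mul_left_comm, fischer_conjForm_mul,
        ih (.sum fun i _ => (hr.pderiv_inr i).C_mul _), hr.evalAt_inr, Nat.factorial_succ]
      simp
      ring
    | zero =>
      have h : fischer r 1 = conj (coeff 0 r) := by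
        have := fischer_monomial r 0 1
        simpa using this
      rw [pow_zero, pow_zero, one_mul, h]
      conv_rhs => rw [hr.eq_C]
      simp [evalAt]

lemma evalAt_zonal {z w : Fin q → ℂ} (hz : ∑ i, conj (z i) * z i = 1) (β k : ℕ) :
    evalAt z (zonal β k w) = (∑ i, z i * conj (w i)) ^ β * ((k + (q - 2)).choose k : ℂ) *
      jacobiR (q - 2) β k (2 * ‖∑ i, z i * conj (w i)‖ ^ 2 - 1) := by
  set ξ := ∑ i, z i * conj (w i) with hξ
  have h1 : evalAt z (linForm w) = ξ := by simp [evalAt, linForm, hξ, mul_comm]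
  have h2 : evalAt z (conjForm w) = conj ξ := by simp [evalAt, conjForm, hξ, mul_comm]
  have h3 : evalAt z (perpForm w) = 1 - ξ * conj ξ := by
    rw [perpForm, map_sub, map_mul, h1, h2, ← hz]
    simp [evalAt, normForm, mul_comm]
  have hc : ((k + (q - 2)).choose k : ℂ) ≠ 0 := by
    exact_mod_cast (Nat.choose_pos (Nat.le_add_right _ _)).ne'
  have h4 : (((‖ξ‖ : ℝ) : ℂ)) ^ 2 = ξ * conj ξ := (Complex.mul_conj' ξ).symm
  rw [jacobiR]
  push_cast
  rw [mul_assoc, mul_div_cancel₀ _ hc, zonal, map_sum, mul_sum]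
  refine sum_congr rfl fun s hs => ?_
  have hs := mem_range_succ_iff.1 hs
  simp only [map_mul, map_pow, h1, h2, h3, h4]
  rw [show evalAt z (C (-1)) = -1 by simp [evalAt], show evalAt z (C _) = _ from eval_C _, show β + k - s = β + (k - s) by omega, pow_add, zonalCoeff]
  rw [show (2 * (ξ * conj ξ) - 1 - 1) / 2 = (-1) * (1 - ξ * conj ξ) by ring,
    show (2 * (ξ * conj ξ) - 1 + 1) / 2 = ξ * conj ξ by ring, mul_pow, mul_pow]
  push_cast
  ring

lemma normForm_dvd_zonal_sub (β k : ℕ) (w : Fin q → ℂ) : normForm q ∣ zonal β k w -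
    C (∑ s ∈ range (k + 1), (zonalCoeff (q - 2) β k s : ℂ)) *
      (linForm w ^ (β + k) * conjForm w ^ k) := by
  rw [zonal, map_sum, sum_mul, ← sum_sub_distrib]
  refine dvd_sum fun s hs => ?_
  have hs := mem_range_succ_iff.1 hs
  have h : normForm q ∣ (-perpForm w) ^ s - (linForm w * conjForm w) ^ s := by
    refine Dvd.dvd.trans ?_ (sub_dvd_pow_sub_pow _ _ s)
    rw [perpForm]
    exact ⟨-1, by ring⟩
  obtain ⟨t, rfl⟩ : ∃ t, k = t + s := ⟨k - s, by omega⟩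
  have : C ((zonalCoeff (q - 2) β (t + s) s : ℕ) * (-1) ^ s : ℂ) *
      (linForm w ^ (β + (t + s) - s) * conjForm w ^ (t + s - s) * perpForm w ^ s)
      - C (zonalCoeff (q - 2) β (t + s) s : ℂ) * (linForm w ^ (β + (t + s)) * conjForm w ^ (t + s))
      = C (zonalCoeff (q - 2) β (t + s) s : ℂ) * linForm w ^ (β + t) * conjForm w ^ t *
        ((-perpForm w) ^ s - (linForm w * conjForm w) ^ s) := by
    rw [← add_assoc, Nat.add_sub_cancel, Nat.add_sub_cancel, neg_pow (perpForm w)]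
    simp only [C_mul, C_pow, C_neg, C_1]
    ring
  rw [this]
  exact h.mul_left _

lemma fischer_zonal (hq : 2 ≤ q) (β k : ℕ) : ∃ c : ℝ, 0 < c ∧ ∀ z w : Fin q → ℂ,
      ∑ i, conj (z i) * z i = 1 → ∑ i, conj (w i) * w i = 1 →
      fischer (zonal β k w) (zonal β k z) = c * conj ((∑ i, z i * conj (w i)) ^ β *
        jacobiR (q - 2) β k (2 * ‖∑ i, z i * conj (w i)‖ ^ 2 - 1)) := by
  refine ⟨(∑ s ∈ range (k + 1), zonalCoeff (q - 2) β k s : ℕ) *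
    ((β + k).factorial * k.factorial * (k + (q - 2)).choose k), ?_, fun z w hz hw => ?_⟩
  · have h1 : 0 < ∑ s ∈ range (k + 1), zonalCoeff (q - 2) β k s :=
      sum_pos' (fun _ _ => Nat.zero_le _) ⟨0, by simp, by
        rw [zonalCoeff]
        exact Nat.mul_pos (Nat.choose_pos (by omega)) (Nat.choose_pos (by omega))⟩
    have h2 : 0 < (k + (q - 2)).choose k := Nat.choose_pos (by omega)
    positivity
  · obtain ⟨p, hp⟩ := normForm_dvd_zonal_sub β k z
    rw [sub_eq_iff_eq_add] at hp
    rw [hp, map_add, fischer_normForm_mul, lap_zonal_eq_zero hq hw, fischer_apply_C_mul,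
      (biHom_zonal β k w).fischer_eq, evalAt_zonal hz]
    have : fischer (0 : BiPoly q) p = 0 := by simp [fischer_apply]
    rw [this]
    simp only [map_mul, map_pow, map_natCast, Complex.conj_ofReal]
    push_cast
    ring

lemma hdot_eq_sum {z w : Ell2} (hz : z ∈ Omega q) (hw : w ∈ Omega q) :
    hdot z w = ∑ i : Fin q, z i * conj (w i) := by
  obtain ⟨v, -, rfl⟩ := exists_toEll hz
  obtain ⟨u, -, rfl⟩ := exists_toEll hw
  rw [hdot_toEll]
  simp [PiLp.inner_apply, toEll_apply]

lemma sum_conj_mul_self {z : Ell2} (hz : z ∈ Omega q) : ∑ i : Fin q, conj (z i) * z i = 1 := by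
  rw [← hdot_self hz, hdot_eq_sum hz hz]
  exact sum_congr rfl fun i _ => mul_comm _ _

end Reproducing

lemma conj_discR (q : ℕ∞) (m n : ℕ) (ξ : ℂ) : conj (discR q m n ξ) = discR q n m ξ := by
  unfold discR
  rcases lt_trichotomy n m with h | rfl | h
  · simp only [h.le, not_le.2 h, if_true, if_false, max_comm n m, min_comm n m]
    split_ifs <;> simp [mul_comm]
  · split_ifs <;> simp [mul_comm]
  · simp only [h.le, not_le.2 h, if_true, if_false, max_comm n m, min_comm n m]
    split_ifs <;> simp [mul_comm]

lemma pdk_discR (q : ℕ∞) (m n : ℕ) : PDK (Omega q) fun z w => discR q m n (hdot z w) := by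
  by_cases hq : q = ⊤ ∨ q ≤ 1
  · simpa only [discR, hq, if_true] using pdk_pow_mul_conj_pow _ m n
  wlog hmn : n ≤ m generalizing m n
  · simpa only [conj_discR] using (this n m (le_of_not_ge hmn)).star
  push Not at hq
  lift q to ℕ using hq.1
  have hq2 : 2 ≤ q := by exact_mod_cast hq.2
  obtain ⟨c, hc, h⟩ := fischer_zonal hq2 (m - n) n
  have h1 : PDK (Omega q) fun z w : Ell2 => (c⁻¹ : ℂ) *
      fischer (zonal (m - n) n fun i : Fin q => w i) (zonal (m - n) n fun i : Fin q => z i) :=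
    (PDK.const (by exact_mod_cast (inv_pos.2 hc).le)).mul (pdk_fischer _)
  refine h1.star.congr fun z hz w hw => ?_
  have hc' : (c : ℂ) ≠ 0 := by exact_mod_cast hc.ne'
  rw [h _ _ (sum_conj_mul_self hz) (sum_conj_mul_self hw), ← hdot_eq_sum hz hw,
    inv_mul_cancel_left₀ hc', Complex.conj_conj, discR, if_neg (by push Not; exact hq)]
  simp [hmn]

lemma norm_discR_le_one {q : ℕ∞} (hq : 1 ≤ q) (m n : ℕ) {ξ : ℂ} (hξ : ξ ∈ domD q) :
    ‖discR q m n ξ‖ ≤ 1 := by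
  simpa [discR_one] using (pdk_discR q m n).norm_le_of_hdot hq hξ

section Haar

open MeasureTheory

/-- On a compact group, a continuous positive definite function has nonnegative mean. -/
lemma integral_nonneg_of_pdk {G : Type*} [Group G] [TopologicalSpace G] [IsTopologicalGroup G]
    [CompactSpace G] [MeasurableSpace G] [BorelSpace G] (μ : Measure G) [IsProbabilityMeasure μ]
    [μ.IsMulLeftInvariant] {φ : G → ℂ} (hφ : Continuous φ)
    (h : PDK Set.univ fun x y : G => φ (y⁻¹ * x)) : 0 ≤ ∫ x, φ x ∂μ := by
  let F : C(G, C(G, ℂ)) := ContinuousMap.curry ⟨fun p : G × G => φ (p.2 * p.1), by fun_prop⟩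
  have hF : ∀ x y, F x y = φ (y * x) := fun x y => rfl
  have hF_int : Integrable F μ :=
    F.continuous.integrable_of_hasCompactSupport (HasCompactSupport.of_compactSpace _)
  have hval : ∀ y, (∫ x, F x ∂μ) y = ∫ x, φ x ∂μ := fun y => by
    have := (ContinuousMap.evalCLM ℝ y).integral_comp_comm hF_int
    simp only [ContinuousMap.evalCLM_apply, hF] at this
    rw [← this, integral_mul_left_eq_self φ y]
  have hmem : ∫ x, F x ∂μ ∈ closure (convexHull ℝ (Set.range F)) :=
    (convex_convexHull ℝ _).closure.integral_mem isClosed_closure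
      (.of_forall fun x => subset_closure (subset_convexHull ℝ _ ⟨x, rfl⟩)) hF_int
  have hcl : ∫ x, φ x ∂μ ∈ closure (Set.Ici (0 : ℂ)) := by
    refine Metric.mem_closure_iff.2 fun ε hε => ?_
    obtain ⟨P, hP, hd⟩ := Metric.mem_closure_iff.1 hmem ε hε
    obtain ⟨ι, _, c, z, hc0, hc1, hz, rfl⟩ := mem_convexHull_iff_exists_fintype.1 hP
    choose x hx using hz
    refine ⟨∑ i, ∑ j, (c i : ℂ) * conj (c j : ℂ) * φ ((x j)⁻¹ * x i),
      h ι x (fun _ => Set.mem_univ _) _, ?_⟩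
    have hc1' : ∑ j, (c j : ℂ) = 1 := by exact_mod_cast hc1
    have e1 : ∑ i, ∑ j, (c i : ℂ) * conj (c j : ℂ) * φ ((x j)⁻¹ * x i)
        = ∑ j, (c j : ℂ) * (∑ i, c i • z i) (x j)⁻¹ := by
      rw [sum_comm]
      simp [← hx, hF, mul_sum, mul_left_comm, mul_assoc]
    have e2 : ∫ x, φ x ∂μ = ∑ j, (c j : ℂ) * (∫ x, F x ∂μ) (x j)⁻¹ := by
      simp only [hval, ← sum_mul, hc1', one_mul]
    rw [e1, e2, dist_eq_norm, ← sum_sub_distrib]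
    refine lt_of_le_of_lt (norm_sum_le_of_le (f := fun j => (c j : ℂ) * _ - _)
      (n := fun j => c j * dist (∫ x, F x ∂μ) (∑ i, c i • z i)) univ fun j _ => ?_) ?_
    · rw [← mul_sub, norm_mul, Complex.norm_of_nonneg (hc0 j), ← dist_eq_norm]
      exact mul_le_mul_of_nonneg_left (ContinuousMap.dist_apply_le_dist _) (hc0 j)
    · rwa [← sum_mul, hc1, one_mul]
  rwa [isClosed_Ici.closure_eq] at hcl

instance (n : ℕ) : CompactSpace (Matrix.unitaryGroup (Fin n) ℂ) := by
  refine isCompact_iff_compactSpace.1 ?_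
  have h1 : IsCompact {A : Matrix (Fin n) (Fin n) ℂ | ∀ i, A i ∈ {v | ∀ j, v j ∈
      Metric.closedBall (0 : ℂ) 1}} :=
    isCompact_pi_infinite fun i => isCompact_pi_infinite fun j => isCompact_closedBall _ _
  refine h1.of_isClosed_subset ?_ fun A hA i j => ?_
  · have : ((Matrix.unitaryGroup (Fin n) ℂ : Submonoid _) : Set (Matrix (Fin n) (Fin n) ℂ))
        = {A | A * star A = 1} := Set.ext fun A => Matrix.mem_unitaryGroup_iff
    rw [this]
    exact isClosed_eq (by fun_prop) continuous_const
  · simpa using entry_norm_bound_of_unitary hA i j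

instance (n : ℕ) : MeasurableSpace (Matrix.unitaryGroup (Fin n) ℂ) := borel _

instance (n : ℕ) : BorelSpace (Matrix.unitaryGroup (Fin n) ℂ) := ⟨rfl⟩

/-- The normalized Haar measure of the unitary group. -/
def unitaryHaar (n : ℕ) : Measure (Matrix.unitaryGroup (Fin n) ℂ) :=
  Measure.haarMeasure ⊤

instance (n : ℕ) : IsProbabilityMeasure (unitaryHaar n) :=
  ⟨by simpa [unitaryHaar] using Measure.haarMeasure_self (K₀ := (⊤ : TopologicalSpace.PositiveCompacts
    (Matrix.unitaryGroup (Fin n) ℂ)))⟩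

instance (n : ℕ) : (unitaryHaar n).IsHaarMeasure := by unfold unitaryHaar; infer_instance

variable {d : ℕ}

/-- Every unit vector is the first row of a unitary matrix. -/
lemma exists_unitary_row {w : Fin (d + 1) → ℂ} (hw : ∑ i, conj (w i) * w i = 1) :
    ∃ W : Matrix.unitaryGroup (Fin (d + 1)) ℂ, ∀ i, W.1 0 i = w i := by
  let v : EuclideanSpace ℂ (Fin (d + 1)) := WithLp.toLp 2 fun i => conj (w i)
  have hv : ‖v‖ = 1 := by
    rw [EuclideanSpace.norm_eq, Real.sqrt_eq_one]
    have : ((∑ i, ‖v i‖ ^ 2 : ℝ) : ℂ) = 1 := by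
      rw [← hw]
      push_cast
      exact sum_congr rfl fun i _ => by simp [v, Complex.conj_mul']
    exact_mod_cast this
  have ho : Orthonormal ℂ (Set.domRestrict ({0} : Set (Fin (d + 1))) fun _ => v) := by
    refine ⟨fun _ => hv, fun i j hij => (hij (Subsingleton.elim _ _)).elim⟩
  obtain ⟨b, hb⟩ := ho.exists_orthonormalBasis_extension_of_card_eq (by simp)
  have hU := OrthonormalBasis.toMatrix_orthonormalBasis_mem_unitary
    (EuclideanSpace.basisFun (Fin (d + 1)) ℂ) b
  refine ⟨star ⟨_, hU⟩, fun i => ?_⟩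
  simp [Matrix.star_apply, Module.Basis.toMatrix_apply, hb, v]

/-- The first column of a unitary matrix, as a point of the sphere. -/
def firstCol (U : Matrix.unitaryGroup (Fin (d + 1)) ℂ) : Ell2 :=
  toEll (WithLp.toLp 2 fun i => U.1 i 0)

lemma hdot_firstCol (U V : Matrix.unitaryGroup (Fin (d + 1)) ℂ) :
    hdot (firstCol U) (firstCol V) = (V⁻¹ * U).1 0 0 := by
  rw [firstCol, firstCol, hdot_toEll]
  simp [PiLp.inner_apply, Matrix.mul_apply, Matrix.star_apply, mul_comm]

lemma firstCol_mem (U : Matrix.unitaryGroup (Fin (d + 1)) ℂ) :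
    firstCol U ∈ Omega (d + 1 : ℕ) := by
  refine toEll_mem_Omega le_rfl ?_
  have h := hdot_firstCol U U
  rw [inv_mul_cancel, firstCol, hdot_toEll, inner_self_eq_norm_sq_to_K] at h
  have h' : ‖(WithLp.toLp 2 fun i => U.1 i 0 : EuclideanSpace ℂ (Fin (d + 1)))‖ ^ 2 = 1 := by
    rw [OneMemClass.coe_one, Matrix.one_apply_eq] at h
    exact Complex.ofReal_injective (by rw [Complex.ofReal_pow, Complex.ofReal_one]; exact h)
  exact (pow_eq_one_iff_of_nonneg (norm_nonneg _) two_ne_zero).1 h'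

lemma entry_mem_domD (U : Matrix.unitaryGroup (Fin (d + 1)) ℂ) :
    U.1 0 0 ∈ domD (d + 1 : ℕ) := by
  have := hdot_mem_domD (firstCol_mem U) (firstCol_mem 1)
  rwa [hdot_firstCol, inv_one, one_mul] at this

lemma continuous_entry (i j : Fin (d + 1)) :
    Continuous fun U : Matrix.unitaryGroup (Fin (d + 1)) ℂ => U.1 i j :=
  continuous_subtype_val.matrix_elem i j

/-- The law of a coordinate of a uniformly distributed point of the unit sphere of `ℂ ^ (d + 1)`. -/
def coordLaw (d : ℕ) : Measure ℂ :=
  (unitaryHaar (d + 1)).map fun U => U.1 0 0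

instance (d : ℕ) : IsProbabilityMeasure (coordLaw d) :=
  Measure.isProbabilityMeasure_map (continuous_entry 0 0).aemeasurable

lemma ae_mem_domD (d : ℕ) : ∀ᵐ ξ ∂coordLaw d, ξ ∈ domD (d + 1 : ℕ) := by
  exact (ae_map_iff (p := (· ∈ domD (d + 1 : ℕ))) (continuous_entry 0 0).aemeasurable
    (isCompact_domD _).isClosed.measurableSet).2 (.of_forall entry_mem_domD)

lemma restrict_coordLaw (d : ℕ) : (coordLaw d).restrict (domD (d + 1 : ℕ)) = coordLaw d :=
  Measure.restrict_eq_self_of_ae_mem (ae_mem_domD d)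

lemma integrable_coordLaw {E : Type*} [NormedAddCommGroup E] {g : ℂ → E}
    (hg : ContinuousOn g (domD (d + 1 : ℕ))) : Integrable g (coordLaw d) := by
  rw [← restrict_coordLaw]
  exact hg.integrableOn_compact (isCompact_domD _)

lemma integral_coordLaw {g : ℂ → ℂ} (hg : ContinuousOn g (domD (d + 1 : ℕ))) :
    ∫ ξ, g ξ ∂coordLaw d = ∫ U, g (U.1 0 0) ∂unitaryHaar (d + 1) :=
  integral_map (continuous_entry 0 0).aemeasurable (integrable_coordLaw hg).aestronglyMeasurable

lemma continuous_comp_entry {g : ℂ → ℂ} (hg : ContinuousOn g (domD (d + 1 : ℕ))) :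
    Continuous fun U : Matrix.unitaryGroup (Fin (d + 1)) ℂ => g (U.1 0 0) :=
  hg.comp_continuous (continuous_entry 0 0) entry_mem_domD

lemma integral_coordLaw_nonneg {g : ℂ → ℂ} (hg : ContinuousOn g (domD (d + 1 : ℕ)))
    (h : PDK (Omega (d + 1 : ℕ)) fun z w => g (hdot z w)) : 0 ≤ ∫ ξ, g ξ ∂coordLaw d := by
  rw [integral_coordLaw hg]
  refine integral_nonneg_of_pdk _ (continuous_comp_entry hg) ?_
  simpa only [hdot_firstCol] using h.comp (T := Set.univ) firstCol fun U _ => firstCol_mem U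

lemma integral_coordLaw_eq {g : ℂ → ℂ} (hg : ContinuousOn g (domD (d + 1 : ℕ)))
    {w : Fin (d + 1) → ℂ} (hw : ∑ i, conj (w i) * w i = 1) :
    ∫ ξ, g ξ ∂coordLaw d = ∫ U, g (∑ i, w i * U.1 i 0) ∂unitaryHaar (d + 1) := by
  obtain ⟨W, hW⟩ := exists_unitary_row hw
  rw [integral_coordLaw hg, ← integral_mul_left_eq_self _ W]
  simp [Matrix.mul_apply, hW]

lemma coordLaw_pos {u : Set ℂ} (hu : IsOpen u) (h : (u ∩ domD (d + 1 : ℕ)).Nonempty) :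
    0 < coordLaw d u := by
  obtain ⟨ξ, hξu, hξ⟩ := h
  rw [coordLaw, Measure.map_apply (continuous_entry 0 0).measurable hu.measurableSet]
  refine (hu.preimage (continuous_entry 0 0)).measure_pos _ ?_
  have hs := sec_mem (by simp) hξ
  obtain ⟨W, hW⟩ := exists_unitary_row (w := fun i : Fin (d + 1) => conj (sec ξ i))
    (by simpa [mul_comm] using sum_conj_mul_self hs)
  refine ⟨W, ?_⟩
  have : W.1 0 0 = ξ := by simp [hW, sec, toEll_apply]
  simpa [this] using hξu

end Haar

section Moments

open MeasureTheory

variable {d : ℕ}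

lemma integrable_unitaryHaar {n : ℕ} {F : Matrix.unitaryGroup (Fin n) ℂ → ℂ} (hF : Continuous F) :
    Integrable F (unitaryHaar n) :=
  hF.integrable_of_hasCompactSupport (HasCompactSupport.of_compactSpace _)

/-- The even moments of the coordinate law. -/
def evenMoment (d n : ℕ) : ℂ := ∫ ξ, (ξ * conj ξ) ^ n ∂coordLaw d

/-- Mixed moments of two coordinates. -/
def mixedMoment (j : Fin (d + 1)) (a b a' b' : ℕ) : ℂ :=
  ∫ U, (U.1 0 0 ^ a * U.1 j 0 ^ b) * conj (U.1 0 0 ^ a' * U.1 j 0 ^ b') ∂unitaryHaar (d + 1)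

lemma continuous_mixed (j : Fin (d + 1)) (a b a' b' : ℕ) :
    Continuous fun U : Matrix.unitaryGroup (Fin (d + 1)) ℂ =>
      (U.1 0 0 ^ a * U.1 j 0 ^ b) * conj (U.1 0 0 ^ a' * U.1 j 0 ^ b') := by
  have h0 := continuous_entry (d := d) 0 0
  have hj := continuous_entry (d := d) j 0
  exact ((h0.pow _).mul (hj.pow _)).mul
    (Complex.continuous_conj.comp ((h0.pow _).mul (hj.pow _)))

/-- A phase separating two different exponents. -/
lemma exists_phase {b b' : ℕ} (h : b ≠ b') : ∃ u : ℂ, conj u * u = 1 ∧ u ^ b * conj u ^ b' = -1 := by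
  have hb : ((b : ℝ) - b') ≠ 0 := sub_ne_zero.2 (by exact_mod_cast h)
  have hc : conj (Complex.exp ((Real.pi / ((b : ℝ) - b') : ℝ) * Complex.I))
      = Complex.exp (-((Real.pi / ((b : ℝ) - b') : ℝ) * Complex.I)) := by
    rw [← Complex.exp_conj]
    simp
  refine ⟨Complex.exp ((Real.pi / ((b : ℝ) - b') : ℝ) * Complex.I), ?_, ?_⟩
  · rw [hc, ← Complex.exp_add]
    simp
  · rw [hc, ← Complex.exp_nat_mul, ← Complex.exp_nat_mul, ← Complex.exp_add, ← Complex.exp_pi_mul_I]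
    congr 1
    have hb' : ((b : ℂ) - b') ≠ 0 := by exact_mod_cast hb
    push_cast
    field_simp
    ring

lemma mixedMoment_eq_zero {j : Fin (d + 1)} (hj : j ≠ 0) (a a' : ℕ) {b b' : ℕ} (h : b ≠ b') :
    mixedMoment j a b a' b' = 0 := by
  obtain ⟨u, hu, hub⟩ := exists_phase h
  let W : Matrix.unitaryGroup (Fin (d + 1)) ℂ :=
    ⟨Matrix.diagonal (Function.update 1 j u), by
      rw [Matrix.mem_unitaryGroup_iff', Matrix.star_eq_conjTranspose,
        Matrix.diagonal_conjTranspose, Matrix.diagonal_mul_diagonal, ← Matrix.diagonal_one]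
      congr 1
      ext i
      by_cases hi : i = j
      · subst hi; simpa using hu
      · simp [hi]⟩
  have h1 := integral_mul_left_eq_self (μ := unitaryHaar (d + 1))
    (fun U => (U.1 0 0 ^ a * U.1 j 0 ^ b) * conj (U.1 0 0 ^ a' * U.1 j 0 ^ b')) W
  have h2 : ∀ U : Matrix.unitaryGroup (Fin (d + 1)) ℂ,
      ((W * U).1 0 0 ^ a * (W * U).1 j 0 ^ b) * conj ((W * U).1 0 0 ^ a' * (W * U).1 j 0 ^ b')
      = (-1) * ((U.1 0 0 ^ a * U.1 j 0 ^ b) * conj (U.1 0 0 ^ a' * U.1 j 0 ^ b')) := fun U => by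
    have e0 : (W * U).1 0 0 = U.1 0 0 := by
      simp [W, Matrix.diagonal_mul, hj.symm]
    have ej : (W * U).1 j 0 = u * U.1 j 0 := by
      simp [W, Matrix.diagonal_mul]
    rw [e0, ej, ← hub]
    simp only [map_mul, map_pow]
    ring
  simp only [h2] at h1
  rw [integral_const_mul] at h1
  have h3 : (-1) * mixedMoment j a b a' b' = mixedMoment j a b a' b' := h1
  linear_combination (-1 / 2) * h3

lemma evenMoment_eq_mixed (j : Fin (d + 1)) (n : ℕ) : evenMoment d n = mixedMoment j n 0 n 0 := by
  rw [evenMoment, integral_coordLaw (by fun_prop), mixedMoment]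
  simp [mul_pow]

lemma sum_mixedMoment {j : Fin (d + 1)} (hj : j ≠ 0) (n : ℕ) (x : ℝ) :
    ∑ k ∈ range (n + 1), (n.choose k : ℂ) ^ 2 * mixedMoment j (n - k) k (n - k) k * (x ^ 2) ^ k
      = (1 + x ^ 2 : ℂ) ^ n * evenMoment d n := by
  have hx : (0 : ℝ) < 1 + x ^ 2 := by positivity
  set r : ℝ := √(1 + x ^ 2) with hr
  have hr0 : (r : ℂ) ≠ 0 := by
    exact_mod_cast (Real.sqrt_pos.2 hx).ne'
  have hr2 : (r : ℂ) ^ 2 = 1 + x ^ 2 := by exact_mod_cast Real.sq_sqrt hx.le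
  let w : Fin (d + 1) → ℂ := fun i => if i = 0 then (r : ℂ)⁻¹ else if i = j then x / r else 0
  have hsum : ∀ f : Fin (d + 1) → ℂ, ∑ i, w i * f i = (f 0 + x * f j) / r := fun f => by
    rw [sum_eq_add 0 j hj.symm]
    · simp [w, hj]; field_simp
    · intro i _ hi; simp [w, hi.1, hi.2]
    · simp
    · simp
  have hw : ∑ i, conj (w i) * w i = 1 := by
    have := hsum fun i => conj (w i)
    simp only [mul_comm (w _)] at this
    rw [this]
    simp [w, hj]
    field_simp
    rw [hr2]
  have h1 := integral_coordLaw_eq (d := d) (g := fun ξ => (ξ * conj ξ) ^ n) (by fun_prop) hw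
  simp only [hsum] at h1
  rw [evenMoment, h1, ← integral_const_mul]
  have h2 : ∀ U : Matrix.unitaryGroup (Fin (d + 1)) ℂ,
      (1 + x ^ 2 : ℂ) ^ n * ((U.1 0 0 + x * U.1 j 0) / r * conj ((U.1 0 0 + x * U.1 j 0) / r)) ^ n
      = ∑ k ∈ range (n + 1), ∑ l ∈ range (n + 1), (n.choose k * n.choose l * x ^ k * x ^ l : ℂ) *
        ((U.1 0 0 ^ (n - k) * U.1 j 0 ^ k) * conj (U.1 0 0 ^ (n - l) * U.1 j 0 ^ l)) := fun U => by
    have : (U.1 0 0 + x * U.1 j 0) ^ n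
        = ∑ k ∈ range (n + 1), (n.choose k * x ^ k : ℂ) * (U.1 0 0 ^ (n - k) * U.1 j 0 ^ k) := by
      rw [add_comm, add_pow]
      exact sum_congr rfl fun k _ => by ring
    rw [← hr2, ← mul_pow]
    have e : (r : ℂ) ^ 2 * ((U.1 0 0 + x * U.1 j 0) / r * conj ((U.1 0 0 + x * U.1 j 0) / r))
        = (U.1 0 0 + x * U.1 j 0) * conj (U.1 0 0 + x * U.1 j 0) := by
      simp only [map_div₀, Complex.conj_ofReal]
      field_simp
    rw [e, mul_pow, ← map_pow, this, map_sum, sum_mul_sum]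
    refine sum_congr rfl fun k _ => sum_congr rfl fun l _ => ?_
    simp
    ring
  simp only [h2]
  rw [integral_finsetSum _ fun k _ => integrable_finsetSum _ fun l _ =>
    (integrable_unitaryHaar (continuous_mixed j _ _ _ _)).const_mul _]
  refine sum_congr rfl fun k hk => ?_
  rw [integral_finsetSum _ fun l _ =>
    (integrable_unitaryHaar (continuous_mixed j _ _ _ _)).const_mul _]
  simp only [integral_const_mul]
  rw [sum_eq_single k]
  · rw [mixedMoment]; ring
  · intro l _ hl
    have := mixedMoment_eq_zero hj (n - k) (n - l) hl.symm
    rw [mixedMoment] at this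
    rw [this, mul_zero]
  · exact fun h => (h hk).elim

lemma succ_mul_mixedMoment {j : Fin (d + 1)} (hj : j ≠ 0) (n : ℕ) :
    (n + 1 : ℂ) * mixedMoment j n 1 n 1 = evenMoment d (n + 1) := by
  let P : Polynomial ℂ := ∑ k ∈ range (n + 1 + 1), Polynomial.C (((n + 1).choose k : ℂ) ^ 2 *
    mixedMoment j (n + 1 - k) k (n + 1 - k) k) * Polynomial.X ^ k
  let Q : Polynomial ℂ := (1 + Polynomial.X) ^ (n + 1) * Polynomial.C (evenMoment d (n + 1))
  have hPQ : P = Q := by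
    refine Polynomial.eq_of_infinite_eval_eq P Q ?_
    refine Set.Infinite.mono (s := Set.range fun m : ℕ => ((m : ℂ))) ?_
      (Set.infinite_range_of_injective Nat.cast_injective)
    rintro _ ⟨m, rfl⟩
    have h := sum_mixedMoment hj (n + 1) (√m)
    have hm : ((√m : ℝ) : ℂ) ^ 2 = m := by exact_mod_cast Real.sq_sqrt (Nat.cast_nonneg m)
    rw [hm] at h
    simpa [P, Q, Polynomial.eval_finsetSum] using h
  have h := congr_arg (fun p => Polynomial.coeff p 1) hPQ
  simp only [P, Q, Polynomial.finsetSum_coeff, Polynomial.coeff_C_mul, Polynomial.coeff_X_pow,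
    Polynomial.coeff_mul_C, Polynomial.coeff_one_add_X_pow] at h
  simp at h
  have h0 : (n + 1 : ℂ) ≠ 0 := by exact_mod_cast n.succ_ne_zero
  apply mul_left_cancel₀ h0
  linear_combination h

lemma evenMoment_succ (d n : ℕ) :
    (n + 1 : ℂ) * evenMoment d n = (n + 1 + d : ℂ) * evenMoment d (n + 1) := by
  have h1 : evenMoment d n = ∑ j : Fin (d + 1), mixedMoment j n 1 n 1 := by
    simp only [mixedMoment]
    rw [← integral_finsetSum _ fun j _ => integrable_unitaryHaar (continuous_mixed j _ _ _ _),
      evenMoment, integral_coordLaw (by fun_prop)]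
    congr 1
    ext U
    have := sum_conj_mul_self (firstCol_mem U)
    simp only [firstCol, toEll_apply, Fin.is_lt, dite_true, Fin.eta] at this
    rw [← mul_one ((_ : ℂ) ^ n), ← this, mul_sum]
    refine sum_congr rfl fun i _ => ?_
    simp
    ring
  have h0 : mixedMoment (0 : Fin (d + 1)) n 1 n 1 = evenMoment d (n + 1) := by
    rw [evenMoment_eq_mixed 0, mixedMoment, mixedMoment]
    simp [pow_succ]
  rw [h1, Fin.sum_univ_succ, h0, mul_add, mul_sum]
  simp only [succ_mul_mixedMoment (Fin.succ_ne_zero _)]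
  simp
  ring

lemma evenMoment_eq (d n : ℕ) :
    evenMoment d n = (n.factorial * d.factorial : ℂ) / (n + d).factorial := by
  induction n with
  | zero =>
    have : (d.factorial : ℂ) ≠ 0 := by exact_mod_cast d.factorial_ne_zero
    simp [evenMoment, this]
  | succ n ih =>
    have h := evenMoment_succ d n
    have h0 : (n + 1 + d : ℂ) ≠ 0 := by exact_mod_cast (by omega : n + 1 + d ≠ 0)
    have h1 : ((n + d).factorial : ℂ) ≠ 0 := by exact_mod_cast (n + d).factorial_ne_zero
    rw [ih] at h
    rw [eq_comm, mul_comm, ← eq_div_iff h0] at h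
    rw [h, show n + 1 + d = n + d + 1 by ring, Nat.factorial_succ, Nat.factorial_succ]
    push_cast
    field_simp
    ring

end Moments

section Orthogonality

open MeasureTheory Polynomial

lemma integrable_of_continuous {d : ℕ} {g : ℂ → ℂ} (hg : Continuous g) :
    Integrable g (coordLaw d) :=
  integrable_coordLaw hg.continuousOn

/-- Beta integrals for the coordinate law. -/
lemma integral_pow_mul_one_sub_pow (α x s : ℕ) :
    ∫ ξ, (ξ * conj ξ) ^ x * (1 - ξ * conj ξ) ^ s ∂coordLaw (α + 1) =
      ((α + 1) * x.factorial * (s + α).factorial : ℂ) / (x + s + α + 1).factorial := by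
  induction s generalizing x with
  | zero =>
    have := evenMoment_eq (α + 1) x
    rw [evenMoment] at this
    simp only [pow_zero, mul_one, this, Nat.factorial_succ, zero_add, add_zero, ← add_assoc]
    push_cast
    ring
  | succ s ih =>
    have h : ∀ ξ : ℂ, (ξ * conj ξ) ^ x * (1 - ξ * conj ξ) ^ (s + 1) =
        (ξ * conj ξ) ^ x * (1 - ξ * conj ξ) ^ s - (ξ * conj ξ) ^ (x + 1) * (1 - ξ * conj ξ) ^ s :=
      fun ξ => by ring
    simp only [h]
    rw [integral_sub (integrable_of_continuous (by fun_prop))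
      (integrable_of_continuous (by fun_prop)), ih, ih,
      show x + (s + 1) + α + 1 = x + s + α + 1 + 1 by ring,
      show x + 1 + s + α + 1 = x + s + α + 1 + 1 by ring,
      show s + 1 + α = s + α + 1 by ring, Nat.factorial_succ (x + s + α + 1),
      Nat.factorial_succ x, Nat.factorial_succ (s + α)]
    have h1 : ((x + s + α + 1).factorial : ℂ) ≠ 0 := by exact_mod_cast Nat.factorial_ne_zero _
    have h2 : ((x + s + α + 1 + 1 : ℕ) : ℂ) ≠ 0 := by exact_mod_cast Nat.succ_ne_zero (x + s + α + 1)
    push_cast at h2 ⊢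
    field_simp
    ring

/-- The Jacobi polynomial in the variable `t = |ξ|²`. -/
def jacobiPoly (α β k : ℕ) : ℂ[X] :=
  C ((k + α).choose k : ℂ)⁻¹ * ∑ s ∈ range (k + 1),
    C ((k + α).choose (k - s) * (k + β).choose s : ℂ) * ((X - 1) ^ s * X ^ (k - s))

lemma jacobiR_eq_eval (α β k : ℕ) (ξ : ℂ) :
    ((jacobiR α β k (2 * ‖ξ‖ ^ 2 - 1) : ℝ) : ℂ) = (jacobiPoly α β k).eval (ξ * conj ξ) := by
  have h1 : ((2 * ‖ξ‖ ^ 2 - 1 - 1) / 2 : ℝ) = ‖ξ‖ ^ 2 - 1 := by ring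
  have h2 : ((2 * ‖ξ‖ ^ 2 - 1 + 1) / 2 : ℝ) = ‖ξ‖ ^ 2 := by ring
  rw [jacobiR, h1, h2, jacobiPoly, eval_mul, eval_C, eval_finsetSum, Complex.mul_conj',
    div_eq_inv_mul]
  push_cast
  congr 1
  refine sum_congr rfl fun s _ => ?_
  rw [eval_mul, eval_C, eval_mul, eval_pow, eval_pow, eval_sub, eval_X, eval_one]
  ring

lemma monic_sub_one_pow_mul (k s : ℕ) (h : s ≤ k) :
    ((X - 1 : ℂ[X]) ^ s * X ^ (k - s)).Monic ∧
      ((X - 1 : ℂ[X]) ^ s * X ^ (k - s)).natDegree = k := by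
  have hm : (X - 1 : ℂ[X]).Monic := by simpa using monic_X_sub_C (1 : ℂ)
  have hd : (X - 1 : ℂ[X]).natDegree = 1 := by simpa using natDegree_X_sub_C (1 : ℂ)
  refine ⟨(hm.pow s).mul (monic_X_pow _), ?_⟩
  rw [(hm.pow s).natDegree_mul (monic_X_pow _), hm.natDegree_pow, hd, natDegree_X_pow]
  omega

lemma natDegree_jacobiPoly_le (α β k : ℕ) : (jacobiPoly α β k).natDegree ≤ k := by
  refine (natDegree_C_mul_le _ _).trans (natDegree_sum_le_of_forall_le _ _ fun s hs => ?_)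
  refine (natDegree_C_mul_le _ _).trans_eq (monic_sub_one_pow_mul k s ?_).2
  exact Nat.lt_succ_iff.1 (mem_range.1 hs)

lemma coeff_jacobiPoly_ne_zero (α β k : ℕ) : (jacobiPoly α β k).coeff k ≠ 0 := by
  have hc : ∀ s ∈ range (k + 1), ((X - 1 : ℂ[X]) ^ s * X ^ (k - s)).coeff k = 1 := fun s hs => by
    obtain ⟨h1, h2⟩ := monic_sub_one_pow_mul k s (Nat.lt_succ_iff.1 (mem_range.1 hs))
    have := h1.coeff_natDegree
    rwa [h2] at this
  rw [jacobiPoly, coeff_C_mul, finsetSum_coeff]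
  refine mul_ne_zero (inv_ne_zero ?_) ?_
  · exact_mod_cast (Nat.choose_pos (Nat.le_add_right k α)).ne'
  · rw [sum_congr rfl fun s hs => by rw [coeff_C_mul, hc s hs, mul_one]]
    have : 0 < ∑ s ∈ range (k + 1), (k + α).choose (k - s) * (k + β).choose s := by
      refine sum_pos' (fun _ _ => Nat.zero_le _) ⟨0, by simp, ?_⟩
      simpa using Nat.choose_pos (Nat.le_add_right k α)
    exact_mod_cast this.ne'

lemma sum_alternating_choose_eq_zero {a k : ℕ} (h : a < k) (β : ℕ) :
    ∑ s ∈ range (k + 1), (-1 : ℂ) ^ s * k.choose s *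
      ((β + a + (k - s)).factorial / (β + (k - s)).factorial) = 0 := by
  have h1 := congr_fun (fwdDiff_iter_eq_zero_of_degree_lt (R := ℂ) (P := ascPochhammer ℂ a) (n := k)
    (by rwa [ascPochhammer_natDegree])) (β + 1)
  rw [fwdDiff_iter_eq_sum_shift, ← sum_range_reflect] at h1
  refine Eq.trans (sum_congr rfl fun s hs => ?_) h1
  have hs' : s ≤ k := Nat.lt_succ_iff.1 (mem_range.1 hs)
  have h2 := factorial_mul_ascPochhammer ℂ (β + (k - s)) a
  have h3 : ((β + (k - s)).factorial : ℂ) ≠ 0 := by exact_mod_cast Nat.factorial_ne_zero _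
  rw [show k + 1 - 1 - s = k - s by omega, show k - (k - s) = s by omega, Nat.choose_symm hs',
    zsmul_eq_mul, show β + a + (k - s) = β + (k - s) + a by omega, ← h2, mul_div_cancel_left₀ _ h3]
  push_cast
  congr 2
  simp
  ring

lemma integral_pow_mul_jacobiPoly {a k : ℕ} (h : a < k) (α β : ℕ) :
    ∫ ξ, (ξ * conj ξ) ^ (β + a) * (jacobiPoly α β k).eval (ξ * conj ξ) ∂coordLaw (α + 1) = 0 := by
  have h1 : ∀ ξ : ℂ, (ξ * conj ξ) ^ (β + a) * (jacobiPoly α β k).eval (ξ * conj ξ) =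
      ∑ s ∈ range (k + 1), (((k + α).choose k : ℂ)⁻¹ * ((k + α).choose (k - s) *
        (k + β).choose s) * (-1) ^ s) *
        ((ξ * conj ξ) ^ (β + a + (k - s)) * (1 - ξ * conj ξ) ^ s) := fun ξ => by
    rw [jacobiPoly, eval_mul, eval_C, eval_finsetSum, mul_sum, mul_sum]
    refine sum_congr rfl fun s _ => ?_
    rw [eval_mul, eval_C, eval_mul, eval_pow, eval_pow, eval_sub, eval_X, eval_one,
      show ξ * conj ξ - 1 = (-1) * (1 - ξ * conj ξ) by ring, mul_pow (-1 : ℂ)]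
    ring
  simp only [h1]
  rw [integral_finsetSum _ fun s _ => (integrable_of_continuous (by fun_prop)).const_mul _]
  simp only [integral_const_mul, integral_pow_mul_one_sub_pow]
  have h2 := sum_alternating_choose_eq_zero h β
  have h3 : ∀ s ∈ range (k + 1), (((k + α).choose k : ℂ)⁻¹ * ((k + α).choose (k - s) *
        (k + β).choose s) * (-1) ^ s) *
        (((α + 1) * (β + a + (k - s)).factorial * (s + α).factorial : ℂ) /
          (β + a + (k - s) + s + α + 1).factorial) =
      (((k + α).choose k : ℂ)⁻¹ * (α + 1) * (k + α).factorial * (k + β).factorial /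
          ((β + a + k + α + 1).factorial * k.factorial)) *
        ((-1 : ℂ) ^ s * k.choose s *
          ((β + a + (k - s)).factorial / (β + (k - s)).factorial)) := fun s hs => by
    have hs' : s ≤ k := Nat.lt_succ_iff.1 (mem_range.1 hs)
    rw [show β + a + (k - s) + s + α + 1 = β + a + k + α + 1 by omega,
      Nat.cast_choose ℂ (show k - s ≤ k + α by omega), Nat.cast_choose ℂ hs',
      Nat.cast_choose ℂ (show s ≤ k + β by omega), show k + α - (k - s) = s + α by omega,
      show k + β - s = β + (k - s) by omega]
    have f0 : ∀ n : ℕ, (n.factorial : ℂ) ≠ 0 := fun n => by exact_mod_cast n.factorial_ne_zero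
    have f1 := f0 (s + α)
    have f2 := f0 s
    have f3 := f0 (k - s)
    have f4 := f0 k
    have f5 := f0 (β + (k - s))
    have f6 := f0 (β + a + k + α + 1)
    field_simp
  rw [sum_congr rfl h3, ← mul_sum, h2, mul_zero]

lemma integral_pow_mul_poly_mul_jacobiPoly {k : ℕ} (P : ℂ[X]) (hP : P.natDegree < k) (α β : ℕ) :
    ∫ ξ, (ξ * conj ξ) ^ β * P.eval (ξ * conj ξ) * (jacobiPoly α β k).eval (ξ * conj ξ)
      ∂coordLaw (α + 1) = 0 := by
  have h1 : ∀ ξ : ℂ,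
      (ξ * conj ξ) ^ β * P.eval (ξ * conj ξ) * (jacobiPoly α β k).eval (ξ * conj ξ) =
      ∑ a ∈ range k, P.coeff a *
        ((ξ * conj ξ) ^ (β + a) * (jacobiPoly α β k).eval (ξ * conj ξ)) := fun ξ => by
    rw [eval_eq_sum_range' hP, mul_sum, sum_mul]
    exact sum_congr rfl fun a _ => by ring
  simp only [h1]
  rw [integral_finsetSum _ fun s _ => (integrable_of_continuous (by fun_prop)).const_mul _]
  refine sum_eq_zero fun a ha => ?_
  rw [integral_const_mul, integral_pow_mul_jacobiPoly (mem_range.1 ha), mul_zero]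

lemma discR_of_le {α m n : ℕ} (h : n ≤ m) (ξ : ℂ) :
    discR ((α + 1 + 1 : ℕ) : ℕ∞) m n ξ =
      ξ ^ (m - n) * (jacobiPoly α (m - n) n).eval (ξ * conj ξ) := by
  have h1 : ¬ (((α + 1 + 1 : ℕ) : ℕ∞) = ⊤ ∨ ((α + 1 + 1 : ℕ) : ℕ∞) ≤ 1) := by
    push Not
    refine ⟨ENat.natCast_ne_top _, ?_⟩
    exact_mod_cast (by omega : 1 < α + 1 + 1)
  rw [discR, if_neg h1, if_pos h, ← jacobiR_eq_eval, min_eq_right h, max_eq_left h,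
    ENat.toNat_natCast]
  simp

lemma discR_phase (q : ℕ∞) (m n : ℕ) {u : ℂ} (hu : conj u * u = 1) (ξ : ℂ) :
    discR q m n (u * ξ) = u ^ m * conj u ^ n * discR q m n ξ := by
  have hn : ‖u‖ = 1 := by
    have h : ((‖u‖ ^ 2 : ℝ) : ℂ) = 1 := by rw [← hu, Complex.conj_mul']; push_cast; rfl
    have h' : ‖u‖ ^ 2 = 1 := by exact_mod_cast h
    exact (pow_eq_one_iff_of_nonneg (norm_nonneg u) two_ne_zero).1 h'
  unfold discR
  rw [norm_mul, hn, one_mul, map_mul]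
  split_ifs with h1 h2
  · ring
  · have : u ^ m * conj u ^ n = u ^ (m - n) := by
      conv_lhs => rw [← Nat.sub_add_cancel h2, pow_add, mul_assoc, ← mul_pow, mul_comm u, hu,
        one_pow, mul_one]
    rw [this, mul_pow]
    ring
  · have : u ^ m * conj u ^ n = conj u ^ (n - m) := by
      conv_lhs => rw [← Nat.sub_add_cancel (le_of_not_ge h2), pow_add, mul_left_comm, ← mul_pow,
        mul_comm u, hu, one_pow, mul_one]
    rw [this, mul_pow]
    ring

lemma integral_discR_mul_eq_zero_of_phase {d m n m' n' : ℕ} (h : m + n' ≠ n + m') :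
    ∫ ξ, discR (d + 1 : ℕ) m n ξ * discR (d + 1 : ℕ) n' m' ξ ∂coordLaw d = 0 := by
  obtain ⟨u, hu, hub⟩ := exists_phase h
  have hc : Continuous fun ξ => discR (d + 1 : ℕ) m n ξ * discR (d + 1 : ℕ) n' m' ξ :=
    (continuous_discR _ _ _).mul (continuous_discR _ _ _)
  have h1 := integral_coordLaw_eq (d := d) hc.continuousOn
    (w := fun i => if i = 0 then u else 0) (by simp [hu])
  simp only [ite_mul, zero_mul, sum_ite_eq', mem_univ, if_true] at h1
  have h2 : ∀ ξ, discR (d + 1 : ℕ) m n (u * ξ) * discR (d + 1 : ℕ) n' m' (u * ξ) =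
      (-1) * (discR (d + 1 : ℕ) m n ξ * discR (d + 1 : ℕ) n' m' ξ) := fun ξ => by
    rw [discR_phase _ _ _ hu, discR_phase _ _ _ hu, ← hub]
    ring
  simp only [h2] at h1
  rw [integral_const_mul, ← integral_coordLaw hc.continuousOn] at h1
  linear_combination (1 / 2) * h1

lemma integral_discR_mul_of_lt {α m n m' n' : ℕ} (h : m + n' = n + m') (hn : n ≤ m) (hlt : n' < n) :
    ∫ ξ, discR (α + 1 + 1 : ℕ) m n ξ * discR (α + 1 + 1 : ℕ) n' m' ξ ∂coordLaw (α + 1) = 0 := by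
  have h1 : ∀ ξ, discR (α + 1 + 1 : ℕ) m n ξ * discR (α + 1 + 1 : ℕ) n' m' ξ =
      (ξ * conj ξ) ^ (m - n) * ((jacobiPoly α (m - n) n').map (starRingEnd ℂ)).eval (ξ * conj ξ) *
        (jacobiPoly α (m - n) n).eval (ξ * conj ξ) := fun ξ => by
    rw [← conj_discR _ m' n', discR_of_le hn, discR_of_le (by omega),
      show m' - n' = m - n by omega, map_mul, map_pow, ← Polynomial.eval_map_apply,
      map_mul, Complex.conj_conj, mul_comm (conj ξ), mul_pow]
    ring
  simp only [h1]
  exact integral_pow_mul_poly_mul_jacobiPoly _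
    ((natDegree_map_le.trans (natDegree_jacobiPoly_le _ _ _)).trans_lt hlt) _ _

/-- Orthogonality of the disc polynomials. -/
lemma integral_discR_mul_conj (d : ℕ) {i j : ℕ × ℕ} (hi : Adm (d + 1 : ℕ) i)
    (hj : Adm (d + 1 : ℕ) j) (hij : i ≠ j) :
    ∫ ξ, discR (d + 1 : ℕ) i.1 i.2 ξ * conj (discR (d + 1 : ℕ) j.1 j.2 ξ) ∂coordLaw d = 0 := by
  obtain ⟨m, n⟩ := i
  obtain ⟨m', n'⟩ := j
  simp only [conj_discR]
  by_cases h : m + n' = n + m'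
  swap
  · exact integral_discR_mul_eq_zero_of_phase h
  obtain _ | α := d
  · have h1 : m * n = 0 := hi (by simp)
    have h2 : m' * n' = 0 := hj (by simp)
    refine (hij ?_).elim
    rcases Nat.mul_eq_zero.1 h1 with h1 | h1 <;> rcases Nat.mul_eq_zero.1 h2 with h2 | h2 <;>
    · ext <;> simp only <;> omega
  have hc : ∀ m n m' n' : ℕ,
      ∫ ξ, discR (α + 1 + 1 : ℕ) n m ξ * discR (α + 1 + 1 : ℕ) m' n' ξ ∂coordLaw (α + 1) =
      conj (∫ ξ, discR (α + 1 + 1 : ℕ) m n ξ * discR (α + 1 + 1 : ℕ) n' m' ξ ∂coordLaw (α + 1)) := by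
    intro m n m' n'
    rw [← integral_conj]
    simp only [map_mul, conj_discR]
  rcases lt_trichotomy n' n with hlt | heq | hgt
  · rcases le_total n m with hn | hn
    · exact integral_discR_mul_of_lt h hn hlt
    · rw [hc n m n' m', integral_discR_mul_of_lt (by omega) hn (by omega), map_zero]
  · exact (hij (by ext <;> simp only <;> omega)).elim
  · simp only [mul_comm (discR _ m n _)]
    rcases le_total n m with hn | hn
    · rw [hc m' n' m n, integral_discR_mul_of_lt (by omega) (by omega) hgt, map_zero]
    · exact integral_discR_mul_of_lt (by omega) (by omega) (by omega)

end Orthogonality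

section Expansion

/-- `g` has the absolutely summable expansion with coefficients `a` in disc polynomials. -/
structure IsExp (q : ℕ∞) (a : ℕ × ℕ → ℂ) (g : ℂ → ℂ) : Prop where
  eq_zero : ∀ i, ¬ Adm q i → a i = 0
  summable : Summable fun i => ‖a i‖
  hasSum : ∀ ξ ∈ domD q, HasSum (fun i => a i * discR q i.1 i.2 ξ) (g ξ)

variable {q : ℕ∞}

lemma summable_mul_discR (hq : 1 ≤ q) {a : ℕ × ℕ → ℂ} (ha : Summable fun i => ‖a i‖) {ξ : ℂ}
    (hξ : ξ ∈ domD q) : Summable fun i => a i * discR q i.1 i.2 ξ := by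
  refine Summable.of_norm_bounded ha fun i => ?_
  rw [norm_mul]
  exact mul_le_of_le_one_right (norm_nonneg _) (norm_discR_le_one hq _ _ hξ)

lemma isExp_tsum (hq : 1 ≤ q) {a : ℕ × ℕ → ℂ} (h0 : ∀ i, ¬ Adm q i → a i = 0)
    (ha : Summable fun i => ‖a i‖) : IsExp q a fun ξ => ∑' i, a i * discR q i.1 i.2 ξ :=
  ⟨h0, ha, fun _ hξ => (summable_mul_discR hq ha hξ).hasSum⟩

lemma IsExp.continuousOn (hq : 1 ≤ q) {a : ℕ × ℕ → ℂ} {g : ℂ → ℂ} (h : IsExp q a g) :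
    ContinuousOn g (domD q) := by
  have : ContinuousOn (fun ξ => ∑' i, a i * discR q i.1 i.2 ξ) (domD q) := by
    refine continuousOn_tsum
      (fun i => (continuous_const.mul (continuous_discR _ _ _)).continuousOn) h.summable
      fun i ξ hξ => ?_
    rw [norm_mul]
    exact mul_le_of_le_one_right (norm_nonneg _) (norm_discR_le_one hq _ _ hξ)
  exact this.congr fun ξ hξ => (h.hasSum ξ hξ).tsum_eq.symm

lemma IsExp.add {a b : ℕ × ℕ → ℂ} {g f : ℂ → ℂ} (h : IsExp q a g) (h' : IsExp q b f) :
    IsExp q (a + b) (g + f) where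
  eq_zero i hi := by simp [h.eq_zero i hi, h'.eq_zero i hi]
  summable := (h.summable.add h'.summable).of_nonneg_of_le (fun _ => norm_nonneg _)
    fun i => norm_add_le _ _
  hasSum ξ hξ := by
    simpa only [Pi.add_apply, add_mul] using (h.hasSum ξ hξ).add (h'.hasSum ξ hξ)

lemma IsExp.const_mul (c : ℂ) {a : ℕ × ℕ → ℂ} {g : ℂ → ℂ} (h : IsExp q a g) :
    IsExp q (fun i => c * a i) (fun ξ => c * g ξ) where
  eq_zero i hi := by simp [h.eq_zero i hi]
  summable := by simpa only [norm_mul] using h.summable.mul_left ‖c‖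
  hasSum ξ hξ := by simpa only [mul_assoc] using (h.hasSum ξ hξ).mul_left c

lemma IsExp.congr {a : ℕ × ℕ → ℂ} {g f : ℂ → ℂ} (h : IsExp q a g)
    (hgf : ∀ ξ ∈ domD q, g ξ = f ξ) : IsExp q a f :=
  ⟨h.eq_zero, h.summable, fun ξ hξ => hgf ξ hξ ▸ h.hasSum ξ hξ⟩

end Expansion

section Span

variable (q : ℕ∞)

/-- The disc polynomial as a continuous function on its domain. -/
def discC (i : ℕ × ℕ) : C(domD q, ℂ) := ⟨fun ξ => discR q i.1 i.2 ξ,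
  (continuous_discR _ _ _).comp continuous_subtype_val⟩

/-- The linear span of the admissible disc polynomials. -/
def discSpan : Submodule ℂ C(domD q, ℂ) := Submodule.span ℂ (discC q '' {i | Adm q i})

/-- The coordinate function. -/
def coordC : C(domD q, ℂ) := ContinuousMap.restrict (domD q) (.id ℂ)

variable {q}

lemma coordC_apply (ξ : domD q) : coordC q ξ = ξ := rfl

lemma discC_apply (i : ℕ × ℕ) (ξ : domD q) : discC q i ξ = discR q i.1 i.2 ξ := rfl

lemma discC_mem {i : ℕ × ℕ} (hi : Adm q i) : discC q i ∈ discSpan q :=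
  Submodule.subset_span ⟨i, hi, rfl⟩

lemma star_mem_discSpan {w : C(domD q, ℂ)} (hw : w ∈ discSpan q) : star w ∈ discSpan q := by
  induction hw using Submodule.span_induction with
  | mem x hx =>
    obtain ⟨i, hi, rfl⟩ := hx
    have : star (discC q i) = discC q i.swap := by
      ext ξ
      exact conj_discR q i.1 i.2 ξ
    rw [this]
    exact discC_mem fun h => by rw [mul_comm]; exact hi h
  | zero => simp
  | add x y _ _ hx hy => rw [star_add]; exact add_mem hx hy
  | smul c x _ hx => rw [star_smul]; exact Submodule.smul_mem _ _ hx

lemma pow_mul_pow_mem_one (a b : ℕ) (hab : b ≤ a) :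
    coordC 1 ^ a * star (coordC 1) ^ b ∈ discSpan 1 := by
  have : coordC 1 ^ a * star (coordC 1) ^ b = discC 1 (a - b, 0) := by
    ext ξ
    have hξ : (ξ : ℂ) * conj (ξ : ℂ) = 1 := by
      have h := ξ.2
      simp only [domD, if_true, mem_sphere_zero_iff_norm] at h
      rw [Complex.mul_conj', h]
      simp
    have h1 : (ξ : ℂ) ^ a * conj (ξ : ℂ) ^ b = (ξ : ℂ) ^ (a - b) := by
      conv_lhs => rw [← Nat.sub_add_cancel hab, pow_add, mul_assoc, ← mul_pow, hξ, one_pow, mul_one]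
    simpa [discC_apply, discR, coordC_apply] using h1
  rw [this]
  exact discC_mem fun _ => by simp

open Polynomial in
lemma pow_mul_pow_mem_two (α β : ℕ) (b : ℕ) :
    coordC (α + 1 + 1 : ℕ) ^ β * (coordC (α + 1 + 1 : ℕ) * star (coordC (α + 1 + 1 : ℕ))) ^ b ∈
      discSpan (α + 1 + 1 : ℕ) := by
  induction b using Nat.strong_induction_on with
  | _ b ih =>
    set P := jacobiPoly α β b
    have hP := coeff_jacobiPoly_ne_zero α β b
    have h1 : discC (α + 1 + 1 : ℕ) (β + b, b) = ∑ j ∈ range (b + 1), P.coeff j •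
        (coordC (α + 1 + 1 : ℕ) ^ β *
          (coordC (α + 1 + 1 : ℕ) * star (coordC (α + 1 + 1 : ℕ))) ^ j) := by
      ext ξ
      rw [discC_apply, discR_of_le (Nat.le_add_left b β), Nat.add_sub_cancel,
        eval_eq_sum_range' (Nat.lt_succ_of_le (natDegree_jacobiPoly_le _ _ _)), mul_sum]
      simp only [ContinuousMap.sum_apply, ContinuousMap.smul_apply, ContinuousMap.mul_apply,
        ContinuousMap.pow_apply, ContinuousMap.star_apply, coordC_apply, smul_eq_mul]
      exact sum_congr rfl fun j _ => by simp [P]; ring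
    rw [sum_range_succ] at h1
    have h2 : P.coeff b • (coordC (α + 1 + 1 : ℕ) ^ β *
          (coordC (α + 1 + 1 : ℕ) * star (coordC (α + 1 + 1 : ℕ))) ^ b) ∈
        discSpan (α + 1 + 1 : ℕ) := by
      rw [← sub_eq_iff_eq_add'.2 h1]
      refine sub_mem (discC_mem fun h => ?_) (sum_mem fun j hj =>
        Submodule.smul_mem _ _ (ih j (mem_range.1 hj)))
      exact absurd h (by exact_mod_cast (by omega : α + 1 + 1 ≠ 1))
    exact (Submodule.smul_mem_iff _ hP).1 h2

lemma pow_mul_pow_mem (d a b : ℕ) :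
    coordC (d + 1 : ℕ) ^ a * star (coordC (d + 1 : ℕ)) ^ b ∈ discSpan (d + 1 : ℕ) := by
  wlog hab : b ≤ a generalizing a b
  · have := star_mem_discSpan (this b a (le_of_not_ge hab))
    simpa [mul_comm] using this
  obtain _ | α := d
  · exact pow_mul_pow_mem_one a b hab
  · have := pow_mul_pow_mem_two α (a - b) b
    rwa [mul_pow, ← mul_assoc, ← pow_add, Nat.sub_add_cancel hab] at this

lemma mem_discSpan_of_mem_adjoin (d : ℕ) {w : C(domD (d + 1 : ℕ), ℂ)}
    (hw : w ∈ StarAlgebra.adjoin ℂ {coordC (d + 1 : ℕ)}) : w ∈ discSpan (d + 1 : ℕ) := by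
  have h := StarAlgebra.adjoin_eq_span (R := ℂ) {coordC (d + 1 : ℕ)}
  have h1 : w ∈ Submodule.span ℂ
      (Submonoid.closure ({coordC (d + 1 : ℕ)} ∪ star {coordC (d + 1 : ℕ)}) :
        Set C(domD (d + 1 : ℕ), ℂ)) := by
    rw [← h]; exact hw
  refine Submodule.span_le.2 ?_ h1
  intro x hx
  rw [Set.star_singleton, Set.singleton_union, SetLike.mem_coe, Submonoid.mem_closure_pair] at hx
  obtain ⟨a, b, rfl⟩ := hx
  exact pow_mul_pow_mem d a b

lemma exists_sum_of_mem_discSpan {w : C(domD q, ℂ)} (hw : w ∈ discSpan q) :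
    ∃ (J : Finset (ℕ × ℕ)) (b : ℕ × ℕ → ℂ), (∀ j ∈ J, Adm q j) ∧
      ∀ ξ : domD q, w ξ = ∑ j ∈ J, b j * discR q j.1 j.2 ξ := by
  obtain ⟨l, hl, rfl⟩ := (Finsupp.mem_span_image_iff_linearCombination ℂ).1 hw
  refine ⟨l.support, l, fun j hj => hl hj, fun ξ => ?_⟩
  rw [Finsupp.linearCombination_apply, Finsupp.sum, ContinuousMap.sum_apply]
  rfl

lemma exists_approx (d : ℕ) {g : ℂ → ℂ} (hg : ContinuousOn g (domD (d + 1 : ℕ))) {ε : ℝ}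
    (hε : 0 < ε) : ∃ (J : Finset (ℕ × ℕ)) (b : ℕ × ℕ → ℂ), (∀ j ∈ J, Adm (d + 1 : ℕ) j) ∧
      ∀ ξ ∈ domD (d + 1 : ℕ), ‖g ξ - ∑ j ∈ J, b j * discR (d + 1 : ℕ) j.1 j.2 ξ‖ ≤ ε := by
  have : CompactSpace (domD (d + 1 : ℕ)) := isCompact_iff_compactSpace.1 (isCompact_domD _)
  let G : C(domD (d + 1 : ℕ), ℂ) := ⟨_, hg.domRestrict⟩
  have h1 : G ∈ StarAlgebra.elemental ℂ (coordC (d + 1 : ℕ)) := by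
    rw [coordC, ContinuousMap.elemental_id_eq_top]; trivial
  have h2 : G ∈ closure (StarAlgebra.adjoin ℂ {coordC (d + 1 : ℕ)} :
      Set C(domD (d + 1 : ℕ), ℂ)) := h1
  obtain ⟨w, hw, hd⟩ := Metric.mem_closure_iff.1 h2 ε hε
  obtain ⟨J, b, hJ, hb⟩ := exists_sum_of_mem_discSpan (mem_discSpan_of_mem_adjoin d hw)
  refine ⟨J, b, hJ, fun ξ hξ => ?_⟩
  have := (ContinuousMap.dist_apply_le_dist (f := G) (g := w) ⟨ξ, hξ⟩).trans hd.le
  rwa [hb, dist_eq_norm] at this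

end Span

section FiniteSlot

open MeasureTheory

variable {d : ℕ}

lemma integral_congr_domD {f g : ℂ → ℂ} (h : ∀ ξ ∈ domD (d + 1 : ℕ), f ξ = g ξ) :
    ∫ ξ, f ξ ∂coordLaw d = ∫ ξ, g ξ ∂coordLaw d :=
  integral_congr_ae ((ae_mem_domD d).mono fun ξ hξ => h ξ hξ)

lemma integral_normSq_pos {g : ℂ → ℂ} (hg : ContinuousOn g (domD (d + 1 : ℕ))) {ξ₀ : ℂ}
    (h₀ : ξ₀ ∈ domD (d + 1 : ℕ)) (h : g ξ₀ ≠ 0) : 0 < ∫ ξ, ‖g ξ‖ ^ 2 ∂coordLaw d := by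
  rw [integral_pos_iff_support_of_nonneg (fun ξ => sq_nonneg _)
    (integrable_coordLaw (hg.norm.pow 2))]
  obtain ⟨u, hu, hgu⟩ := continuousOn_iff'.1 hg {0}ᶜ isOpen_compl_singleton
  refine (coordLaw_pos hu ⟨ξ₀, ?_⟩).trans_le (measure_mono_ae ?_)
  · rw [← hgu]; exact ⟨h, h₀⟩
  · filter_upwards [ae_mem_domD d] with ξ hξ hξu
    have : ξ ∈ g ⁻¹' {0}ᶜ ∩ domD (d + 1 : ℕ) := by rw [hgu]; exact ⟨hξu, hξ⟩
    exact pow_ne_zero 2 (norm_ne_zero_iff.2 this.1)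

/-- The squared `L²` norm of a disc polynomial. -/
def discNorm (d : ℕ) (i : ℕ × ℕ) : ℝ := ∫ ξ, ‖discR (d + 1 : ℕ) i.1 i.2 ξ‖ ^ 2 ∂coordLaw d

lemma discNorm_pos (d : ℕ) (i : ℕ × ℕ) : 0 < discNorm d i :=
  integral_normSq_pos (continuous_discR _ _ _).continuousOn (one_mem_domD _)
    (by rw [discR_one]; exact one_ne_zero)

lemma integral_discR_mul_conj_self (d : ℕ) (i : ℕ × ℕ) :
    ∫ ξ, discR (d + 1 : ℕ) i.1 i.2 ξ * conj (discR (d + 1 : ℕ) i.1 i.2 ξ) ∂coordLaw d =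
      discNorm d i := by
  rw [discNorm, ← integral_complex_ofReal]
  simp only [Complex.mul_conj']
  push_cast
  rfl

lemma integral_discR_mul_conj' (d : ℕ) {i j : ℕ × ℕ} (hi : Adm (d + 1 : ℕ) i)
    (hj : Adm (d + 1 : ℕ) j) :
    ∫ ξ, discR (d + 1 : ℕ) i.1 i.2 ξ * conj (discR (d + 1 : ℕ) j.1 j.2 ξ) ∂coordLaw d =
      if i = j then (discNorm d j : ℂ) else 0 := by
  split_ifs with h
  · rw [h, integral_discR_mul_conj_self]
  · exact integral_discR_mul_conj d hi hj h

/-- The Fourier integrals of `g` against disc polynomials. -/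
def fourier (d : ℕ) (g : ℂ → ℂ) (j : ℕ × ℕ) : ℂ :=
  ∫ ξ, g ξ * conj (discR (d + 1 : ℕ) j.1 j.2 ξ) ∂coordLaw d

lemma continuous_conj_discR (q : ℕ∞) (m n : ℕ) : Continuous fun ξ => conj (discR q m n ξ) :=
  Complex.continuous_conj.comp (continuous_discR _ _ _)

lemma integrable_mul_conj_discR {g : ℂ → ℂ} (hg : ContinuousOn g (domD (d + 1 : ℕ))) (j : ℕ × ℕ) :
    Integrable (fun ξ => g ξ * conj (discR (d + 1 : ℕ) j.1 j.2 ξ)) (coordLaw d) :=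
  integrable_coordLaw (hg.mul (continuous_conj_discR _ _ _).continuousOn)

lemma fourier_nonneg {g : ℂ → ℂ} (hg : ContinuousOn g (domD (d + 1 : ℕ)))
    (h : PDK (Omega (d + 1 : ℕ)) fun z w => g (hdot z w)) (j : ℕ × ℕ) : 0 ≤ fourier d g j :=
  integral_coordLaw_nonneg (hg.mul (continuous_conj_discR _ _ _).continuousOn)
    (h.mul (pdk_discR _ _ _).star)

lemma fourier_of_isExp {a : ℕ × ℕ → ℂ} {g : ℂ → ℂ} (h : IsExp (d + 1 : ℕ) a g) {j : ℕ × ℕ}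
    (hj : Adm (d + 1 : ℕ) j) : fourier d g j = a j * discNorm d j := by
  have hq : (1 : ℕ∞) ≤ (d + 1 : ℕ) := by exact_mod_cast Nat.le_add_left 1 d
  let F : ℕ × ℕ → ℂ → ℂ := fun i ξ => a i * discR (d + 1 : ℕ) i.1 i.2 ξ *
    conj (discR (d + 1 : ℕ) j.1 j.2 ξ)
  have hFc : ∀ i, Continuous (F i) := fun i =>
    (continuous_const.mul (continuous_discR _ _ _)).mul (continuous_conj_discR _ _ _)
  have hF : ∀ i, Integrable (F i) (coordLaw d) := fun i => integrable_of_continuous (hFc i)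
  have hb : ∀ i, ∫ ξ, ‖F i ξ‖ ∂coordLaw d ≤ ‖a i‖ := fun i => by
    have := integral_mono_ae (hF i).norm (integrable_const ‖a i‖) (by
      filter_upwards [ae_mem_domD d] with ξ hξ
      simp only [F, norm_mul, RCLike.norm_conj]
      have h1 := norm_discR_le_one hq i.1 i.2 hξ
      have h2 := norm_discR_le_one hq j.1 j.2 hξ
      calc _ ≤ ‖a i‖ * 1 * 1 := by gcongr
        _ = _ := by ring)
    simpa using this
  have hs : Summable fun i => ∫ ξ, ‖F i ξ‖ ∂coordLaw d :=
    h.summable.of_nonneg_of_le (fun i => integral_nonneg fun _ => norm_nonneg _) hb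
  have h1 := hasSum_integral_of_summable_integral_norm hF hs
  have h2 : ∫ ξ, ∑' i, F i ξ ∂coordLaw d = fourier d g j :=
    integral_congr_domD fun ξ hξ => ((h.hasSum ξ hξ).mul_right _).tsum_eq
  rw [h2] at h1
  refine h1.unique ?_
  have h3 : ∀ i, i ≠ j → ∫ ξ, F i ξ ∂coordLaw d = 0 := fun i hij => by
    simp only [F, mul_assoc, integral_const_mul]
    by_cases hi : Adm (d + 1 : ℕ) i
    · rw [integral_discR_mul_conj d hi hj hij, mul_zero]
    · rw [h.eq_zero i hi, zero_mul]
  have h4 : ∫ ξ, F j ξ ∂coordLaw d = a j * discNorm d j := by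
    simp only [F, mul_assoc, integral_const_mul, integral_discR_mul_conj_self]
  rw [← h4]
  exact hasSum_single j h3

lemma isExp_unique_nat {a b : ℕ × ℕ → ℂ} {g : ℂ → ℂ} (h : IsExp (d + 1 : ℕ) a g)
    (h' : IsExp (d + 1 : ℕ) b g) : a = b := by
  funext j
  by_cases hj : Adm (d + 1 : ℕ) j
  · have h1 := fourier_of_isExp h hj
    rw [fourier_of_isExp h' hj] at h1
    exact (mul_right_cancel₀ (by exact_mod_cast (discNorm_pos d j).ne') h1).symm
  · rw [h.eq_zero j hj, h'.eq_zero j hj]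

lemma eq_zero_of_fourier_eq_zero {g : ℂ → ℂ} (hg : ContinuousOn g (domD (d + 1 : ℕ)))
    (h : ∀ j, Adm (d + 1 : ℕ) j → fourier d g j = 0) {ξ : ℂ} (hξ : ξ ∈ domD (d + 1 : ℕ)) :
    g ξ = 0 := by
  by_contra hne
  have hpos := integral_normSq_pos hg hξ hne
  obtain ⟨M, hM⟩ := (isCompact_domD (d + 1 : ℕ)).exists_bound_of_continuousOn hg
  have hM0 : 0 < M := (norm_pos_iff.2 hne).trans_le (hM ξ hξ)
  set I := ∫ ξ, ‖g ξ‖ ^ 2 ∂coordLaw d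
  obtain ⟨J, b, hJ, hb⟩ := exists_approx d hg (ε := I / (2 * M)) (by positivity)
  let w : ℂ → ℂ := fun ξ => ∑ j ∈ J, b j * discR (d + 1 : ℕ) j.1 j.2 ξ
  have hw : Continuous w := continuous_finsetSum _ fun j _ =>
    continuous_const.mul (continuous_discR _ _ _)
  have hwc : Continuous fun ξ => conj (w ξ) := Complex.continuous_conj.comp hw
  have hgc : ContinuousOn (fun ξ => conj (g ξ)) (domD (d + 1 : ℕ)) :=
    Complex.continuous_conj.comp_continuousOn hg
  have h1 : ∫ ξ, g ξ * conj (w ξ) ∂coordLaw d = 0 := by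
    simp only [w, map_sum, map_mul, mul_sum, mul_left_comm (g _)]
    rw [integral_finsetSum _ fun j _ => (integrable_mul_conj_discR hg j).const_mul _]
    refine sum_eq_zero fun j hj => ?_
    rw [integral_const_mul]
    have := h j (hJ j hj)
    rw [fourier] at this
    rw [this, mul_zero]
  have h2 : ∫ ξ, g ξ * conj (g ξ - w ξ) ∂coordLaw d = I := by
    simp only [map_sub, mul_sub]
    have e1 : Integrable (fun ξ => g ξ * conj (g ξ)) (coordLaw d) :=
      integrable_coordLaw (hg.mul hgc)
    have e2 : Integrable (fun ξ => g ξ * conj (w ξ)) (coordLaw d) :=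
      integrable_coordLaw (hg.mul hwc.continuousOn)
    rw [integral_sub e1 e2, h1, sub_zero, ← integral_complex_ofReal]
    simp only [Complex.mul_conj']
    push_cast
    rfl
  have h3 := norm_integral_le_of_norm_le_const (μ := coordLaw d)
    (f := fun ξ => g ξ * conj (g ξ - w ξ)) (C := M * (I / (2 * M))) (by
      filter_upwards [ae_mem_domD d] with ξ hξ
      rw [norm_mul, RCLike.norm_conj]
      exact mul_le_mul (hM ξ hξ) (hb ξ hξ) (norm_nonneg _) hM0.le)
  rw [h2, probReal_univ, mul_one, Complex.norm_real, Real.norm_of_nonneg hpos.le] at h3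
  have h4 : M * (I / (2 * M)) = I / 2 := by field_simp
  linarith

/-- The peak functions used to evaluate at `1`. -/
lemma integral_peak_nonneg {g : ℂ → ℂ} (hg : ContinuousOn g (domD (d + 1 : ℕ)))
    (h : ∀ j, Adm (d + 1 : ℕ) j → 0 ≤ fourier d g j) (N : ℕ) :
    0 ≤ ∫ ξ, ((1 + ξ) * conj (1 + ξ)) ^ N * g ξ ∂coordLaw d := by
  let k : ℂ → ℂ := fun ξ => ((1 + ξ) * conj (1 + ξ)) ^ N
  have hk : Continuous k := by
    have : Continuous fun ξ : ℂ => conj (1 + ξ) := Complex.continuous_conj.comp (by fun_prop)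
    exact ((by fun_prop : Continuous fun ξ : ℂ => 1 + ξ).mul this).pow N
  have hkreal : ∀ ξ, conj (k ξ) = k ξ := fun ξ => by
    simp only [k, map_pow, map_mul, Complex.conj_conj]
    rw [mul_comm]
  have hkpd : PDK (Omega (d + 1 : ℕ)) fun z w => k (hdot z w) := by
    have h1 : PDK (Omega (d + 1 : ℕ)) fun z w => 1 + hdot z w :=
      (PDK.const zero_le_one).add (pdk_hdot _)
    exact (h1.mul h1.star).pow N
  have hmem : ((1 + coordC (d + 1 : ℕ)) * star (1 + coordC (d + 1 : ℕ))) ^ N ∈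
      StarAlgebra.adjoin ℂ {coordC (d + 1 : ℕ)} := by
    have h1 : 1 + coordC (d + 1 : ℕ) ∈ StarAlgebra.adjoin ℂ {coordC (d + 1 : ℕ)} :=
      add_mem (one_mem _) (StarAlgebra.self_mem_adjoin_singleton _ _)
    exact pow_mem (mul_mem h1 (star_mem h1)) N
  obtain ⟨J, b, hJ, hb⟩ := exists_sum_of_mem_discSpan (mem_discSpan_of_mem_adjoin d hmem)
  have hb' : ∀ ξ ∈ domD (d + 1 : ℕ), k ξ = ∑ j ∈ J, b j * discR (d + 1 : ℕ) j.1 j.2 ξ :=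
    fun ξ hξ => hb ⟨ξ, hξ⟩
  have hbj : ∀ j ∈ J, 0 ≤ b j := fun j hj => by
    have h1 := fourier_nonneg hk.continuousOn hkpd j
    have h2 : fourier d k j = b j * discNorm d j := by
      rw [fourier, integral_congr_domD (g := fun ξ => ∑ i ∈ J, b i *
        (discR (d + 1 : ℕ) i.1 i.2 ξ * conj (discR (d + 1 : ℕ) j.1 j.2 ξ)))
        fun ξ hξ => by rw [hb' ξ hξ, sum_mul]; simp only [mul_assoc]]
      rw [integral_finsetSum _ fun i _ =>
        (integrable_mul_conj_discR (continuous_discR _ _ _).continuousOn j).const_mul _,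
        sum_eq_single_of_mem j hj fun i hi hij => by
          rw [integral_const_mul, integral_discR_mul_conj d (hJ i hi) (hJ j hj) hij, mul_zero],
        integral_const_mul, integral_discR_mul_conj_self]
    rw [h2] at h1
    have h3 : (0 : ℂ) < discNorm d j := by exact_mod_cast discNorm_pos d j
    rw [← mul_div_cancel_right₀ (b j) h3.ne']
    exact div_nonneg h1 h3.le
  have h1 : ∫ ξ, k ξ * g ξ ∂coordLaw d = ∑ j ∈ J, b j * fourier d g j := by
    rw [integral_congr_domD (g := fun ξ => ∑ j ∈ J, b j *
        (g ξ * conj (discR (d + 1 : ℕ) j.1 j.2 ξ))) fun ξ hξ => by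
          rw [← hkreal, hb' ξ hξ, map_sum, sum_mul]
          refine sum_congr rfl fun j hj => ?_
          rw [map_mul, Complex.conj_eq_iff_im.2 (Complex.le_def.1 (hbj j hj)).2.symm]
          ring,
      integral_finsetSum _ fun i _ => (integrable_mul_conj_discR hg i).const_mul _]
    simp only [integral_const_mul, fourier]
  change 0 ≤ ∫ ξ, k ξ * g ξ ∂coordLaw d
  rw [h1]
  exact sum_nonneg fun j hj => mul_nonneg (hbj j hj) (h j (hJ j hj))

lemma nonneg_at_one_of_fourier_nonneg {g : ℂ → ℂ} (hg : ContinuousOn g (domD (d + 1 : ℕ)))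
    (h : ∀ j, Adm (d + 1 : ℕ) j → 0 ≤ fourier d g j) : 0 ≤ g 1 := by
  have hone := one_mem_domD (d + 1 : ℕ)
  have key := tendsto_setIntegral_pow_smul_of_unique_maximum_of_isCompact_of_measure_nhdsWithin_pos
    (μ := coordLaw d) (isCompact_domD (d + 1 : ℕ)) (x₀ := 1) (c := fun ξ => ‖1 + ξ‖ ^ 2) (g := g)
    (fun u hu h1 => by
      have h2 := coordLaw_pos (d := d) hu ⟨1, h1, hone⟩
      rwa [← restrict_coordLaw, Measure.restrict_apply hu.measurableSet] at h2)
    (by fun_prop) (fun y hy hne => by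
      have hy1 : ‖y‖ ≤ 1 := norm_le_one_of_mem_domD hy
      have h1 : ‖1 + y‖ ^ 2 + ‖1 - y‖ ^ 2 = 2 * (‖(1 : ℂ)‖ ^ 2 + ‖y‖ ^ 2) := by
        have := parallelogram_law_with_norm ℂ (1 : ℂ) y
        nlinarith
      have h2 : 0 < ‖1 - y‖ := norm_pos_iff.2 (sub_ne_zero.2 (Ne.symm hne))
      have h3 : ‖(1 : ℂ) + 1‖ = 2 := by norm_num
      simp only [h3]
      rw [norm_one] at h1
      nlinarith [norm_nonneg y])
    (fun _ _ => sq_nonneg _) (by norm_num) hone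
    (by rw [IntegrableOn, restrict_coordLaw]; exact integrable_coordLaw hg) (hg 1 hone)
  refine ge_of_tendsto' key fun N => ?_
  rw [restrict_coordLaw]
  refine smul_nonneg (inv_nonneg.2 (integral_nonneg fun _ => by positivity)) ?_
  have := integral_peak_nonneg hg h N
  simpa only [Complex.mul_conj', ← Complex.ofReal_pow, Complex.real_smul] using this

/-- Positive definite continuous functions on a finite dimensional sphere have an expansion
with nonnegative summable coefficients. -/
lemma exists_isExp_nat {g : ℂ → ℂ} (hg : ContinuousOn g (domD (d + 1 : ℕ)))
    (h : PDK (Omega (d + 1 : ℕ)) fun z w => g (hdot z w)) :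
    ∃ a : ℕ × ℕ → ℂ, (∀ i, 0 ≤ a i) ∧ IsExp (d + 1 : ℕ) a g := by
  classical
  have hq : (1 : ℕ∞) ≤ (d + 1 : ℕ) := by exact_mod_cast Nat.le_add_left 1 d
  have hpos : ∀ j, (0 : ℂ) < discNorm d j := fun j => by exact_mod_cast discNorm_pos d j
  let a : ℕ × ℕ → ℂ := fun i => if Adm (d + 1 : ℕ) i then fourier d g i / discNorm d i else 0
  have ha0 : ∀ i, ¬ Adm (d + 1 : ℕ) i → a i = 0 := fun i hi => if_neg hi
  have haf : ∀ i, Adm (d + 1 : ℕ) i → a i * discNorm d i = fourier d g i := fun i hi => by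
    simp only [a, if_pos hi]
    exact div_mul_cancel₀ _ (hpos i).ne'
  have ha : ∀ i, 0 ≤ a i := fun i => by
    simp only [a]
    split_ifs
    · exact div_nonneg (fourier_nonneg hg h i) (hpos i).le
    · exact le_rfl
  have hsum : ∀ F : Finset (ℕ × ℕ), ∑ i ∈ F, a i ≤ g 1 := fun F => by
    let s : ℂ → ℂ := fun ξ => ∑ i ∈ F, a i * discR (d + 1 : ℕ) i.1 i.2 ξ
    have hs : Continuous s := continuous_finsetSum _ fun j _ =>
      continuous_const.mul (continuous_discR _ _ _)
    have hsf : ∀ j, Adm (d + 1 : ℕ) j → fourier d s j = if j ∈ F then fourier d g j else 0 := by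
      intro j hj
      simp only [fourier, s, sum_mul, mul_assoc]
      rw [integral_finsetSum _ fun i _ =>
        (integrable_mul_conj_discR (continuous_discR _ _ _).continuousOn j).const_mul _]
      simp only [integral_const_mul]
      have : ∀ i ∈ F, a i * ∫ ξ, discR (d + 1 : ℕ) i.1 i.2 ξ *
          conj (discR (d + 1 : ℕ) j.1 j.2 ξ) ∂coordLaw d = if i = j then fourier d g j else 0 := by
        intro i _
        by_cases hi : Adm (d + 1 : ℕ) i
        · rw [integral_discR_mul_conj' d hi hj]
          split_ifs with hij
          · rw [hij, haf j hj]
          · simp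
        · rw [ha0 i hi, zero_mul, if_neg fun hij : i = j => hi (hij ▸ hj)]
      rw [sum_congr rfl this, sum_ite_eq']
      rfl
    have h1 := nonneg_at_one_of_fourier_nonneg (g := fun ξ => g ξ - s ξ)
      (hg.sub hs.continuousOn) fun j hj => by
        have : fourier d (fun ξ => g ξ - s ξ) j = fourier d g j - fourier d s j := by
          simp only [fourier, sub_mul]
          exact integral_sub (integrable_mul_conj_discR hg j)
            (integrable_mul_conj_discR hs.continuousOn j)
        rw [this, hsf j hj]
        split_ifs
        · simp
        · simpa using fourier_nonneg hg h j
    simpa [s, discR_one] using h1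
  have hre : ∀ i, ‖a i‖ = (a i).re := fun i => by
    rw [Complex.eq_re_of_ofReal_le (ha i), Complex.norm_real, Complex.ofReal_re,
      Real.norm_of_nonneg (Complex.le_def.1 (ha i)).1]
  have hsummable : Summable fun i => ‖a i‖ := by
    refine summable_of_sum_le (c := (g 1).re) (fun _ => norm_nonneg _) fun F => ?_
    simp only [hre, ← Complex.re_sum]
    exact (Complex.le_def.1 (hsum F)).1
  refine ⟨a, ha, (isExp_tsum hq ha0 hsummable).congr fun ξ hξ => ?_⟩
  have hG := isExp_tsum hq ha0 hsummable
  have := eq_zero_of_fourier_eq_zero (hg.sub (hG.continuousOn hq)) (fun j hj => by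
    have h1 : fourier d (fun ξ => g ξ - ∑' i, a i * discR (d + 1 : ℕ) i.1 i.2 ξ) j =
        fourier d g j - fourier d (fun ξ => ∑' i, a i * discR (d + 1 : ℕ) i.1 i.2 ξ) j := by
      simp only [fourier, sub_mul]
      exact integral_sub (integrable_mul_conj_discR hg j)
        (integrable_mul_conj_discR (hG.continuousOn hq) j)
    refine h1.trans ?_
    rw [fourier_of_isExp hG hj, haf j hj, sub_self]) hξ
  exact (sub_eq_zero.1 this).symm

end FiniteSlot

section Uniqueness

lemma discR_top (m n : ℕ) (ξ : ℂ) : discR ⊤ m n ξ = ξ ^ m * conj ξ ^ n := by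
  simp [discR]

lemma mem_domD_top {ξ : ℂ} : ξ ∈ domD ⊤ ↔ ‖ξ‖ ≤ 1 := by
  simp [domD]

lemma adm_top (i : ℕ × ℕ) : Adm ⊤ i := fun h => absurd h (by simp)

/-- A homogeneous polynomial in `u, conj u` that vanishes on the unit circle is zero. -/
lemma eq_zero_of_sum_antidiagonal {N : ℕ} {a : ℕ × ℕ → ℂ}
    (h : ∀ u : ℂ, conj u * u = 1 → ∑ i ∈ antidiagonal N, a i * (u ^ i.1 * conj u ^ i.2) = 0)
    {i : ℕ × ℕ} (hi : i ∈ antidiagonal N) : a i = 0 := by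
  let P : Polynomial ℂ := ∑ m ∈ range (N + 1), Polynomial.C (a (m, N - m)) * Polynomial.X ^ m
  have hP : P = 0 := by
    refine Polynomial.eq_zero_of_infinite_isRoot P ?_
    refine Set.Infinite.mono (s := Set.range fun t : Circle => ((t : ℂ)) ^ 2) ?_ ?_
    · rintro _ ⟨t, rfl⟩
      have ht : conj (t : ℂ) * t = 1 := by rw [Complex.conj_mul', Circle.norm_coe]; simp
      have h1 := h t ht
      rw [Nat.sum_antidiagonal_eq_sum_range_succ_mk] at h1
      have h2 : P.eval ((t : ℂ) ^ 2) = (t : ℂ) ^ N *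
          ∑ m ∈ range (N + 1), a (m, N - m) * ((t : ℂ) ^ m * conj (t : ℂ) ^ (N - m)) := by
        simp only [P, Polynomial.eval_finsetSum, Polynomial.eval_mul, Polynomial.eval_C,
          Polynomial.eval_pow, Polynomial.eval_X, mul_sum]
        refine sum_congr rfl fun m hm => ?_
        have hm' : m ≤ N := Nat.lt_succ_iff.1 (mem_range.1 hm)
        have h3 : (t : ℂ) ^ N * conj (t : ℂ) ^ (N - m) = (t : ℂ) ^ m := by
          conv_lhs => rw [← Nat.sub_add_cancel hm', pow_add]
          rw [Nat.sub_add_cancel hm', mul_right_comm, ← mul_pow, mul_comm (t : ℂ), ht, one_pow,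
            one_mul]
        linear_combination -(a (m, N - m) * (t : ℂ) ^ m) * h3
      change P.eval _ = 0
      rw [h2, h1, mul_zero]
    · intro hfin
      have hpre : (Set.range fun t : Circle => (t : ℂ)).Finite := by
        refine Set.Finite.of_finite_fibers (f := fun z : ℂ => z ^ 2) ?_ ?_
        · refine hfin.subset ?_
          rintro _ ⟨_, ⟨t, rfl⟩, rfl⟩
          exact ⟨t, rfl⟩
        · intro x _
          refine ((Polynomial.X ^ 2 - Polynomial.C x).finite_setOfPred_isRoot
            (Polynomial.X_pow_sub_C_ne_zero two_pos x)).subset ?_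
          rintro z ⟨_, hz⟩
          simpa [Polynomial.IsRoot, sub_eq_zero] using hz
      have : Infinite (Set.Ioc (-Real.pi) Real.pi) :=
        (Set.Ioc_infinite (by linarith [Real.pi_pos])).to_subtype
      have : Infinite Circle := Circle.argEquiv.infinite_iff.2 this
      refine Set.infinite_range_of_injective (f := fun t : Circle => (t : ℂ))
        Subtype.coe_injective hpre
  have hi' := mem_antidiagonal.1 hi
  have := congr_arg (fun p => Polynomial.coeff p i.1) hP
  simp only [P, Polynomial.finsetSum_coeff, Polynomial.coeff_C_mul, Polynomial.coeff_X_pow,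
    Polynomial.coeff_zero] at this
  simp only [mul_ite, mul_one, mul_zero, sum_ite_eq, mem_range] at this
  rw [if_pos (by omega), show N - i.1 = i.2 by omega] at this
  exact this

lemma isExp_top_eq_zero {a : ℕ × ℕ → ℂ} (h : IsExp ⊤ a fun _ => 0) : a = 0 := by
  suffices H : ∀ N : ℕ, ∀ i ∈ antidiagonal N, a i = 0 from
    funext fun i => H (i.1 + i.2) i (mem_antidiagonal.2 rfl)
  intro N
  induction N using Nat.strong_induction_on with
  | _ N ih =>
    intro i hi
    refine eq_zero_of_sum_antidiagonal (fun u hu => ?_) hi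
    have hun : ‖u‖ = 1 := by
      have h1 : ((‖u‖ ^ 2 : ℝ) : ℂ) = 1 := by rw [← hu, Complex.conj_mul']; push_cast; rfl
      have h2 : ‖u‖ ^ 2 = 1 := by exact_mod_cast h1
      exact (pow_eq_one_iff_of_nonneg (norm_nonneg u) two_ne_zero).1 h2
    let F : ℝ → ℕ × ℕ → ℂ := fun r i => a i * ((r : ℂ) ^ (i.1 + i.2 - N) * (u ^ i.1 * conj u ^ i.2))
    let G : ℕ × ℕ → ℂ := fun i => if i ∈ antidiagonal N then a i * (u ^ i.1 * conj u ^ i.2) else 0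
    have hlt : ∀ i : ℕ × ℕ, i.1 + i.2 < N → a i = 0 := fun i hi =>
      ih _ hi i (mem_antidiagonal.2 rfl)
    have hFG : Filter.Tendsto (fun r => ∑' i, F r i) (nhdsWithin 0 (Set.Ioo 0 1))
        (nhds (∑' i, G i)) := by
      refine tendsto_tsum_of_dominated_convergence h.summable (fun i => ?_) ?_
      · rcases lt_trichotomy (i.1 + i.2) N with hi | hi | hi
        · simp [F, G, hlt i hi]
        · have : i ∈ antidiagonal N := mem_antidiagonal.2 hi
          simp only [F, G, hi, this, if_true, Nat.sub_self, pow_zero, one_mul]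
          exact tendsto_const_nhds
        · have h1 : i ∉ antidiagonal N := fun h => hi.ne' (mem_antidiagonal.1 h)
          have hc : Continuous fun r : ℝ => F r i := by simp only [F]; fun_prop
          have h2 := hc.tendsto 0
          simp only [F, Complex.ofReal_zero, zero_pow (by omega : i.1 + i.2 - N ≠ 0), zero_mul,
            mul_zero] at h2
          simp only [G, if_neg h1]
          exact h2.mono_left nhdsWithin_le_nhds
      · filter_upwards [self_mem_nhdsWithin] with r hr i
        simp only [F, norm_mul, norm_pow, RCLike.norm_conj, hun, one_pow, mul_one,
          Complex.norm_real, Real.norm_of_nonneg hr.1.le]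
        exact mul_le_of_le_one_right (norm_nonneg _) (pow_le_one₀ hr.1.le hr.2.le)
    have hF0 : ∀ r ∈ Set.Ioo (0 : ℝ) 1, ∑' i, F r i = 0 := fun r hr => by
      have hr0 : ((r : ℂ)) ^ N ≠ 0 := pow_ne_zero _ (by exact_mod_cast hr.1.ne')
      have hmem : (r : ℂ) * u ∈ domD ⊤ := by
        rw [mem_domD_top, norm_mul, hun, mul_one, Complex.norm_real, Real.norm_of_nonneg hr.1.le]
        exact hr.2.le
      have h1 := ((h.hasSum _ hmem).mul_left ((r : ℂ) ^ N)⁻¹).tsum_eq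
      rw [mul_zero] at h1
      rw [← h1]
      refine tsum_congr fun i => ?_
      rcases lt_or_ge (i.1 + i.2) N with hi | hi
      · simp [F, hlt i hi]
      · simp only [F, discR_top, map_mul, Complex.conj_ofReal, mul_pow]
        have : (r : ℂ) ^ (i.1 + i.2 - N) = ((r : ℂ) ^ N)⁻¹ * ((r : ℂ) ^ i.1 * (r : ℂ) ^ i.2) := by
          rw [eq_inv_mul_iff_mul_eq₀ hr0, ← pow_add, ← pow_add]
          congr 1
          omega
        rw [this]
        ring
    have hne : (nhdsWithin (0 : ℝ) (Set.Ioo 0 1)).NeBot := by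
      rw [← mem_closure_iff_nhdsWithin_neBot, closure_Ioo zero_ne_one]
      simp
    have hz : ∑' i, G i = 0 := by
      refine tendsto_nhds_unique hFG (tendsto_const_nhds.congr' ?_)
      filter_upwards [self_mem_nhdsWithin] with r hr using (hF0 r hr).symm
    rw [tsum_eq_sum (s := antidiagonal N) fun i hi => if_neg hi] at hz
    rw [← hz]
    exact sum_congr rfl fun i hi => (if_pos hi).symm

lemma isExp_unique {q : ℕ∞} (hq : 1 ≤ q) {a b : ℕ × ℕ → ℂ} {g : ℂ → ℂ} (h : IsExp q a g)
    (h' : IsExp q b g) : a = b := by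
  induction q using ENat.recTopCoe with
  | top =>
    have h1 := isExp_top_eq_zero ((h.add (h'.const_mul (-1))).congr (f := fun _ => 0)
      fun ξ _ => by simp)
    funext i
    have := congr_fun h1 i
    simp only [Pi.add_apply, Pi.zero_apply] at this
    linear_combination this
  | coe n =>
    obtain ⟨d, rfl⟩ : ∃ d, n = d + 1 := ⟨n - 1, by
      have : 1 ≤ n := by exact_mod_cast hq
      omega⟩
    exact isExp_unique_nat h h'

end Uniqueness

section PoissonWeight

variable {L : ℕ}

/-- The bidegree attached to the frequency `k` modulo `2 * L + 1`. -/
def freqDeg (L : ℕ) (k : ZMod (2 * L + 1)) : ℕ × ℕ :=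
  if k.val ≤ L then (k.val, 0) else (0, 2 * L + 1 - k.val)

lemma conj_stdAddChar (u : ZMod (2 * L + 1)) :
    conj (ZMod.stdAddChar u) = ZMod.stdAddChar (-u) :=
  (AddChar.map_neg_eq_conj _ _).symm

lemma norm_stdAddChar (u : ZMod (2 * L + 1)) : ‖ZMod.stdAddChar u‖ = 1 :=
  AddChar.norm_apply _ _

lemma freqDeg_zero : freqDeg L 0 = 0 := by
  simp [freqDeg]

lemma freqDeg_one (hL : 1 ≤ L) : freqDeg L 1 = (1, 0) := by
  have : Fact (1 < 2 * L + 1) := ⟨by omega⟩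
  simp [freqDeg, ZMod.val_one, hL]

/-- A truncated Poisson kernel on the `(2 * L + 1)`-th roots of unity. -/
def poissonWeight (L : ℕ) (ξ : ℂ) (u : ZMod (2 * L + 1)) : ℂ :=
  ((2 * L + 1 : ℕ) : ℂ)⁻¹ *
    ∑ k, discR ⊤ (freqDeg L k).1 (freqDeg L k).2 ξ * ZMod.stdAddChar (-(k * u))

lemma sum_poissonWeight_mul (ξ : ℂ) (k : ZMod (2 * L + 1)) :
    ∑ u, poissonWeight L ξ u * ZMod.stdAddChar (k * u)
      = discR ⊤ (freqDeg L k).1 (freqDeg L k).2 ξ := by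
  have h1 : ∀ u, poissonWeight L ξ u * ZMod.stdAddChar (k * u) = ((2 * L + 1 : ℕ) : ℂ)⁻¹ *
      ∑ j, discR ⊤ (freqDeg L j).1 (freqDeg L j).2 ξ * ZMod.stdAddChar (u * (k - j)) := by
    intro u
    rw [poissonWeight, mul_assoc, sum_mul]
    congr 1
    refine sum_congr rfl fun j _ => ?_
    rw [mul_assoc, ← AddChar.map_add_eq_mul]
    congr 2
    ring
  simp only [h1]
  rw [← mul_sum, sum_comm]
  simp only [← mul_sum, AddChar.sum_mulShift _ (ZMod.isPrimitive_stdAddChar _), sub_eq_zero,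
    ZMod.card]
  have h0 : ((2 * L + 1 : ℕ) : ℂ) ≠ 0 := by exact_mod_cast (by omega : 2 * L + 1 ≠ 0)
  simp only [Nat.cast_ite, Nat.cast_zero, mul_ite, mul_zero, sum_ite_eq, mem_univ, if_true]
  rw [mul_comm, mul_assoc, mul_inv_cancel₀ h0, mul_one]

lemma sum_poissonWeight (ξ : ℂ) : ∑ u, poissonWeight L ξ u = 1 := by
  simpa [freqDeg_zero, discR_top] using sum_poissonWeight_mul (L := L) ξ 0

lemma sum_poissonWeight_mul_sub (hL : 1 ≤ L) (ξ : ℂ) :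
    ∑ u, poissonWeight L ξ u * (ZMod.stdAddChar u - ξ) = 0 := by
  have := sum_poissonWeight_mul (L := L) ξ 1
  simp only [one_mul, freqDeg_one hL, discR_top, pow_one, pow_zero, mul_one] at this
  simp only [mul_sub, sum_sub_distrib, this, ← sum_mul, sum_poissonWeight, one_mul, sub_self]

lemma poissonWeight_one (u : ZMod (2 * L + 1)) :
    poissonWeight L 1 u = if u = 0 then 1 else 0 := by
  have h0 : ((2 * L + 1 : ℕ) : ℂ) ≠ 0 := by exact_mod_cast (by omega : 2 * L + 1 ≠ 0)
  simp only [poissonWeight, discR_top, one_pow, map_one, mul_one, one_mul, ← mul_neg,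
    AddChar.sum_mulShift _ (ZMod.isPrimitive_stdAddChar _), neg_eq_zero, ZMod.card]
  split_ifs
  · exact inv_mul_cancel₀ h0
  · simp

lemma sum_poissonWeight_eq (ξ : ℂ) (u : ZMod (2 * L + 1)) :
    ((2 * L + 1 : ℕ) : ℂ) * poissonWeight L ξ u =
      ∑ k ∈ range (L + 1), (ξ * conj (ZMod.stdAddChar u)) ^ k
        + ∑ k ∈ range L, conj (ξ * conj (ZMod.stdAddChar u)) ^ (k + 1) := by
  have h0 : ((2 * L + 1 : ℕ) : ℂ) ≠ 0 := by exact_mod_cast (by omega : 2 * L + 1 ≠ 0)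
  rw [poissonWeight, mul_inv_cancel_left₀ h0]
  let φ : ℕ → ℂ := fun k => if k ≤ L then (ξ * conj (ZMod.stdAddChar u)) ^ k
    else conj (ξ * conj (ZMod.stdAddChar u)) ^ (2 * L + 1 - k)
  have hφ : ∀ k : ZMod (2 * L + 1),
      discR ⊤ (freqDeg L k).1 (freqDeg L k).2 ξ * ZMod.stdAddChar (-(k * u)) = φ k.val := by
    intro k
    have hk : ∀ n : ℕ, ZMod.stdAddChar (-((n : ZMod (2 * L + 1)) * u))
        = conj (ZMod.stdAddChar u) ^ n := by
      intro n
      rw [conj_stdAddChar, ← AddChar.map_nsmul_eq_pow, nsmul_eq_mul, mul_neg]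
    simp only [φ, freqDeg, discR_top]
    split_ifs with h
    · rw [pow_zero, mul_one, mul_pow, ← hk, ZMod.natCast_val, ZMod.cast_id]
    · have hlt := ZMod.val_lt k
      have h2 : k = -((2 * L + 1 - k.val : ℕ) : ZMod (2 * L + 1)) := by
        rw [Nat.cast_sub hlt.le, ZMod.natCast_self, ZMod.natCast_val, ZMod.cast_id]
        ring
      rw [pow_zero, one_mul, map_mul, mul_pow, Complex.conj_conj]
      congr 1
      conv_lhs => rw [h2]
      rw [neg_mul, neg_neg, ← nsmul_eq_mul, AddChar.map_nsmul_eq_pow]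
  simp only [hφ]
  rw [show ∑ k : ZMod (2 * L + 1), φ k.val = ∑ k ∈ range (2 * L + 1), φ k from
    Fin.sum_univ_eq_sum_range φ (2 * L + 1), show range (2 * L + 1) = range ((L + 1) + L) by congr 1; ring,
    sum_range_add]
  congr 1
  · refine sum_congr rfl fun k hk => ?_
    simp only [φ]
    rw [if_pos (by have := mem_range.1 hk; omega)]
  · rw [← sum_range_reflect]
    refine sum_congr rfl fun k hk => ?_
    have hk' := mem_range.1 hk
    simp only [φ]
    rw [if_neg (by omega)]
    congr 1
    omega

lemma poissonWeight_nonneg {ξ : ℂ} (hξ : ‖ξ‖ < 1) (hL : 4 * ‖ξ‖ ^ (L + 1) ≤ 1 - ‖ξ‖ ^ 2)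
    (u : ZMod (2 * L + 1)) : 0 ≤ poissonWeight L ξ u := by
  set z : ℂ := ξ * conj (ZMod.stdAddChar u) with hz
  have hzn : ‖z‖ = ‖ξ‖ := by rw [hz, norm_mul, RCLike.norm_conj, norm_stdAddChar, mul_one]
  have h1 : 1 - z ≠ 0 := by
    intro h
    rw [sub_eq_zero] at h
    rw [← h, norm_one] at hzn
    linarith
  have h1' : 1 - conj z ≠ 0 := by
    intro h
    apply h1
    rw [← Complex.conj_conj (1 - z), map_sub, map_one, h, map_zero]
  have hA : ∑ k ∈ range (L + 1), z ^ k = (1 - z ^ (L + 1)) / (1 - z) := by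
    rw [eq_div_iff h1, mul_comm, mul_neg_geom_sum]
  have hB : ∑ k ∈ range L, conj z ^ (k + 1) = (conj z - conj z ^ (L + 1)) / (1 - conj z) := by
    rw [eq_div_iff h1']
    simp only [pow_succ, ← sum_mul]
    rw [mul_right_comm, mul_comm _ (1 - conj z), mul_neg_geom_sum]
    ring
  have hS : ((2 * L + 1 : ℕ) : ℂ) * poissonWeight L ξ u * (Complex.normSq (1 - z) : ℝ)
      = ((1 - ‖z‖ ^ 2 - 2 * (z ^ (L + 1) * (1 - conj z)).re : ℝ) : ℂ) := by
    rw [sum_poissonWeight_eq, ← hz, hA, hB, Complex.normSq_eq_conj_mul_self]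
    have h3 : (((2 * (z ^ (L + 1) * (1 - conj z)).re : ℝ)) : ℂ)
        = z ^ (L + 1) * (1 - conj z) + conj z ^ (L + 1) * (1 - z) := by
      rw [← Complex.add_conj]
      simp
    have h4 : ((‖z‖ ^ 2 : ℝ) : ℂ) = conj z * z := by
      rw [Complex.conj_mul']; push_cast; rfl
    rw [Complex.ofReal_sub, Complex.ofReal_sub, h3, h4]
    simp only [map_sub, map_one, Complex.ofReal_one]
    field_simp
    ring
  have hre : |(z ^ (L + 1) * (1 - conj z)).re| ≤ ‖ξ‖ ^ (L + 1) * 2 := by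
    refine (Complex.abs_re_le_norm _).trans ?_
    rw [norm_mul, norm_pow, hzn]
    gcongr
    refine (norm_sub_le _ _).trans ?_
    rw [RCLike.norm_conj, hzn, norm_one]
    linarith
  have h5 : 0 ≤ 1 - ‖z‖ ^ 2 - 2 * (z ^ (L + 1) * (1 - conj z)).re := by
    rw [hzn]
    have := (abs_le.1 hre).2
    linarith
  have hpos : 0 < (2 * L + 1 : ℕ) * Complex.normSq (1 - z) :=
    mul_pos (by positivity) (Complex.normSq_pos.2 h1)
  have h6 : poissonWeight L ξ u = (((1 - ‖z‖ ^ 2 - 2 * (z ^ (L + 1) * (1 - conj z)).re) /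
      ((2 * L + 1 : ℕ) * Complex.normSq (1 - z)) : ℝ) : ℂ) := by
    rw [Complex.ofReal_div, ← hS, eq_div_iff (by exact_mod_cast hpos.ne')]
    push_cast
    ring
  rw [h6]
  exact_mod_cast div_nonneg h5 hpos.le

end PoissonWeight

section Bernstein

variable {L N : ℕ}

/-- The product of truncated Poisson kernels. -/
def prodWeight (L N : ℕ) (ξ : ℂ) (u : Fin N → ZMod (2 * L + 1)) : ℂ :=
  ∏ i, poissonWeight L ξ (u i)

/-- The mean of the roots of unity selected by `u`. -/
def rootMean (L N : ℕ) (u : Fin N → ZMod (2 * L + 1)) : ℂ :=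
  (N : ℂ)⁻¹ * ∑ i, ZMod.stdAddChar (u i)

/-- The Fourier coefficients of `g ∘ rootMean`. -/
def meanCoeff (L N : ℕ) (g : ℂ → ℂ) (α : Fin N → ZMod (2 * L + 1)) : ℂ :=
  ∑ u, g (rootMean L N u) * ∏ i, (((2 * L + 1 : ℕ) : ℂ)⁻¹ * ZMod.stdAddChar (-(α i * u i)))

/-- The Bernstein-type operator attached to the Poisson weights. -/
def bernstein (L N : ℕ) (g : ℂ → ℂ) (ξ : ℂ) : ℂ :=
  ∑ u, g (rootMean L N u) * prodWeight L N ξ u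

lemma norm_rootMean_le (u : Fin N → ZMod (2 * L + 1)) : ‖rootMean L N u‖ ≤ 1 := by
  rw [rootMean, norm_mul, norm_inv, Complex.norm_natCast]
  have h : ‖∑ i, ZMod.stdAddChar (u i)‖ ≤ N := by
    refine (norm_sum_le _ _).trans ?_
    simp
  rcases Nat.eq_zero_or_pos N with rfl | hN
  · simp
  · rw [inv_mul_le_iff₀ (by exact_mod_cast hN)]
    simpa using h

lemma sum_prod_poissonWeight (ξ : ℂ) (H : Fin N → ZMod (2 * L + 1) → ℂ) :
    ∑ u : Fin N → ZMod (2 * L + 1), prodWeight L N ξ u * ∏ i, H i (u i)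
      = ∏ i, ∑ v, poissonWeight L ξ v * H i v := by
  rw [prod_univ_sum, Fintype.piFinset_univ]
  simp only [prodWeight, prod_mul_distrib]

lemma sum_prodWeight (ξ : ℂ) : ∑ u, prodWeight L N ξ u = 1 := by
  simpa [sum_poissonWeight] using sum_prod_poissonWeight (L := L) (N := N) ξ fun _ _ => 1

lemma norm_prodWeight {ξ : ℂ} (hξ : ‖ξ‖ < 1) (h0 : 4 * ‖ξ‖ ^ (L + 1) ≤ 1 - ‖ξ‖ ^ 2)
    (u : Fin N → ZMod (2 * L + 1)) : (‖prodWeight L N ξ u‖ : ℂ) = prodWeight L N ξ u :=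
  have : 0 ≤ prodWeight L N ξ u := prod_nonneg fun _ _ => poissonWeight_nonneg hξ h0 _
  RCLike.norm_of_nonneg' this

lemma sum_norm_prodWeight {ξ : ℂ} (hξ : ‖ξ‖ < 1) (h0 : 4 * ‖ξ‖ ^ (L + 1) ≤ 1 - ‖ξ‖ ^ 2) :
    ∑ u, ‖prodWeight L N ξ u‖ = 1 :=
  Complex.ofReal_injective (by
    rw [Complex.ofReal_sum, sum_congr rfl fun u _ => norm_prodWeight hξ h0 u, sum_prodWeight,
      Complex.ofReal_one])

lemma prod_discR_top {ι : Type*} (s : Finset ι) (d : ι → ℕ × ℕ) (ξ : ℂ) :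
    ∏ i ∈ s, discR ⊤ (d i).1 (d i).2 ξ = discR ⊤ (∑ i ∈ s, d i).1 (∑ i ∈ s, d i).2 ξ := by
  simp only [discR_top, prod_mul_distrib, prod_pow_eq_pow_sum, Prod.fst_sum, Prod.snd_sum]

lemma bernstein_eq_sum (g : ℂ → ℂ) (ξ : ℂ) :
    bernstein L N g ξ = ∑ α, meanCoeff L N g α *
      discR ⊤ (∑ i, freqDeg L (α i)).1 (∑ i, freqDeg L (α i)).2 ξ := by
  have h : ∀ u, prodWeight L N ξ u = ∑ α : Fin N → ZMod (2 * L + 1),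
      (∏ i, (((2 * L + 1 : ℕ) : ℂ)⁻¹ * ZMod.stdAddChar (-(α i * u i)))) *
        discR ⊤ (∑ i, freqDeg L (α i)).1 (∑ i, freqDeg L (α i)).2 ξ := by
    intro u
    simp only [prodWeight, poissonWeight, mul_sum]
    rw [prod_univ_sum, Fintype.piFinset_univ]
    refine sum_congr rfl fun α _ => ?_
    rw [← prod_discR_top, ← prod_mul_distrib]
    refine prod_congr rfl fun i _ => ?_
    ring
  simp only [bernstein, meanCoeff, h, mul_sum, sum_mul]
  rw [sum_comm]
  refine sum_congr rfl fun α _ => sum_congr rfl fun u _ => ?_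
  ring

lemma bernstein_one (hN : N ≠ 0) (g : ℂ → ℂ) : bernstein L N g 1 = g 1 := by
  have h : ∀ u : Fin N → ZMod (2 * L + 1), prodWeight L N 1 u = if u = 0 then 1 else 0 := by
    intro u
    simp only [prodWeight, poissonWeight_one]
    rw [prod_ite_zero, prod_const_one]
    simp [funext_iff]
  have hN' : (N : ℂ) ≠ 0 := by exact_mod_cast hN
  simp [bernstein, h, rootMean, hN']

/-- Points of the sphere realising `rootMean` as an inner product. -/
def torusPoint (L N : ℕ) (u : Fin N → ZMod (2 * L + 1)) : Ell2 :=
  toEll (WithLp.toLp 2 fun i => ((√N)⁻¹ : ℝ) * ZMod.stdAddChar (u i))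

lemma hdot_torusPoint (u v : Fin N → ZMod (2 * L + 1)) :
    hdot (torusPoint L N u) (torusPoint L N v) = rootMean L N (u - v) := by
  rw [torusPoint, torusPoint, hdot_toEll, PiLp.inner_apply, rootMean, mul_sum]
  refine sum_congr rfl fun i _ => ?_
  have h : (((√N)⁻¹ : ℝ) : ℂ) * (((√N)⁻¹ : ℝ) : ℂ) = (N : ℂ)⁻¹ := by
    rw [← Complex.ofReal_mul, ← mul_inv, Real.mul_self_sqrt (by positivity)]
    simp
  simp only [RCLike.inner_apply, map_mul, Complex.conj_ofReal, conj_stdAddChar, Pi.sub_apply]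
  rw [sub_eq_add_neg, AddChar.map_add_eq_mul, ← h]
  ring

lemma torusPoint_mem (hN : N ≠ 0) (u : Fin N → ZMod (2 * L + 1)) :
    torusPoint L N u ∈ Omega ⊤ := by
  refine toEll_mem_Omega le_top ?_
  have h := hdot_torusPoint u u
  have hN' : (N : ℂ) ≠ 0 := by exact_mod_cast hN
  rw [torusPoint, hdot_toEll, inner_self_eq_norm_sq_to_K] at h
  simp only [rootMean, sub_self, Pi.zero_apply, AddChar.map_zero_eq_one, sum_const, card_univ,
    Fintype.card_fin, nsmul_eq_mul, mul_one, inv_mul_cancel₀ hN'] at h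
  have h2 : ‖(WithLp.toLp 2 fun i => ((√N)⁻¹ : ℝ) * ZMod.stdAddChar (u i) :
      EuclideanSpace ℂ (Fin N))‖ ^ 2 = 1 :=
    Complex.ofReal_injective (by rw [Complex.ofReal_pow]; exact h)
  exact (pow_eq_one_iff_of_nonneg (norm_nonneg _) two_ne_zero).1 h2

lemma meanCoeff_nonneg (hN : N ≠ 0) {g : ℂ → ℂ} (h : PDK (Omega ⊤) fun z w => g (hdot z w))
    (α : Fin N → ZMod (2 * L + 1)) : 0 ≤ meanCoeff L N g α := by
  have h1 := h (Fin N → ZMod (2 * L + 1)) (torusPoint L N) (torusPoint_mem hN)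
    fun u => ∏ i, ZMod.stdAddChar (-(α i * u i))
  have h2 : ∀ u v : Fin N → ZMod (2 * L + 1),
      (∏ i, ZMod.stdAddChar (-(α i * u i))) * conj (∏ i, ZMod.stdAddChar (-(α i * v i)))
        = ∏ i, ZMod.stdAddChar (-(α i * (u - v) i)) := by
    intro u v
    rw [map_prod, ← prod_mul_distrib]
    refine prod_congr rfl fun i _ => ?_
    rw [conj_stdAddChar, ← AddChar.map_add_eq_mul, Pi.sub_apply]
    congr 1
    ring
  simp only [hdot_torusPoint, h2] at h1
  rw [sum_comm] at h1
  have h3 : ∀ v : Fin N → ZMod (2 * L + 1),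
      ∑ u, (∏ i, ZMod.stdAddChar (-(α i * (u - v) i))) * g (rootMean L N (u - v))
        = ∑ u, (∏ i, ZMod.stdAddChar (-(α i * u i))) * g (rootMean L N u) := fun v =>
    Equiv.sum_comp (Equiv.subRight v)
      fun u => (∏ i, ZMod.stdAddChar (-(α i * u i))) * g (rootMean L N u)
  simp only [h3, sum_const, card_univ, nsmul_eq_mul] at h1
  have hc : (0 : ℝ) < Fintype.card (Fin N → ZMod (2 * L + 1)) := by
    exact_mod_cast Fintype.card_pos
  have h4 : meanCoeff L N g α = ((((2 * L + 1 : ℕ) : ℝ)⁻¹ ^ N *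
      (Fintype.card (Fin N → ZMod (2 * L + 1)) : ℝ)⁻¹ : ℝ) : ℂ) *
      ((Fintype.card (Fin N → ZMod (2 * L + 1)) : ℂ) *
        ∑ u, (∏ i, ZMod.stdAddChar (-(α i * u i))) * g (rootMean L N u)) := by
    have hc' : (Fintype.card (Fin N → ZMod (2 * L + 1)) : ℂ) ≠ 0 := by exact_mod_cast hc.ne'
    rw [Complex.ofReal_mul, Complex.ofReal_inv, Complex.ofReal_natCast, mul_assoc,
      inv_mul_cancel_left₀ hc', meanCoeff, mul_sum]
    refine sum_congr rfl fun u _ => ?_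
    rw [prod_mul_distrib, prod_const, card_univ, Fintype.card_fin]
    push_cast
    ring
  rw [h4]
  exact mul_nonneg (by exact_mod_cast (by positivity)) h1

lemma sum_prodWeight_mul_cross (hL : 1 ≤ L) (ξ : ℂ) {i j : Fin N} (hij : i ≠ j) :
    ∑ u, prodWeight L N ξ u *
      ((ZMod.stdAddChar (u i) - ξ) * conj (ZMod.stdAddChar (u j) - ξ)) = 0 := by
  have h := sum_prod_poissonWeight (L := L) (N := N) ξ fun k v =>
    (if k = i then ZMod.stdAddChar v - ξ else 1) *
      (if k = j then conj (ZMod.stdAddChar v - ξ) else 1)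
  simp only [prod_mul_distrib, prod_ite_eq', mem_univ, if_true] at h
  rw [h]
  refine prod_eq_zero (mem_univ i) ?_
  simpa [hij] using sum_poissonWeight_mul_sub hL ξ

lemma sum_prodWeight_mul_norm_sq (hL : 1 ≤ L) (hN : N ≠ 0) {ξ : ℂ} (hξ : ‖ξ‖ < 1)
    (h0 : 4 * ‖ξ‖ ^ (L + 1) ≤ 1 - ‖ξ‖ ^ 2) :
    ∑ u, ‖prodWeight L N ξ u‖ * ‖rootMean L N u - ξ‖ ^ 2 ≤ 4 / N := by
  have hN' : (N : ℂ) ≠ 0 := by exact_mod_cast hN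
  have hpos : ∀ u, (‖prodWeight L N ξ u‖ : ℂ) = prodWeight L N ξ u := norm_prodWeight hξ h0
  have hone : ∑ u, ‖prodWeight L N ξ u‖ = 1 := sum_norm_prodWeight hξ h0
  have h1 : ∀ u, ((‖rootMean L N u - ξ‖ ^ 2 : ℝ) : ℂ) = ((N : ℂ) ^ 2)⁻¹ * ∑ i, ∑ j,
      (ZMod.stdAddChar (u i) - ξ) * conj (ZMod.stdAddChar (u j) - ξ) := by
    intro u
    have h2 : rootMean L N u - ξ = (N : ℂ)⁻¹ * ∑ i, (ZMod.stdAddChar (u i) - ξ) := by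
      rw [rootMean, sum_sub_distrib, sum_const, card_univ, Fintype.card_fin, nsmul_eq_mul]
      field_simp
    rw [Complex.ofReal_pow, ← Complex.mul_conj', h2, ← sum_mul_sum, ← map_sum, map_mul, map_inv₀,
      Complex.conj_natCast]
    field_simp
  have h3 : ((∑ u, ‖prodWeight L N ξ u‖ * ‖rootMean L N u - ξ‖ ^ 2 : ℝ) : ℂ)
      = ((((N : ℝ) ^ 2)⁻¹ * ∑ i : Fin N, ∑ u, ‖prodWeight L N ξ u‖ *
        ‖ZMod.stdAddChar (u i) - ξ‖ ^ 2 : ℝ) : ℂ) := by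
    simp only [Complex.ofReal_sum, Complex.ofReal_mul, hpos, h1]
    simp only [mul_left_comm _ (((N : ℂ) ^ 2)⁻¹)]
    rw [← mul_sum]
    simp only [mul_sum (s := (univ : Finset (Fin N)))]
    rw [sum_comm]
    push_cast
    rw [mul_sum]
    refine sum_congr rfl fun i _ => ?_
    congr 1
    rw [sum_comm, sum_eq_single i]
    · refine sum_congr rfl fun u _ => ?_
      rw [Complex.mul_conj']
    · intro j _ hj
      exact sum_prodWeight_mul_cross hL ξ hj.symm
    · simp
  have h4 := Complex.ofReal_injective h3
  rw [h4]
  have h5 : ∀ i : Fin N, ∑ u, ‖prodWeight L N ξ u‖ * ‖ZMod.stdAddChar (u i) - ξ‖ ^ 2 ≤ 4 := by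
    intro i
    calc _ ≤ ∑ u, ‖prodWeight L N ξ u‖ * 4 := by
          refine sum_le_sum fun u _ => mul_le_mul_of_nonneg_left ?_ (norm_nonneg _)
          have : ‖ZMod.stdAddChar (u i) - ξ‖ ≤ 2 := by
            refine (norm_sub_le _ _).trans ?_
            rw [norm_stdAddChar]
            linarith
          nlinarith [norm_nonneg (ZMod.stdAddChar (u i) - ξ)]
      _ = 4 := by rw [← sum_mul, hone, one_mul]
  have hNr : (0 : ℝ) < N := by exact_mod_cast Nat.pos_of_ne_zero hN
  calc _ ≤ ((N : ℝ) ^ 2)⁻¹ * ∑ _i : Fin N, (4 : ℝ) := by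
        gcongr with i
        exact h5 i
    _ = 4 / N := by
        rw [sum_const, card_univ, Fintype.card_fin, nsmul_eq_mul]
        field_simp

lemma norm_bernstein_sub_le (hL : 1 ≤ L) (hN : N ≠ 0) {ξ : ℂ} (hξ : ‖ξ‖ < 1)
    (h0 : 4 * ‖ξ‖ ^ (L + 1) ≤ 1 - ‖ξ‖ ^ 2) {g : ℂ → ℂ} {C ε δ : ℝ} (hδ : 0 < δ)
    (hε : 0 ≤ ε) (hC : ∀ y, ‖y‖ ≤ 1 → ‖g y‖ ≤ C)
    (hg : ∀ y, ‖y‖ ≤ 1 → ‖y - ξ‖ < δ → ‖g y - g ξ‖ ≤ ε) :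
    ‖bernstein L N g ξ - g ξ‖ ≤ ε + 2 * C / δ ^ 2 * (4 / N) := by
  have hC0 : 0 ≤ C := (norm_nonneg _).trans (hC ξ hξ.le)
  have hone : ∑ u, ‖prodWeight L N ξ u‖ = 1 := sum_norm_prodWeight hξ h0
  have h1 : bernstein L N g ξ - g ξ
      = ∑ u, (g (rootMean L N u) - g ξ) * prodWeight L N ξ u := by
    simp only [sub_mul, sum_sub_distrib, ← mul_sum, sum_prodWeight, mul_one, bernstein]
  have h2 : ∀ u, ‖g (rootMean L N u) - g ξ‖
      ≤ ε + 2 * C / δ ^ 2 * ‖rootMean L N u - ξ‖ ^ 2 := by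
    intro u
    rcases lt_or_ge ‖rootMean L N u - ξ‖ δ with h | h
    · have := hg _ (norm_rootMean_le u) h
      have : 0 ≤ 2 * C / δ ^ 2 * ‖rootMean L N u - ξ‖ ^ 2 := by positivity
      linarith
    · have h3 : ‖g (rootMean L N u) - g ξ‖ ≤ 2 * C := by
        refine (norm_sub_le _ _).trans ?_
        linarith [hC _ (norm_rootMean_le u), hC ξ hξ.le]
      have h4 : 2 * C ≤ 2 * C / δ ^ 2 * ‖rootMean L N u - ξ‖ ^ 2 := by
        rw [div_mul_eq_mul_div, le_div_iff₀ (by positivity)]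
        gcongr
      linarith
  rw [h1]
  calc _ ≤ ∑ u, (ε + 2 * C / δ ^ 2 * ‖rootMean L N u - ξ‖ ^ 2) * ‖prodWeight L N ξ u‖ := by
        refine (norm_sum_le _ _).trans (sum_le_sum fun u _ => ?_)
        rw [norm_mul]
        exact mul_le_mul_of_nonneg_right (h2 u) (norm_nonneg _)
    _ = ε + 2 * C / δ ^ 2 * ∑ u, ‖prodWeight L N ξ u‖ * ‖rootMean L N u - ξ‖ ^ 2 := by
        simp only [add_mul, sum_add_distrib, ← mul_sum, hone, mul_one]
        rw [mul_sum]
        congr 1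
        refine sum_congr rfl fun u _ => ?_
        ring
    _ ≤ _ := by
        gcongr
        exact sum_prodWeight_mul_norm_sq hL hN hξ h0

end Bernstein

section InfiniteDimension

open Filter Topology

variable {L N : ℕ}

/-- The coefficients of `bernstein L N g` in the monomials `ξ ^ m * conj ξ ^ n`. -/
def bernCoeff (L N : ℕ) (g : ℂ → ℂ) (i : ℕ × ℕ) : ℝ :=
  ∑ α : Fin N → ZMod (2 * L + 1),
    if i = ∑ j, freqDeg L (α j) then (meanCoeff L N g α).re else 0

variable {g : ℂ → ℂ}

lemma bernCoeff_nonneg (hN : N ≠ 0) (h : PDK (Omega ⊤) fun z w => g (hdot z w)) (i : ℕ × ℕ) :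
    0 ≤ bernCoeff L N g i :=
  sum_nonneg fun α _ => by
    split_ifs
    · exact (Complex.nonneg_iff.1 (meanCoeff_nonneg hN h α)).1
    · exact le_rfl

lemma hasSum_bernCoeff_mul (hN : N ≠ 0) (h : PDK (Omega ⊤) fun z w => g (hdot z w)) (ξ : ℂ) :
    HasSum (fun i => (bernCoeff L N g i : ℂ) * discR ⊤ i.1 i.2 ξ) (bernstein L N g ξ) := by
  have hre : ∀ α : Fin N → ZMod (2 * L + 1),
      ((meanCoeff L N g α).re : ℂ) = meanCoeff L N g α := fun α =>
    (Complex.eq_re_of_ofReal_le (r := 0) (by exact_mod_cast meanCoeff_nonneg hN h α)).symm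
  rw [bernstein_eq_sum]
  have := hasSum_sum (s := (univ : Finset (Fin N → ZMod (2 * L + 1))))
    (f := fun α i => if i = ∑ j, freqDeg L (α j)
      then meanCoeff L N g α * discR ⊤ i.1 i.2 ξ else 0)
    fun α _ => hasSum_single (∑ j, freqDeg L (α j)) fun i hi => if_neg hi
  simp only [if_true] at this
  refine this.congr_fun fun i => ?_
  simp only [bernCoeff, Complex.ofReal_sum, sum_mul]
  refine sum_congr rfl fun α _ => ?_
  split_ifs
  · rw [hre]
  · simp

lemma hasSum_bernCoeff (hN : N ≠ 0) (h : PDK (Omega ⊤) fun z w => g (hdot z w)) :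
    HasSum (bernCoeff L N g) (g 1).re := by
  have := Complex.hasSum_re (hasSum_bernCoeff_mul (L := L) hN h 1)
  simpa [discR_one, bernstein_one hN] using this

lemma sum_bernCoeff_le (hN : N ≠ 0) (h : PDK (Omega ⊤) fun z w => g (hdot z w))
    (s : Finset (ℕ × ℕ)) : ∑ i ∈ s, bernCoeff L N g i ≤ (g 1).re :=
  sum_le_hasSum s (fun i _ => bernCoeff_nonneg hN h i) (hasSum_bernCoeff hN h)

lemma tendsto_bernstein (hg : ContinuousOn g (domD ⊤))
    (h : PDK (Omega ⊤) fun z w => g (hdot z w)) {ξ : ℂ} (hξ : ‖ξ‖ < 1) :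
    Tendsto (fun n : ℕ => bernstein (n + 1) (n + 1) g ξ) atTop (𝓝 (g ξ)) := by
  have hC : ∀ y, ‖y‖ ≤ 1 → ‖g y‖ ≤ (g 1).re := fun y hy =>
    h.norm_le_of_hdot le_top (mem_domD_top.2 hy)
  rw [Metric.tendsto_atTop]
  intro ε hε
  obtain ⟨δ, hδ, hδ'⟩ := Metric.continuousOn_iff.1 hg ξ (mem_domD_top.2 hξ.le) (ε / 2)
    (by positivity)
  have hlim : Tendsto (fun n : ℕ => 2 * (g 1).re / δ ^ 2 * (4 / ((n + 1 : ℕ) : ℝ))) atTop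
      (𝓝 0) := by
    have := (tendsto_const_div_atTop_nhds_zero_nat (4 : ℝ)).comp (tendsto_add_atTop_nat 1)
    simpa using this.const_mul (2 * (g 1).re / δ ^ 2)
  have hpow : Tendsto (fun n : ℕ => 4 * ‖ξ‖ ^ (n + 1 + 1)) atTop (𝓝 0) := by
    have := (tendsto_pow_atTop_nhds_zero_of_lt_one (norm_nonneg ξ) hξ).comp
      (tendsto_add_atTop_nat 2)
    simpa using this.const_mul 4
  have hlt : 0 < 1 - ‖ξ‖ ^ 2 := by nlinarith [norm_nonneg ξ]
  obtain ⟨n₀, hn₀⟩ := eventually_atTop.1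
    ((hlim.eventually (gt_mem_nhds (half_pos hε))).and (hpow.eventually (gt_mem_nhds hlt)))
  refine ⟨n₀, fun n hn => ?_⟩
  obtain ⟨h1, h2⟩ := hn₀ n hn
  rw [dist_eq_norm]
  have := norm_bernstein_sub_le (L := n + 1) (N := n + 1) (by omega) (by omega) hξ h2.le hδ
    (half_pos hε).le hC fun y hy hyξ => by
      have := hδ' y (mem_domD_top.2 hy) (by rwa [dist_eq_norm])
      rw [dist_eq_norm] at this
      exact this.le
  linarith

/-- Every continuous positive definite function on the infinite-dimensional complex sphere has an
expansion with nonnegative coefficients. -/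
theorem exists_isExp_top (hg : ContinuousOn g (domD ⊤))
    (h : PDK (Omega ⊤) fun z w => g (hdot z w)) :
    ∃ a : ℕ × ℕ → ℂ, (∀ i, 0 ≤ a i) ∧ IsExp ⊤ a g := by
  have hmem : ∀ n : ℕ, bernCoeff (n + 1) (n + 1) g ∈
      Set.univ.pi fun _ : ℕ × ℕ => Set.Icc 0 (g 1).re := fun n i _ =>
    ⟨bernCoeff_nonneg (by omega) h i, by
      simpa using sum_bernCoeff_le (L := n + 1) (N := n + 1) (by omega) h {i}⟩
  obtain ⟨c, hc, φ, hφ, hlim⟩ :=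
    (isCompact_univ_pi fun _ : ℕ × ℕ => isCompact_Icc (a := 0) (b := (g 1).re)).tendsto_subseq hmem
  rw [tendsto_pi_nhds] at hlim
  have hc0 : ∀ i, 0 ≤ c i := fun i => (hc i trivial).1
  have hsum : Summable c := by
    refine summable_of_sum_le hc0 (c := (g 1).re) fun s => ?_
    exact le_of_tendsto' (tendsto_finsetSum s fun i _ => hlim i) fun n =>
      sum_bernCoeff_le (by omega) h s
  have hE : IsExp ⊤ (fun i => (c i : ℂ)) fun ξ => ∑' i, (c i : ℂ) * discR ⊤ i.1 i.2 ξ := by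
    refine isExp_tsum le_top (fun i hi => absurd (adm_top i) hi) ?_
    simpa using hsum.norm
  refine ⟨fun i => (c i : ℂ), fun i => Complex.zero_le_real.2 (hc0 i), hE.congr ?_⟩
  have hball : Set.EqOn (fun ξ => ∑' i, (c i : ℂ) * discR ⊤ i.1 i.2 ξ) g (Metric.ball 0 1) := by
    intro ξ hξ
    have hξ' : ‖ξ‖ < 1 := by simpa using hξ
    refine tendsto_nhds_unique ?_ ((tendsto_bernstein hg h hξ').comp hφ.tendsto_atTop)
    have hB : ∀ n, bernstein (φ n + 1) (φ n + 1) g ξ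
        = ∑' i, (bernCoeff (φ n + 1) (φ n + 1) g i : ℂ) * discR ⊤ i.1 i.2 ξ := fun n =>
      (hasSum_bernCoeff_mul (by omega) h ξ).tsum_eq.symm
    refine Tendsto.congr (fun n => (hB n).symm) ?_
    refine tendsto_tsum_of_dominated_convergence
      (bound := fun i : ℕ × ℕ => (g 1).re * (‖ξ‖ ^ i.1 * ‖ξ‖ ^ i.2)) ?_ ?_ ?_
    · refine Summable.mul_left _ (Summable.mul_of_nonneg
        (summable_geometric_of_lt_one (norm_nonneg _) hξ')
        (summable_geometric_of_lt_one (norm_nonneg _) hξ') ?_ ?_)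
      · exact fun _ => by positivity
      · exact fun _ => by positivity
    · exact fun i => ((Complex.continuous_ofReal.tendsto _).comp (hlim i)).mul_const _
    · refine Eventually.of_forall fun n i => ?_
      have h1 := hmem (φ n) i trivial
      rw [norm_mul, discR_top, norm_mul, norm_pow, norm_pow, RCLike.norm_conj, Complex.norm_real,
        Real.norm_eq_abs, abs_of_nonneg h1.1]
      exact mul_le_mul_of_nonneg_right h1.2 (by positivity)
  have hdom : domD ⊤ = Metric.closedBall 0 1 := by simp [domD]
  refine hball.of_subset_closure (hE.continuousOn le_top) hg ?_ ?_
  · rw [hdom]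
    exact Metric.ball_subset_closedBall
  · rw [hdom, closure_ball _ one_ne_zero]

/-- Schoenberg's theorem on the complex sphere `Ω_{2q}`, for `q` finite or infinite. -/
theorem exists_isExp {q : ℕ∞} (hq : 1 ≤ q) (hg : ContinuousOn g (domD q))
    (h : PDK (Omega q) fun z w => g (hdot z w)) :
    ∃ a : ℕ × ℕ → ℂ, (∀ i, 0 ≤ a i) ∧ IsExp q a g := by
  induction q using ENat.recTopCoe with
  | top => exact exists_isExp_top hg h
  | coe n =>
    have hn : 1 ≤ n := by exact_mod_cast hq
    obtain ⟨d, rfl⟩ := Nat.exists_eq_add_of_le' hn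
    exact exists_isExp_nat hg h

end InfiniteDimension

section Product

open Filter Topology

lemma IsExp.sum {q : ℕ∞} {ι : Type*} (s : Finset ι) {a : ι → ℕ × ℕ → ℂ} {g : ι → ℂ → ℂ}
    (h : ∀ k ∈ s, IsExp q (a k) (g k)) :
    IsExp q (fun i => ∑ k ∈ s, a k i) fun ξ => ∑ k ∈ s, g k ξ where
  eq_zero i hi := sum_eq_zero fun k hk => (h k hk).eq_zero i hi
  summable := (summable_sum fun k hk => (h k hk).summable).of_nonneg_of_le
    (fun _ => norm_nonneg _) fun _ => norm_sum_le _ _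
  hasSum ξ hξ := by
    simpa only [sum_mul] using hasSum_sum fun k hk => (h k hk).hasSum ξ hξ

variable {q p : ℕ∞} {f : ℂ → ℂ → ℂ}

/-- The kernel of a function of two variables on a product of spheres is positive definite. -/
def PDK₂ (q p : ℕ∞) (f : ℂ → ℂ → ℂ) : Prop :=
  PDK (Omega q ×ˢ Omega p) fun x y => f (hdot x.1 y.1) (hdot x.2 y.2)

lemma PDK₂.slice (h : PDK₂ q p f) {ι : Type} [Fintype ι] (w : ι → Ell2)
    (hw : ∀ i, w i ∈ Omega p) (c : ι → ℂ) :
    PDK (Omega q) fun z z' =>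
      ∑ μ, ∑ ν, c μ * conj (c ν) * f (hdot z z') (hdot (w μ) (w ν)) := by
  intro κ _ x hx d
  have h1 := h (κ × ι) (fun k => (x k.1, w k.2)) (fun k => ⟨hx _, hw _⟩) fun k => d k.1 * c k.2
  simp only [Fintype.sum_prod_type] at h1
  convert h1 using 1
  refine sum_congr rfl fun k _ => ?_
  rw [sum_comm (s := (univ : Finset ι))]
  refine sum_congr rfl fun l _ => ?_
  rw [mul_sum]
  refine sum_congr rfl fun μ _ => ?_
  rw [mul_sum]
  refine sum_congr rfl fun ν _ => ?_
  rw [map_mul]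
  ring

lemma continuousOn_left (hf : ContinuousOn (fun v : ℂ × ℂ => f v.1 v.2) (domD q ×ˢ domD p))
    {η : ℂ} (hη : η ∈ domD p) : ContinuousOn (fun ξ => f ξ η) (domD q) :=
  hf.comp (f := fun ξ => (ξ, η)) (by fun_prop) fun _ hξ => ⟨hξ, hη⟩

lemma continuousOn_right (hf : ContinuousOn (fun v : ℂ × ℂ => f v.1 v.2) (domD q ×ˢ domD p))
    {ξ : ℂ} (hξ : ξ ∈ domD q) : ContinuousOn (fun η => f ξ η) (domD p) :=
  hf.comp (f := fun η => (ξ, η)) (by fun_prop) fun _ hη => ⟨hξ, hη⟩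

lemma PDK₂.exists_isExp_slice (hq : 1 ≤ q)
    (hf : ContinuousOn (fun v : ℂ × ℂ => f v.1 v.2) (domD q ×ˢ domD p)) (h : PDK₂ q p f)
    {ι : Type} [Fintype ι] (w : ι → Ell2) (hw : ∀ i, w i ∈ Omega p) (c : ι → ℂ) :
    ∃ a : ℕ × ℕ → ℂ, (∀ i, 0 ≤ a i) ∧
      IsExp q a fun ξ => ∑ μ, ∑ ν, c μ * conj (c ν) * f ξ (hdot (w μ) (w ν)) :=
  exists_isExp hq (continuousOn_finsetSum _ fun μ _ => continuousOn_finsetSum _ fun ν _ =>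
    continuousOn_const.mul (continuousOn_left hf (hdot_mem_domD (hw μ) (hw ν))))
    (h.slice w hw c)

/-- By polarization, each section of a positive definite function has an expansion. -/
lemma PDK₂.exists_isExp_section (hq : 1 ≤ q) (hp : 1 ≤ p)
    (hf : ContinuousOn (fun v : ℂ × ℂ => f v.1 v.2) (domD q ×ˢ domD p)) (h : PDK₂ q p f)
    {η : ℂ} (hη : η ∈ domD p) : ∃ a : ℕ × ℕ → ℂ, IsExp q a fun ξ => f ξ η := by
  have hw : ∀ i, ![sec 1, sec η] i ∈ Omega p := by
    intro i
    fin_cases i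
    · exact sec_mem hp (one_mem_domD p)
    · exact sec_mem hp hη
  have key := fun c : ℂ => h.exists_isExp_slice hq hf ![sec 1, sec η] hw ![1, c]
  choose a _ ha using key
  refine ⟨_, (IsExp.const_mul 4⁻¹ (((ha 1).add ((ha (-1)).const_mul (-1))).add
    (((ha Complex.I).const_mul Complex.I).add
      ((ha (-Complex.I)).const_mul (-Complex.I))))).congr fun ξ _ => ?_⟩
  simp only [Pi.add_apply, Fin.sum_univ_two, Matrix.cons_val_zero, Matrix.cons_val_one,
    hdot_sec_one, map_one, map_neg, Complex.conj_I]
  ring_nf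
  simp only [Complex.I_sq]
  ring

lemma continuousOn_coeff (hp : 1 ≤ p) {b F : ℂ → ℂ}
    (hb : PDK (Omega p) fun z w => b (hdot z w)) (hF : ContinuousOn F (domD p))
    (hle : ∀ ζ ∈ domD p, (b 1).re - (b ζ).re ≤ (F 1).re - (F ζ).re) :
    ContinuousOn b (domD p) := by
  intro η hη
  have h1 := sec_mem hp (one_mem_domD p)
  let t : ℂ → ℂ := fun η' => hdot (sec η) (sec η')
  have ht : Continuous t := by
    simp only [t, hdot_sec_sec]
    fun_prop
  have htη : t η = 1 := hdot_self (sec_mem hp hη)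
  have htm : ∀ η' ∈ domD p, t η' ∈ domD p := fun η' h' =>
    hdot_mem_domD (sec_mem hp hη) (sec_mem hp h')
  have hlim : Tendsto (fun η' => (b 1).re * (2 * ((F 1).re - (F (t η')).re))) (𝓝[domD p] η)
      (𝓝 0) := by
    have h2 : Tendsto t (𝓝[domD p] η) (𝓝[domD p] 1) := by
      refine tendsto_nhdsWithin_iff.2 ⟨?_, ?_⟩
      · rw [← htη]
        exact ht.continuousAt.mono_left nhdsWithin_le_nhds
      · filter_upwards [self_mem_nhdsWithin] with η' h' using htm η' h'
    have h3 : Tendsto (fun η' => (F (t η')).re) (𝓝[domD p] η) (𝓝 (F 1).re) :=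
      (Complex.continuous_re.tendsto _).comp ((hF 1 (one_mem_domD p)).tendsto.comp h2)
    have h4 := ((h3.const_sub (F 1).re).const_mul 2).const_mul (b 1).re
    simpa using h4
  have hb1 : 0 ≤ (b 1).re := by
    have := (Complex.nonneg_iff.1 (hb.diag_nonneg h1)).1
    rwa [hdot_self h1] at this
  have hsq : Tendsto (fun η' => ‖b η - b η'‖ ^ 2) (𝓝[domD p] η) (𝓝 0) := by
    refine squeeze_zero' (Eventually.of_forall fun _ => by positivity) ?_ hlim
    filter_upwards [self_mem_nhdsWithin] with η' h'
    have h2 := hb.norm_sub_sq_le h1 (sec_mem hp hη) (sec_mem hp h')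
    simp only [hdot_sec_one, hdot_self h1, hdot_self (sec_mem hp hη),
      hdot_self (sec_mem hp h')] at h2
    refine h2.trans (mul_le_mul_of_nonneg_left ?_ hb1)
    have := hle _ (htm η' h')
    simp only [t] at this ⊢
    linarith
  have hn : Tendsto (fun η' => ‖b η' - b η‖) (𝓝[domD p] η) (𝓝 0) := by
    have := (Real.continuous_sqrt.tendsto 0).comp hsq
    simpa [Function.comp_def, norm_sub_rev] using this
  exact tendsto_iff_norm_sub_tendsto_zero.2 hn

/-- The two-variable expansion of a continuous positive definite function. -/
theorem PDK₂.exists_expansion (hq : 1 ≤ q) (hp : 1 ≤ p)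
    (hf : ContinuousOn (fun v : ℂ × ℂ => f v.1 v.2) (domD q ×ˢ domD p)) (h : PDK₂ q p f) :
    ∃ a : (ℕ × ℕ) × (ℕ × ℕ) → ℝ, (∀ i, 0 ≤ a i) ∧ Summable a ∧
      (∀ i j, ¬ Adm q i → a (i, j) = 0) ∧ (∀ i j, ¬ Adm p j → a (i, j) = 0) ∧
      ∀ ξ ∈ domD q, ∀ η ∈ domD p, HasSum (fun i : (ℕ × ℕ) × (ℕ × ℕ) =>
        (a i : ℂ) * discR q i.1.1 i.1.2 ξ * discR p i.2.1 i.2.2 η) (f ξ η) := by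
  have hsec : ∀ η, ∃ a : ℕ × ℕ → ℂ, η ∈ domD p → IsExp q a fun ξ => f ξ η := fun η => by
    by_cases hη : η ∈ domD p
    · obtain ⟨a, ha⟩ := h.exists_isExp_section hq hp hf hη
      exact ⟨a, fun _ => ha⟩
    · exact ⟨0, fun h' => absurd h' hη⟩
  choose B hB using hsec
  have h1 := one_mem_domD p
  have hBpd : ∀ i, PDK (Omega p) fun z w => B (hdot z w) i := by
    intro i ι _ w hw c
    obtain ⟨a, ha, haE⟩ := h.exists_isExp_slice hq hf w hw c
    have h2 : IsExp q (fun i => ∑ μ, ∑ ν, c μ * conj (c ν) * B (hdot (w μ) (w ν)) i)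
        fun ξ => ∑ μ, ∑ ν, c μ * conj (c ν) * f ξ (hdot (w μ) (w ν)) :=
      IsExp.sum _ fun μ _ => IsExp.sum _ fun ν _ =>
        (hB _ (hdot_mem_domD (hw μ) (hw ν))).const_mul _
    have h3 := congr_fun (isExp_unique hq h2 haE) i
    exact h3 ▸ ha i
  have hBre : ∀ η ∈ domD p, HasSum (fun i => (B η i).re) (f 1 η).re := fun η hη => by
    simpa [discR_one] using Complex.hasSum_re ((hB η hη).hasSum 1 (one_mem_domD q))
  have hBle : ∀ i, ∀ ζ ∈ domD p, (B ζ i).re ≤ (B 1 i).re := fun i ζ hζ =>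
    (Complex.re_le_norm _).trans ((hBpd i).norm_le_of_hdot (g := fun η => B η i) hp hζ)
  have hBcont : ∀ i, ContinuousOn (fun η => B η i) (domD p) := by
    intro i
    refine continuousOn_coeff hp (hBpd i) (continuousOn_right hf (one_mem_domD q)) fun ζ hζ => ?_
    exact le_hasSum ((hBre 1 h1).sub (hBre ζ hζ)) i fun j _ => sub_nonneg.2 (hBle j ζ hζ)
  have hA := fun i => exists_isExp hp (hBcont i) (hBpd i)
  choose A hA0 hAE using hA
  have hAre : ∀ i j, ((A i j).re : ℂ) = A i j := fun i j =>
    (Complex.eq_re_of_ofReal_le (r := 0) (by exact_mod_cast hA0 i j)).symm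
  have hA0' : ∀ i j, 0 ≤ (A i j).re := fun i j => (Complex.nonneg_iff.1 (hA0 i j)).1
  have hA1 : ∀ i, HasSum (fun j => (A i j).re) (B 1 i).re := fun i => by
    simpa [discR_one] using Complex.hasSum_re ((hAE i).hasSum 1 h1)
  have hsum : Summable fun i : (ℕ × ℕ) × (ℕ × ℕ) => (A i.1 i.2).re := by
    rw [summable_prod_of_nonneg fun i => hA0' i.1 i.2]
    refine ⟨fun i => (hA1 i).summable, ?_⟩
    simpa only [(hA1 _).tsum_eq] using (hBre 1 h1).summable
  refine ⟨fun i => (A i.1 i.2).re, fun i => hA0' _ _, hsum, fun i j hi => ?_, fun i j hj => ?_,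
    fun ξ hξ η hη => ?_⟩
  · have h2 := hA1 i
    rw [(hB 1 h1).eq_zero i hi, Complex.zero_re, hasSum_zero_iff_of_nonneg (hA0' i)] at h2
    exact congr_fun h2 j
  · simp [(hAE i).eq_zero j hj]
  · have hs : Summable fun i : (ℕ × ℕ) × (ℕ × ℕ) =>
        ((A i.1 i.2).re : ℂ) * discR q i.1.1 i.1.2 ξ * discR p i.2.1 i.2.2 η := by
      refine Summable.of_norm_bounded hsum fun i => ?_
      rw [norm_mul, norm_mul, Complex.norm_real, Real.norm_eq_abs, abs_of_nonneg (hA0' _ _)]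
      exact mul_le_of_le_one_right (mul_nonneg (hA0' _ _) (norm_nonneg _))
        (norm_discR_le_one hp _ _ hη) |>.trans
          (mul_le_of_le_one_right (hA0' _ _) (norm_discR_le_one hq _ _ hξ))
    have h2 := hs.hasSum.prod_fiberwise (g := fun i => B η i * discR q i.1 i.2 ξ) fun i => by
      simpa only [hAre, mul_right_comm] using ((hAE i).hasSum η hη).mul_right (discR q i.1 i.2 ξ)
    rw [((hB η hη).hasSum ξ hξ).unique h2]
    exact hs.hasSum

lemma pdk₂_of_hasSum (hq : 1 ≤ q) (hp : 1 ≤ p) {a : ℕ × ℕ × ℕ × ℕ → ℝ} (ha : ∀ i, 0 ≤ a i)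
    (hs : Summable a)
    (h : ∀ ξ ∈ domD q, ∀ η ∈ domD p, f ξ η = ∑' i : ℕ × ℕ × ℕ × ℕ,
      (a i : ℂ) * discR q i.1 i.2.1 ξ * discR p i.2.2.1 i.2.2.2 η) : PDK₂ q p f := by
  refine PDK.of_tendsto (l := atTop) (F := fun (s : Finset (ℕ × ℕ × ℕ × ℕ)) x y => ∑ i ∈ s,
    (a i : ℂ) * discR q i.1 i.2.1 (hdot x.1 y.1) * discR p i.2.2.1 i.2.2.2 (hdot x.2 y.2))
    (fun s => ?_) fun x hx y hy => ?_
  · refine PDK.sum s fun i _ => PDK.mul (PDK.mul (PDK.const (Complex.zero_le_real.2 (ha i))) ?_) ?_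
    · exact (pdk_discR q i.1 i.2.1).comp Prod.fst fun y hy => hy.1
    · exact (pdk_discR p i.2.2.1 i.2.2.2).comp Prod.snd fun y hy => hy.2
  · have h1 := hdot_mem_domD hx.1 hy.1
    have h2 := hdot_mem_domD hx.2 hy.2
    rw [h _ h1 _ h2]
    refine (Summable.of_norm_bounded hs fun i => ?_).hasSum
    rw [norm_mul, norm_mul, Complex.norm_real, Real.norm_eq_abs, abs_of_nonneg (ha _)]
    exact mul_le_of_le_one_right (mul_nonneg (ha _) (norm_nonneg _))
      (norm_discR_le_one hp _ _ h2) |>.trans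
        (mul_le_of_le_one_right (ha _) (norm_discR_le_one hq _ _ h1))

end Product

end DiscPD

/-- Lemma 2.3 / `lm_charDD`: for `q, p ∈ ℕ ∪ {∞}` (recall that in
the paper `ℕ = {1, 2, …}`), a continuous `f : 𝔻̃ × 𝔻̃ → ℂ` is PD on `Ω_{2q} × Ω_{2p}`
iff it has an expansion in products of disc polynomials with nonnegative summable
coefficients, which vanish for `mn > 0` if `q = 1` and for `kl > 0` if `p = 1`. -/
theorem stmt4 (q p : ℕ∞) (hq : 1 ≤ q) (hp : 1 ≤ p) (f : ℂ → ℂ → ℂ)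
    (hf : ContinuousOn (fun v : ℂ × ℂ => f v.1 v.2) (domD q ×ˢ domD p)) :
    PDonProd q p f ↔
      ∃ a : ℕ × ℕ × ℕ × ℕ → ℝ, (∀ i, 0 ≤ a i) ∧ Summable a ∧
        (∀ m n k l : ℕ, q = 1 → 0 < m * n → a (m, n, k, l) = 0) ∧
        (∀ m n k l : ℕ, p = 1 → 0 < k * l → a (m, n, k, l) = 0) ∧
        (∀ ξ ∈ domD q, ∀ η ∈ domD p,
          f ξ η = ∑' i : ℕ × ℕ × ℕ × ℕ,
            (a i : ℂ) * discR q i.1 i.2.1 ξ * discR p i.2.2.1 i.2.2.2 η) := by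
  refine Iff.trans DiscPD.isPDKernel_iff ⟨fun h => ?_, ?_⟩
  · obtain ⟨a, h0, hs, hq0, hp0, ha⟩ := DiscPD.PDK₂.exists_expansion hq hp hf h
    let e : ℕ × ℕ × ℕ × ℕ ≃ (ℕ × ℕ) × (ℕ × ℕ) := (Equiv.prodAssoc ℕ ℕ (ℕ × ℕ)).symm
    refine ⟨a ∘ e, fun i => h0 _, e.summable_iff.2 hs, fun m n k l h1 hmn => ?_,
      fun m n k l h1 hkl => ?_, fun ξ hξ η hη => ?_⟩
    · exact hq0 (m, n) (k, l) fun h2 => hmn.ne' (h2 h1)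
    · exact hp0 (m, n) (k, l) fun h2 => hkl.ne' (h2 h1)
    · exact ((e.hasSum_iff.2 (ha ξ hξ η hη)).tsum_eq).symm
  · rintro ⟨a, h0, hs, -, -, ha⟩
    exact DiscPD.pdk₂_of_hasSum hq hp h0 hs ha

end
end

section
/- Let q, p ∈ ℕ ∪ {∞} and let f be a continuous function which is positive definite on Ω_{2q} × Ω_{2p}, with coefficient index set J = {(m,n,k,l) ∈ ℤ₊⁴ : a_{m,n,k,l} > 0} in its expansion in products of disc polynomials, and let J' = {(m−n, k−l) ∈ ℤ² : (m,n,k,l) ∈ J}. If f is strictly positive definite on Ω_{2q} × Ω_{2p}, then J' ∩ (Nℤ+x) × (Mℤ+y) ≠ ∅ for every positive integers N, M, x, y. -/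
open scoped ComplexOrder

noncomputable section

/-- Strict positive definiteness tested on a family of points indexed by any finite type. -/
theorem IsSPDKernel.eq_zero_of_sum_eq_zero {α ι : Type*} [Fintype ι] {S : Set α}
    {K : α → α → ℂ} (hK : IsSPDKernel S K) {x : ι → α} (hxS : ∀ i, x i ∈ S)
    (hx : Function.Injective x) {c : ι → ℂ}
    (h : ∑ μ, ∑ ν, c μ * (starRingEnd ℂ) (c ν) * K (x μ) (x ν) = 0) : c = 0 := by
  let e := (Fintype.equivFin ι).symm
  have hc : c ∘ e = 0 := by
    refine hK.2 _ (x ∘ e) (fun i => hxS _) (hx.comp e.injective) (c ∘ e) ?_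
    rw [← h, ← e.sum_comp]
    refine Finset.sum_congr rfl fun μ _ => ?_
    rw [← e.sum_comp]
    rfl
  funext i
  simpa using congrFun hc (e.symm i)

theorem jacobiR_one (α β k : ℕ) : jacobiR α β k 1 = 1 := by
  have hne : ((k + α).choose k : ℝ) ≠ 0 :=
    Nat.cast_ne_zero.mpr (Nat.choose_pos (Nat.le_add_right k α)).ne'
  unfold jacobiR
  rw [Finset.sum_eq_single 0]
  · simp [hne]
  · intro s _ hs
    simp [hs]
  · simp

/-- On the unit circle every disc polynomial is a monomial. -/
theorem discR_of_norm_eq_one (q : ℕ∞) (m n : ℕ) {ξ : ℂ} (hξ : ‖ξ‖ = 1) :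
    discR q m n ξ = ξ ^ m * (starRingEnd ℂ ξ) ^ n := by
  unfold discR
  split_ifs with h hnm
  · rfl
  all_goals
    have h1 : ξ * (starRingEnd ℂ) ξ = 1 := by simp [Complex.mul_conj', hξ]
    have h2 : (2 * ‖ξ‖ ^ 2 - 1 : ℝ) = 1 := by rw [hξ]; norm_num
    rw [h2, jacobiR_one, Complex.ofReal_one, mul_one]
  · obtain ⟨d, rfl⟩ := Nat.exists_eq_add_of_le hnm
    rw [Nat.add_sub_cancel_left, pow_add, mul_right_comm, ← mul_pow, h1, one_pow, one_mul]
  · obtain ⟨d, rfl⟩ := Nat.exists_eq_add_of_le (le_of_not_ge hnm)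
    rw [Nat.add_sub_cancel_left, pow_add, ← mul_assoc, ← mul_pow, h1, one_pow, one_mul]

theorem discR_mul_conj (q : ℕ∞) (m n : ℕ) {u v : ℂ} (hu : ‖u‖ = 1) (hv : ‖v‖ = 1) :
    discR q m n (u * (starRingEnd ℂ) v) =
      discR q m n u * (starRingEnd ℂ) (discR q m n v) := by
  rw [discR_of_norm_eq_one q m n hu, discR_of_norm_eq_one q m n hv,
    discR_of_norm_eq_one q m n (by simp [hu, hv])]
  simp only [map_mul, map_pow, Complex.conj_conj, mul_pow]
  ring

theorem mem_domD_of_norm_eq_one (q : ℕ∞) {ξ : ℂ} (hξ : ‖ξ‖ = 1) : ξ ∈ domD q := by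
  unfold domD
  split_ifs <;> simp [hξ]

theorem single_mem_Omega {q : ℕ∞} (hq : 1 ≤ q) {u : ℂ} (hu : ‖u‖ = 1) :
    (lp.single 2 0 u : Ell2) ∈ Omega q := by
  refine ⟨by rw [lp.norm_single (by norm_num), hu], fun j hj => ?_⟩
  have hj0 : j ≠ 0 := by
    rintro rfl
    simpa using hq.trans hj
  simp [lp.single_apply, hj0]

theorem hdot_single (u v : ℂ) :
    hdot (lp.single 2 0 u) (lp.single 2 0 v) = u * (starRingEnd ℂ) v := by
  simp [hdot, lp.inner_single_left, lp.single_apply]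

theorem single_zero_injective :
    Function.Injective (fun u : ℂ => (lp.single 2 0 u : Ell2)) := by
  intro u v h
  simpa [lp.single_apply] using congrArg (fun z : Ell2 => z 0) h

/-- Summing the character of frequency `m - n - x` over the `N`-th roots of unity gives zero
unless `N` divides the frequency. -/
theorem sum_zpow_mul_discR_eq_zero (q : ℕ∞) {N : ℕ} {ζ : ℂ} (hN : N ≠ 0)
    (hζ : IsPrimitiveRoot ζ N) (m n : ℕ) (x : ℤ) (h : ¬ (N : ℤ) ∣ (m : ℤ) - n - x) :
    ∑ s : Fin N, (ζ ^ (-x)) ^ (s : ℕ) * discR q m n (ζ ^ (s : ℕ)) = 0 := by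
  have hnorm : ‖ζ‖ = 1 := hζ.norm'_eq_one hN
  have hζ0 : ζ ≠ 0 := hζ.ne_zero hN
  have hconj : (starRingEnd ℂ) ζ = ζ⁻¹ := (Complex.inv_eq_conj hnorm).symm
  have hterm : ∀ s : Fin N, (ζ ^ (-x)) ^ (s : ℕ) * discR q m n (ζ ^ (s : ℕ)) =
      (ζ ^ ((m : ℤ) - n - x)) ^ (s : ℕ) := by
    intro s
    rw [discR_of_norm_eq_one q m n (by simp [hnorm]), map_pow, hconj, pow_right_comm ζ,
      pow_right_comm ζ⁻¹, ← mul_pow, ← mul_pow]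
    congr 1
    rw [sub_eq_add_neg, sub_eq_add_neg, zpow_add₀ hζ0, zpow_add₀ hζ0, zpow_neg ζ n,
      zpow_natCast, zpow_natCast, inv_pow]
    ring
  rw [Finset.sum_congr rfl fun s _ => hterm s,
    Fin.sum_univ_eq_sum_range fun s => (ζ ^ ((m : ℤ) - n - x)) ^ s]
  have hr : ζ ^ ((m : ℤ) - n - x) - 1 ≠ 0 :=
    sub_ne_zero.mpr fun h1 => h ((hζ.zpow_eq_one_iff_dvd _).mp h1)
  refine (mul_eq_zero.mp ?_).resolve_right hr
  rw [geom_sum_mul, ← zpow_natCast, ← zpow_mul, mul_comm, zpow_mul, zpow_natCast, hζ.pow_eq_one,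
    one_zpow, sub_self]

/-- A quadratic form of a summable superposition of rank-one kernels vanishes when every
rank-one form with nonzero weight does. -/
theorem sum_sum_tsum_rankOne_eq_zero {ι κ : Type*} [Fintype ι] {w : κ → ℂ} {φ : κ → ι → ℂ}
    (hs : ∀ μ ν, Summable fun i => w i * (φ i μ * (starRingEnd ℂ) (φ i ν))) (c : ι → ℂ)
    (h : ∀ i, w i ≠ 0 → ∑ μ, c μ * φ i μ = 0) :
    ∑ μ, ∑ ν, c μ * (starRingEnd ℂ) (c ν) *
      ∑' i, w i * (φ i μ * (starRingEnd ℂ) (φ i ν)) = 0 := by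
  have hsum := hasSum_sum (s := Finset.univ) fun μ _ =>
    hasSum_sum (s := Finset.univ) fun ν _ =>
      (hs μ ν).hasSum.mul_left (c μ * (starRingEnd ℂ) (c ν))
  have hterm : ∀ i, ∑ μ, ∑ ν, c μ * (starRingEnd ℂ) (c ν) *
      (w i * (φ i μ * (starRingEnd ℂ) (φ i ν))) = 0 := by
    intro i
    have hfac : ∑ μ, ∑ ν, c μ * (starRingEnd ℂ) (c ν) *
        (w i * (φ i μ * (starRingEnd ℂ) (φ i ν))) =
        w i * ((∑ μ, c μ * φ i μ) * (starRingEnd ℂ) (∑ ν, c ν * φ i ν)) := by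
      rw [map_sum, Finset.sum_mul_sum, Finset.mul_sum]
      refine Finset.sum_congr rfl fun μ _ => ?_
      rw [Finset.mul_sum]
      refine Finset.sum_congr rfl fun ν _ => ?_
      rw [map_mul]
      ring
    rw [hfac]
    by_cases hw : w i = 0
    · simp [hw]
    · simp [h i hw]
  simp only [hterm] at hsum
  exact hsum.unique hasSum_zero

/-- Proposition 3.3 / `th_spd->progr`: if a continuous PD function on
`Ω_{2q} × Ω_{2p}` is SPD, then `J' = {(m-n, k-l) : a_{m,n,k,l} > 0}` intersects every
product of full arithmetic progressions in ℤ. -/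
theorem stmt5 (q p : ℕ∞) (hq : 1 ≤ q) (hp : 1 ≤ p) (f : ℂ → ℂ → ℂ)
    (hf : ContinuousOn (fun v : ℂ × ℂ => f v.1 v.2) (domD q ×ˢ domD p))
    (hPD : PDonProd q p f)
    (a : ℕ × ℕ × ℕ × ℕ → ℝ) (ha0 : ∀ i, 0 ≤ a i) (haS : Summable a)
    (hq1 : ∀ m n k l : ℕ, q = 1 → 0 < m * n → a (m, n, k, l) = 0)
    (hp1 : ∀ m n k l : ℕ, p = 1 → 0 < k * l → a (m, n, k, l) = 0)
    (hexp : ∀ ξ ∈ domD q, ∀ η ∈ domD p,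
      f ξ η = ∑' i : ℕ × ℕ × ℕ × ℕ,
        (a i : ℂ) * discR q i.1 i.2.1 ξ * discR p i.2.2.1 i.2.2.2 η)
    (hSPD : SPDonProd q p f) :
    MeetsAllProgressions
      {v : ℤ × ℤ | ∃ m n k l : ℕ, 0 < a (m, n, k, l) ∧
        v = ((m : ℤ) - (n : ℤ), (k : ℤ) - (l : ℤ))} := by
  intro N M x y hN hM _ _
  by_contra hcon
  lift N to ℕ using hN.le
  lift M to ℕ using hM.le
  have hN0 : N ≠ 0 := by rintro rfl; simp at hN
  have hM0 : M ≠ 0 := by rintro rfl; simp at hM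
  have hζ := Complex.isPrimitiveRoot_exp N hN0
  have hτ := Complex.isPrimitiveRoot_exp M hM0
  generalize Complex.exp (2 * Real.pi * Complex.I / N) = ζ at hζ
  generalize Complex.exp (2 * Real.pi * Complex.I / M) = τ at hτ
  have hζs : ∀ s : ℕ, ‖ζ ^ s‖ = 1 := fun s => by simp [hζ.norm'_eq_one hN0]
  have hτt : ∀ t : ℕ, ‖τ ^ t‖ = 1 := fun t => by simp [hτ.norm'_eq_one hM0]
  let pt : Fin N × Fin M → Ell2 × Ell2 :=
    fun μ => (lp.single 2 0 (ζ ^ (μ.1 : ℕ)), lp.single 2 0 (τ ^ (μ.2 : ℕ)))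
  let c : Fin N × Fin M → ℂ := fun μ => (ζ ^ (-x)) ^ (μ.1 : ℕ) * (τ ^ (-y)) ^ (μ.2 : ℕ)
  let φ : ℕ × ℕ × ℕ × ℕ → Fin N × Fin M → ℂ := fun i μ =>
    discR q i.1 i.2.1 (ζ ^ (μ.1 : ℕ)) * discR p i.2.2.1 i.2.2.2 (τ ^ (μ.2 : ℕ))
  have hφ : ∀ i μ, ‖φ i μ‖ = 1 := by
    intro i μ
    simp only [φ, discR_of_norm_eq_one q _ _ (hζs μ.1), discR_of_norm_eq_one p _ _ (hτt μ.2)]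
    simp [hζ.norm'_eq_one hN0, hτ.norm'_eq_one hM0]
  have hpt : Function.Injective pt := by
    intro μ ν h
    obtain ⟨h1, h2⟩ := Prod.ext_iff.mp h
    exact Prod.ext (Fin.ext (hζ.pow_inj μ.1.2 ν.1.2 (single_zero_injective h1)))
      (Fin.ext (hτ.pow_inj μ.2.2 ν.2.2 (single_zero_injective h2)))
  have hker : ∀ μ ν, f (hdot (pt μ).1 (pt ν).1) (hdot (pt μ).2 (pt ν).2) =
      ∑' i, (a i : ℂ) * (φ i μ * (starRingEnd ℂ) (φ i ν)) := by
    intro μ ν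
    simp only [pt, hdot_single]
    rw [hexp _ (mem_domD_of_norm_eq_one q (by simp [hζ.norm'_eq_one hN0]))
      _ (mem_domD_of_norm_eq_one p (by simp [hτ.norm'_eq_one hM0]))]
    refine tsum_congr fun i => ?_
    rw [discR_mul_conj q _ _ (hζs _) (hζs _), discR_mul_conj p _ _ (hτt _) (hτt _)]
    simp only [φ, map_mul]
    ring
  have hsumm : ∀ μ ν, Summable fun i => (a i : ℂ) * (φ i μ * (starRingEnd ℂ) (φ i ν)) := by
    intro μ ν
    refine Summable.of_norm ?_
    simpa [hφ] using haS.abs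
  have hvanish : ∀ i, (a i : ℂ) ≠ 0 → ∑ μ, c μ * φ i μ = 0 := by
    rintro ⟨m, n, k, l⟩ hi
    have hpos : 0 < a (m, n, k, l) := (ha0 _).lt_of_ne' (by exact_mod_cast hi)
    have hprod : ∑ μ, c μ * φ (m, n, k, l) μ =
        (∑ s : Fin N, (ζ ^ (-x)) ^ (s : ℕ) * discR q m n (ζ ^ (s : ℕ))) *
          ∑ t : Fin M, (τ ^ (-y)) ^ (t : ℕ) * discR p k l (τ ^ (t : ℕ)) := by
      rw [Finset.sum_mul_sum, Fintype.sum_prod_type]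
      refine Finset.sum_congr rfl fun s _ => Finset.sum_congr rfl fun t _ => ?_
      simp only [c, φ]
      ring
    rw [hprod]
    by_cases h1 : (N : ℤ) ∣ (m : ℤ) - n - x
    · by_cases h2 : (M : ℤ) ∣ (k : ℤ) - l - y
      · obtain ⟨j, hj⟩ := h1
        obtain ⟨j', hj'⟩ := h2
        exact absurd ⟨_, ⟨m, n, k, l, hpos, rfl⟩, ⟨j, by linarith⟩, ⟨j', by linarith⟩⟩ hcon
      · rw [sum_zpow_mul_discR_eq_zero p hM0 hτ k l y h2, mul_zero]
    · rw [sum_zpow_mul_discR_eq_zero q hN0 hζ m n x h1, zero_mul]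
  have hc : c = 0 := by
    refine IsSPDKernel.eq_zero_of_sum_eq_zero hSPD (x := pt)
      (fun μ => ⟨single_mem_Omega hq (hζs _), single_mem_Omega hp (hτt _)⟩) hpt ?_
    simp only [hker]
    exact sum_sum_tsum_rankOne_eq_zero hsumm c hvanish
  have h0 := congrFun hc (⟨0, Nat.pos_of_ne_zero hN0⟩, ⟨0, Nat.pos_of_ne_zero hM0⟩)
  simp [c] at h0

end
end
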